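/- arXiv:2312.01819 — 3 statements merged into one kernel-verified Lean document; each statement's English description precedes it below -/
import Mathlib

section
/- For every α ∈ (0,3] and every t ∈ (0, t_α), ∂²h_α(p(·,t))/∂t² ≤ 0; that is, the Rényi entropy h_α(p(·,t)) (Shannon entropy when α = 1) is a concave function of t on (0, t_α) for all orders 0 < α ≤ 3. -/
open MeasureTheory Real Filter
open scoped Classical

/-- The density `p(x,t)` of `X + √t Z` along the heat flow. -/
noncomputable def heatP (f : ℝ → ℝ) (t x : ℝ) : ℝ :=
  ∫ y : ℝ, f y * ((Real.sqrt (2 * Real.pi * t))⁻¹ * Real.exp (-(x - y) ^ 2 / (2 * t)))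

/-- `p_k(x,t) = ∂^k p / ∂x^k`. -/
noncomputable def pk (f : ℝ → ℝ) (k : ℕ) (t x : ℝ) : ℝ :=
  iteratedDeriv k (heatP f t) x

/-- `p̄_i = p_i / p`. -/
noncomputable def pbar (f : ℝ → ℝ) (i : ℕ) (t x : ℝ) : ℝ :=
  pk f i t x / heatP f t x

/-- The Rényi entropy `h_α(p(·,t))`, with the Shannon entropy at `α = 1`. -/
noncomputable def renyiEnt (f : ℝ → ℝ) (α t : ℝ) : ℝ :=
  if α = 1 then -∫ x : ℝ, heatP f t x * Real.log (heatP f t x)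
  else (1 - α)⁻¹ * Real.log (∫ x : ℝ, heatP f t x ^ α)

/-- Finiteness `|h_α(p(·,t))| < ∞` of the Rényi entropy at time `t`. -/
def renyiFinite (f : ℝ → ℝ) (α t : ℝ) : Prop :=
  if α = 1 then Integrable (fun x : ℝ => heatP f t x * Real.log (heatP f t x))
  else Integrable (fun x : ℝ => heatP f t x ^ α) ∧ 0 < ∫ x : ℝ, heatP f t x ^ α

/-- `t < t_α` where `t_α = sup { s > 0 : |h_α(p(·,s))| < ∞ }`. -/
def ltTalpha (f : ℝ → ℝ) (α t : ℝ) : Prop :=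
  ∃ s : ℝ, t < s ∧ 0 < s ∧ renyiFinite f α s

/-- The tilted expectation `E_α[g] = (∫ g p^α) / (∫ p^α)`. -/
noncomputable def Ea (f : ℝ → ℝ) (α t : ℝ) (g : ℝ → ℝ) : ℝ :=
  (∫ x : ℝ, g x * heatP f t x ^ α) / (∫ x : ℝ, heatP f t x ^ α)

/-- Abstract package of the facts on the heat flow used in the computation. -/
structure HeatPack (p v1 v2 v3 R : ℝ → ℝ → ℝ) (P : ℝ → ℝ) (a b K : ℝ) : Prop where
  pos : ∀ τ ∈ Set.Ioo a b, ∀ x, 0 < p τ x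
  px : ∀ τ ∈ Set.Ioo a b, ∀ x, HasDerivAt (p τ) (p τ x * v1 τ x) x
  v1x : ∀ τ ∈ Set.Ioo a b, ∀ x, HasDerivAt (v1 τ) (v2 τ x) x
  v2x : ∀ τ ∈ Set.Ioo a b, ∀ x, HasDerivAt (v2 τ) (v3 τ x) x
  v3c : ∀ τ ∈ Set.Ioo a b, Continuous (v3 τ)
  pt : ∀ τ ∈ Set.Ioo a b, ∀ x,
    HasDerivAt (fun σ => p σ x) (p τ x * ((v2 τ x + v1 τ x ^ 2) / 2)) τ
  v1t : ∀ τ ∈ Set.Ioo a b, ∀ x,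
    HasDerivAt (fun σ => v1 σ x) ((v3 τ x + 2 * v1 τ x * v2 τ x) / 2) τ
  R1 : ∀ τ ∈ Set.Ioo a b, ∀ x, 1 ≤ R τ x
  Ppos : ∀ x, 0 < P x
  Kpos : 0 < K
  pR : ∀ τ ∈ Set.Ioo a b, ∀ x, p τ x * R τ x ≤ K * P x
  Pp : ∀ τ ∈ Set.Ioo a b, ∀ x, P x ≤ p τ x * R τ x
  bd : ∀ β : ℝ, 0 < β → β ≤ 1 → ∃ C, ∀ τ ∈ Set.Ioo a b, ∀ x,
    |v1 τ x| ≤ C * R τ x ^ β ∧ |v2 τ x| ≤ C * R τ x ^ β ∧ |v3 τ x| ≤ C * R τ x ^ β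

namespace HeatPack

variable {p v1 v2 v3 R : ℝ → ℝ → ℝ} {P : ℝ → ℝ} {a b K : ℝ}

lemma bdS (H : HeatPack p v1 v2 v3 R P a b K) {β : ℝ} (hβ : 0 < β) :
    ∃ C, 0 < C ∧ ∀ τ ∈ Set.Ioo a b, ∀ x,
      (1 + |v1 τ x| + |v2 τ x| + |v3 τ x|) ^ 4 ≤ C * R τ x ^ β := by
  obtain ⟨C, hC⟩ := H.bd (min (β / 4) 1) (lt_min (by linarith) one_pos) (min_le_right _ _)
  refine ⟨(1 + 3 * |C|) ^ 4, by positivity, fun τ hτ x => ?_⟩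
  obtain ⟨h1, h2, h3⟩ := hC τ hτ x
  have hR := H.R1 τ hτ x
  set r := R τ x ^ (min (β / 4) 1) with hr
  have hr1 : 1 ≤ r := Real.one_le_rpow hR (by positivity)
  have hCr : C * r ≤ |C| * r := by gcongr; exact le_abs_self C
  have : 1 + |v1 τ x| + |v2 τ x| + |v3 τ x| ≤ (1 + 3 * |C|) * r := by linarith
  calc _ ≤ ((1 + 3 * |C|) * r) ^ 4 := by gcongr
    _ = (1 + 3 * |C|) ^ 4 * r ^ 4 := by ring
    _ ≤ _ := by
      gcongr
      rw [hr, ← Real.rpow_natCast, ← Real.rpow_mul (by linarith)]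
      apply Real.rpow_le_rpow_of_exponent_le hR
      have := min_le_left (β / 4) 1
      push_cast; linarith

lemma dom (H : HeatPack p v1 v2 v3 R P a b K) {α : ℝ} (hα : 0 < α) :
    ∃ C, 0 < C ∧ ∀ τ ∈ Set.Ioo a b, ∀ x,
      p τ x ^ α * (1 + |v1 τ x| + |v2 τ x| + |v3 τ x|) ^ 4 ≤ C * P x ^ α := by
  obtain ⟨C, hC0, hC⟩ := H.bdS hα
  refine ⟨C * K ^ α, by have := H.Kpos; positivity, fun τ hτ x => ?_⟩
  have hp := H.pos τ hτ x
  have hR := H.R1 τ hτ x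
  calc _ ≤ p τ x ^ α * (C * R τ x ^ α) := by gcongr; exact hC τ hτ x
    _ = C * (p τ x * R τ x) ^ α := by rw [Real.mul_rpow hp.le (by linarith)]; ring
    _ ≤ C * (K * P x) ^ α := by
      have := H.pR τ hτ x
      have h0 : 0 ≤ p τ x * R τ x := by positivity
      exact mul_le_mul_of_nonneg_left (Real.rpow_le_rpow h0 this hα.le) hC0.le
    _ = _ := by rw [Real.mul_rpow H.Kpos.le (H.Ppos x).le]; ring

lemma pc (H : HeatPack p v1 v2 v3 R P a b K) {τ : ℝ} (hτ : τ ∈ Set.Ioo a b) :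
    Continuous (p τ) :=
  continuous_iff_continuousAt.2 fun x => (H.px τ hτ x).continuousAt

lemma v1c (H : HeatPack p v1 v2 v3 R P a b K) {τ : ℝ} (hτ : τ ∈ Set.Ioo a b) :
    Continuous (v1 τ) :=
  continuous_iff_continuousAt.2 fun x => (H.v1x τ hτ x).continuousAt

lemma v2c (H : HeatPack p v1 v2 v3 R P a b K) {τ : ℝ} (hτ : τ ∈ Set.Ioo a b) :
    Continuous (v2 τ) :=
  continuous_iff_continuousAt.2 fun x => (H.v2x τ hτ x).continuousAt

lemma pac (H : HeatPack p v1 v2 v3 R P a b K) {τ : ℝ} (hτ : τ ∈ Set.Ioo a b) (α : ℝ) :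
    Continuous (fun x => p τ x ^ α) :=
  (H.pc hτ).rpow_const fun x => Or.inl (H.pos τ hτ x).ne'

lemma integ (H : HeatPack p v1 v2 v3 R P a b K) {α : ℝ} (hα : 0 < α)
    (hP : Integrable fun x => P x ^ α) {τ : ℝ} (hτ : τ ∈ Set.Ioo a b) {w : ℝ → ℝ}
    (hw : Continuous w) {c : ℝ}
    (hwb : ∀ x, |w x| ≤ c * (1 + |v1 τ x| + |v2 τ x| + |v3 τ x|) ^ 4) :
    Integrable fun x => p τ x ^ α * w x := by
  obtain ⟨C, hC0, hC⟩ := H.dom hα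
  refine (hP.const_mul (|c| * C)).mono' ((H.pac hτ α).mul hw).aestronglyMeasurable
    (Eventually.of_forall fun x => ?_)
  have hp := (H.pos τ hτ x).le
  rw [Real.norm_eq_abs, abs_mul, abs_of_nonneg (Real.rpow_nonneg hp α)]
  calc _ ≤ p τ x ^ α * (|c| * (1 + |v1 τ x| + |v2 τ x| + |v3 τ x|) ^ 4) := by
        gcongr
        refine (hwb x).trans ?_
        gcongr
        exact le_abs_self c
    _ = |c| * (p τ x ^ α * (1 + |v1 τ x| + |v2 τ x| + |v3 τ x|) ^ 4) := by ring
    _ ≤ |c| * (C * P x ^ α) := mul_le_mul_of_nonneg_left (hC τ hτ x) (abs_nonneg c)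
    _ = _ := by ring

lemma hasDerivAt_pow_x (H : HeatPack p v1 v2 v3 R P a b K) (α : ℝ) {τ : ℝ}
    (hτ : τ ∈ Set.Ioo a b) (x : ℝ) :
    HasDerivAt (fun x => p τ x ^ α) (p τ x ^ α * (α * v1 τ x)) x := by
  have hp := H.pos τ hτ x
  refine ((H.px τ hτ x).rpow_const (p := α) (Or.inl hp.ne')).congr_deriv ?_
  rw [Real.rpow_sub_one hp.ne']
  field_simp

lemma hasDerivAt_pow_t (H : HeatPack p v1 v2 v3 R P a b K) (α : ℝ) {τ : ℝ}
    (hτ : τ ∈ Set.Ioo a b) (x : ℝ) :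
    HasDerivAt (fun σ => p σ x ^ α)
      (p τ x ^ α * (α * ((v2 τ x + v1 τ x ^ 2) / 2))) τ := by
  have hp := H.pos τ hτ x
  refine ((H.pt τ hτ x).rpow_const (p := α) (Or.inl hp.ne')).congr_deriv ?_
  rw [Real.rpow_sub_one hp.ne']
  field_simp

lemma ibp (H : HeatPack p v1 v2 v3 R P a b K) {α : ℝ} (hα : 0 < α)
    (hP : Integrable fun x => P x ^ α) {τ : ℝ} (hτ : τ ∈ Set.Ioo a b) {w w' : ℝ → ℝ}
    (hw' : Continuous w') (hd : ∀ x, HasDerivAt w (w' x) x) {c c' : ℝ}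
    (hwb : ∀ x, |w x| ≤ c * (1 + |v1 τ x| + |v2 τ x| + |v3 τ x|) ^ 4)
    (hwb' : ∀ x, |α * v1 τ x * w x + w' x| ≤
      c' * (1 + |v1 τ x| + |v2 τ x| + |v3 τ x|) ^ 4) :
    ∫ x, p τ x ^ α * (α * v1 τ x * w x + w' x) = 0 := by
  have hwc : Continuous w := continuous_iff_continuousAt.2 fun x => (hd x).continuousAt
  refine integral_eq_zero_of_hasDerivAt_of_integrable (f := fun x => p τ x ^ α * w x)
    (fun x => ?_) (H.integ hα hP hτ ?_ hwb') (H.integ hα hP hτ hwc hwb)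
  · refine ((H.hasDerivAt_pow_x α hτ x).mul (hd x)).congr_deriv ?_
    ring
  · have := H.v1c hτ
    fun_prop

lemma leibniz (H : HeatPack p v1 v2 v3 R P a b K) {α : ℝ} (hα : 0 < α)
    (hP : Integrable fun x => P x ^ α) {τ : ℝ} (hτ : τ ∈ Set.Ioo a b) {w w' : ℝ → ℝ → ℝ}
    (hwc : ∀ σ ∈ Set.Ioo a b, Continuous (w σ)) (hwc' : ∀ σ ∈ Set.Ioo a b, Continuous (w' σ))
    (hd : ∀ σ ∈ Set.Ioo a b, ∀ x, HasDerivAt (fun σ => w σ x) (w' σ x) σ) {c c' : ℝ}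
    (hwb : ∀ σ ∈ Set.Ioo a b, ∀ x,
      |w σ x| ≤ c * (1 + |v1 σ x| + |v2 σ x| + |v3 σ x|) ^ 4)
    (hwb' : ∀ σ ∈ Set.Ioo a b, ∀ x, |α * ((v2 σ x + v1 σ x ^ 2) / 2) * w σ x + w' σ x| ≤
      c' * (1 + |v1 σ x| + |v2 σ x| + |v3 σ x|) ^ 4) :
    HasDerivAt (fun σ => ∫ x, p σ x ^ α * w σ x)
      (∫ x, p τ x ^ α * (α * ((v2 τ x + v1 τ x ^ 2) / 2) * w τ x + w' τ x)) τ := by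
  obtain ⟨C, hC0, hC⟩ := H.dom hα
  have hn : Set.Ioo a b ∈ nhds τ := isOpen_Ioo.mem_nhds hτ
  refine (hasDerivAt_integral_of_dominated_loc_of_deriv_le
    (F' := fun σ x => p σ x ^ α * (α * ((v2 σ x + v1 σ x ^ 2) / 2) * w σ x + w' σ x))
    (bound := fun x => |c'| * C * P x ^ α) hn ?_ ?_ ?_ ?_ ?_ ?_).2
  · filter_upwards [hn] with σ hσ
    exact ((H.pac hσ α).mul (hwc σ hσ)).aestronglyMeasurable
  · exact H.integ hα hP hτ (hwc τ hτ) (hwb τ hτ)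
  · have h1 := H.v1c hτ
    have h2 := H.v2c hτ
    have h3 := hwc τ hτ
    have h4 := hwc' τ hτ
    exact ((H.pac hτ α).mul (by fun_prop)).aestronglyMeasurable
  · refine Eventually.of_forall fun x σ hσ => ?_
    have hp := (H.pos σ hσ x).le
    rw [Real.norm_eq_abs, abs_mul, abs_of_nonneg (Real.rpow_nonneg hp α)]
    calc _ ≤ p σ x ^ α * (|c'| * (1 + |v1 σ x| + |v2 σ x| + |v3 σ x|) ^ 4) := by
          gcongr
          refine (hwb' σ hσ x).trans ?_
          gcongr
          exact le_abs_self c'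
      _ = |c'| * (p σ x ^ α * (1 + |v1 σ x| + |v2 σ x| + |v3 σ x|) ^ 4) := by ring
      _ ≤ |c'| * (C * P x ^ α) := mul_le_mul_of_nonneg_left (hC σ hσ x) (abs_nonneg c')
      _ = _ := by ring
  · exact hP.const_mul _
  · refine Eventually.of_forall fun x σ hσ => ?_
    refine ((H.hasDerivAt_pow_t α hσ x).mul (hd σ hσ x)).congr_deriv ?_
    ring

end HeatPack

/-- Elementary bounds of monomials by the fourth power of `1 + |x| + |y| + |z|`. -/
lemma mono_bd (x y z : ℝ) (i j k : ℕ) (h : i + j + k ≤ 4) :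
    |x ^ i * y ^ j * z ^ k| ≤ (1 + |x| + |y| + |z|) ^ 4 := by
  have hx := abs_nonneg x
  have hy := abs_nonneg y
  have hz := abs_nonneg z
  rw [abs_mul, abs_mul, abs_pow, abs_pow, abs_pow]
  calc _ ≤ (1 + |x| + |y| + |z|) ^ i * (1 + |x| + |y| + |z|) ^ j *
        (1 + |x| + |y| + |z|) ^ k := by gcongr <;> linarith
    _ = (1 + |x| + |y| + |z|) ^ (i + j + k) := by ring
    _ ≤ _ := pow_le_pow_right₀ (by linarith) h

lemma lin4_bd {A B C D S : ℝ} (hA : |A| ≤ S) (hB : |B| ≤ S) (hC : |C| ≤ S) (hD : |D| ≤ S)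
    (c1 c2 c3 c4 : ℝ) :
    |c1 * A + c2 * B + c3 * C + c4 * D| ≤ (|c1| + |c2| + |c3| + |c4|) * S := by
  have e1 : |c1 * A| ≤ |c1| * S := by rw [abs_mul]; gcongr
  have e2 : |c2 * B| ≤ |c2| * S := by rw [abs_mul]; gcongr
  have e3 : |c3 * C| ≤ |c3| * S := by rw [abs_mul]; gcongr
  have e4 : |c4 * D| ≤ |c4| * S := by rw [abs_mul]; gcongr
  have t1 := abs_add_le (c1 * A + c2 * B + c3 * C) (c4 * D)
  have t2 := abs_add_le (c1 * A + c2 * B) (c3 * C)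
  have t3 := abs_add_le (c1 * A) (c2 * B)
  linarith

lemma int_lin4 {A B C D : ℝ → ℝ} (hA : Integrable A) (hB : Integrable B) (hC : Integrable C)
    (hD : Integrable D) (c1 c2 c3 c4 : ℝ) :
    ∫ x, (c1 * A x + c2 * B x + c3 * C x + c4 * D x) =
      c1 * (∫ x, A x) + c2 * (∫ x, B x) + c3 * (∫ x, C x) + c4 * (∫ x, D x) := by
  rw [integral_add, integral_add, integral_add]
  · simp only [integral_const_mul]
  · exact hA.const_mul _
  · exact hB.const_mul _
  · exact (hA.const_mul _).add (hB.const_mul _)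
  · exact hC.const_mul _
  · exact ((hA.const_mul _).add (hB.const_mul _)).add (hC.const_mul _)
  · exact hD.const_mul _

namespace HeatPack

variable {p v1 v2 v3 R : ℝ → ℝ → ℝ} {P : ℝ → ℝ} {a b K : ℝ}

lemma imon (H : HeatPack p v1 v2 v3 R P a b K) {α : ℝ} (hα : 0 < α)
    (hP : Integrable fun x => P x ^ α) {τ : ℝ} (hτ : τ ∈ Set.Ioo a b) (i j k : ℕ)
    (h : i + j + k ≤ 4) :
    Integrable fun x => p τ x ^ α * (v1 τ x ^ i * v2 τ x ^ j * v3 τ x ^ k) := by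
  have h1 := H.v1c hτ
  have h2 := H.v2c hτ
  have h3 := H.v3c τ hτ
  refine H.integ hα hP hτ (c := 1) (by fun_prop) fun x => ?_
  rw [one_mul]
  exact mono_bd _ _ _ i j k h

/-- First integration by parts identity. -/
lemma ibp1 (H : HeatPack p v1 v2 v3 R P a b K) {α : ℝ} (hα : 0 < α)
    (hP : Integrable fun x => P x ^ α) {τ : ℝ} (hτ : τ ∈ Set.Ioo a b) :
    ∫ x, p τ x ^ α * v2 τ x = -α * ∫ x, p τ x ^ α * v1 τ x ^ 2 := by
  have key := H.ibp hα hP hτ (w := v1 τ) (w' := v2 τ) (c := 1) (c' := |α| + |1| + |0| + |0|)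
    (H.v2c hτ) (H.v1x τ hτ)
    (fun x => by simpa using mono_bd (v1 τ x) (v2 τ x) (v3 τ x) 1 0 0 (by norm_num))
    (fun x => by
      refine le_of_eq_of_le ?_ (lin4_bd (mono_bd (v1 τ x) (v2 τ x) (v3 τ x) 2 0 0 (by norm_num))
        (mono_bd (v1 τ x) (v2 τ x) (v3 τ x) 0 1 0 (by norm_num))
        (mono_bd (v1 τ x) (v2 τ x) (v3 τ x) 0 0 0 (by norm_num))
        (mono_bd (v1 τ x) (v2 τ x) (v3 τ x) 0 0 0 (by norm_num)) α 1 0 0)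
      congr 1; ring)
  have e := int_lin4 (H.imon hα hP hτ 2 0 0 (by norm_num)) (H.imon hα hP hτ 0 1 0 (by norm_num))
    (H.imon hα hP hτ 0 0 0 (by norm_num)) (H.imon hα hP hτ 0 0 0 (by norm_num)) α 1 0 0
  rw [integral_congr_ae (g := fun x => p τ x ^ α * (α * v1 τ x * v1 τ x + v2 τ x))
    (Eventually.of_forall fun x => by ring), key] at e
  simp only [pow_zero, mul_one, one_mul, pow_one, zero_mul, add_zero] at e
  linarith

lemma ibp3 (H : HeatPack p v1 v2 v3 R P a b K) {α : ℝ} (hα : 0 < α)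
    (hP : Integrable fun x => P x ^ α) {τ : ℝ} (hτ : τ ∈ Set.Ioo a b) :
    3 * ∫ x, p τ x ^ α * (v1 τ x ^ 2 * v2 τ x) = -α * ∫ x, p τ x ^ α * v1 τ x ^ 4 := by
  have h1 := H.v1c hτ
  have h2 := H.v2c hτ
  have key := H.ibp hα hP hτ (w := fun x => v1 τ x ^ 3)
    (w' := fun x => 3 * v1 τ x ^ 2 * v2 τ x) (c := 1) (c' := |α| + |3| + |0| + |0|)
    (by fun_prop) (fun x => ((H.v1x τ hτ x).pow 3).congr_deriv (by norm_num))
    (fun x => by simpa using mono_bd (v1 τ x) (v2 τ x) (v3 τ x) 3 0 0 (by norm_num))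
    (fun x => by
      refine le_of_eq_of_le ?_ (lin4_bd (mono_bd (v1 τ x) (v2 τ x) (v3 τ x) 4 0 0 (by norm_num))
        (mono_bd (v1 τ x) (v2 τ x) (v3 τ x) 2 1 0 (by norm_num))
        (mono_bd (v1 τ x) (v2 τ x) (v3 τ x) 0 0 0 (by norm_num))
        (mono_bd (v1 τ x) (v2 τ x) (v3 τ x) 0 0 0 (by norm_num)) α 3 0 0)
      congr 1; ring)
  have e := int_lin4 (H.imon hα hP hτ 4 0 0 (by norm_num)) (H.imon hα hP hτ 2 1 0 (by norm_num))
    (H.imon hα hP hτ 0 0 0 (by norm_num)) (H.imon hα hP hτ 0 0 0 (by norm_num)) α 3 0 0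
  rw [integral_congr_ae
    (g := fun x => p τ x ^ α * (α * v1 τ x * v1 τ x ^ 3 + 3 * v1 τ x ^ 2 * v2 τ x))
    (Eventually.of_forall fun x => by ring), key] at e
  simp only [pow_zero, mul_one, one_mul, pow_one, zero_mul, add_zero] at e
  linarith

lemma ibp2 (H : HeatPack p v1 v2 v3 R P a b K) {α : ℝ} (hα : 0 < α)
    (hP : Integrable fun x => P x ^ α) {τ : ℝ} (hτ : τ ∈ Set.Ioo a b) :
    ∫ x, p τ x ^ α * (v1 τ x * v3 τ x) =
      -α * (∫ x, p τ x ^ α * (v1 τ x ^ 2 * v2 τ x)) - ∫ x, p τ x ^ α * v2 τ x ^ 2 := by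
  have h1 := H.v1c hτ
  have h2 := H.v2c hτ
  have h3 := H.v3c τ hτ
  have key := H.ibp hα hP hτ (w := fun x => v1 τ x * v2 τ x)
    (w' := fun x => v2 τ x * v2 τ x + v1 τ x * v3 τ x) (c := 1) (c' := |α| + |1| + |1| + |0|)
    (by fun_prop) (fun x => (H.v1x τ hτ x).mul (H.v2x τ hτ x))
    (fun x => by simpa using mono_bd (v1 τ x) (v2 τ x) (v3 τ x) 1 1 0 (by norm_num))
    (fun x => by
      refine le_of_eq_of_le ?_ (lin4_bd (mono_bd (v1 τ x) (v2 τ x) (v3 τ x) 2 1 0 (by norm_num))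
        (mono_bd (v1 τ x) (v2 τ x) (v3 τ x) 0 2 0 (by norm_num))
        (mono_bd (v1 τ x) (v2 τ x) (v3 τ x) 1 0 1 (by norm_num))
        (mono_bd (v1 τ x) (v2 τ x) (v3 τ x) 0 0 0 (by norm_num)) α 1 1 0)
      congr 1; ring)
  have e := int_lin4 (H.imon hα hP hτ 2 1 0 (by norm_num)) (H.imon hα hP hτ 0 2 0 (by norm_num))
    (H.imon hα hP hτ 1 0 1 (by norm_num)) (H.imon hα hP hτ 0 0 0 (by norm_num)) α 1 1 0
  rw [integral_congr_ae
    (g := fun x => p τ x ^ α * (α * v1 τ x * (v1 τ x * v2 τ x) +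
      (v2 τ x * v2 τ x + v1 τ x * v3 τ x)))
    (Eventually.of_forall fun x => by ring), key] at e
  simp only [pow_zero, mul_one, one_mul, pow_one, zero_mul, add_zero] at e
  linarith

lemma phi_deriv (H : HeatPack p v1 v2 v3 R P a b K) {α : ℝ} (hα : 0 < α)
    (hP : Integrable fun x => P x ^ α) {τ : ℝ} (hτ : τ ∈ Set.Ioo a b) :
    HasDerivAt (fun σ => ∫ x, p σ x ^ α)
      (α * (1 - α) / 2 * ∫ x, p τ x ^ α * v1 τ x ^ 2) τ := by
  have key := H.leibniz hα hP hτ (w := fun _ _ => 1) (w' := fun _ _ => 0) (c := 1)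
    (c' := |α / 2| + |α / 2| + |0| + |0|)
    (fun _ _ => continuous_const) (fun _ _ => continuous_const)
    (fun σ _ x => hasDerivAt_const _ _)
    (fun τ _ x => by simpa using mono_bd (v1 τ x) (v2 τ x) (v3 τ x) 0 0 0 (by norm_num))
    (fun τ _ x => by
      refine le_of_eq_of_le ?_ (lin4_bd (mono_bd (v1 τ x) (v2 τ x) (v3 τ x) 0 1 0 (by norm_num))
        (mono_bd (v1 τ x) (v2 τ x) (v3 τ x) 2 0 0 (by norm_num))
        (mono_bd (v1 τ x) (v2 τ x) (v3 τ x) 0 0 0 (by norm_num))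
        (mono_bd (v1 τ x) (v2 τ x) (v3 τ x) 0 0 0 (by norm_num)) (α / 2) (α / 2) 0 0)
      congr 1; ring)
  simp only [mul_one] at key
  refine key.congr_deriv ?_
  have e := int_lin4 (H.imon hα hP hτ 0 1 0 (by norm_num)) (H.imon hα hP hτ 2 0 0 (by norm_num))
    (H.imon hα hP hτ 0 0 0 (by norm_num)) (H.imon hα hP hτ 0 0 0 (by norm_num)) (α / 2) (α / 2) 0 0
  rw [integral_congr_ae
    (g := fun x => p τ x ^ α * (α * ((v2 τ x + v1 τ x ^ 2) / 2) + 0))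
    (Eventually.of_forall fun x => by ring)] at e
  simp only [pow_zero, mul_one, one_mul, pow_one, zero_mul, add_zero] at e
  rw [H.ibp1 hα hP hτ] at e
  simp only [add_zero]
  rw [e]
  ring

lemma J_deriv (H : HeatPack p v1 v2 v3 R P a b K) {α : ℝ} (hα : 0 < α)
    (hP : Integrable fun x => P x ^ α) {τ : ℝ} (hτ : τ ∈ Set.Ioo a b) :
    HasDerivAt (fun σ => ∫ x, p σ x ^ α * v1 σ x ^ 2)
      (-(∫ x, p τ x ^ α * v2 τ x ^ 2) -
        α * (1 - α) / 6 * ∫ x, p τ x ^ α * v1 τ x ^ 4) τ := by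
  have key := H.leibniz hα hP hτ (w := fun σ x => v1 σ x ^ 2)
    (w' := fun σ x => 2 * v1 σ x * ((v3 σ x + 2 * v1 σ x * v2 σ x) / 2)) (c := 1)
    (c' := |α / 2| + |α / 2 + 2| + |1| + |0|)
    (fun σ hσ => by have := H.v1c hσ; fun_prop)
    (fun σ hσ => by
      have h1 := H.v1c hσ
      have h2 := H.v2c hσ
      have h3 := H.v3c σ hσ
      fun_prop)
    (fun σ hσ x => ((H.v1t σ hσ x).pow 2).congr_deriv (by norm_num))
    (fun τ _ x => by simpa using mono_bd (v1 τ x) (v2 τ x) (v3 τ x) 2 0 0 (by norm_num))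
    (fun τ _ x => by
      refine le_of_eq_of_le ?_ (lin4_bd (mono_bd (v1 τ x) (v2 τ x) (v3 τ x) 4 0 0 (by norm_num))
        (mono_bd (v1 τ x) (v2 τ x) (v3 τ x) 2 1 0 (by norm_num))
        (mono_bd (v1 τ x) (v2 τ x) (v3 τ x) 1 0 1 (by norm_num))
        (mono_bd (v1 τ x) (v2 τ x) (v3 τ x) 0 0 0 (by norm_num)) (α / 2) (α / 2 + 2) 1 0)
      congr 1; ring)
  refine key.congr_deriv ?_
  have e := int_lin4 (H.imon hα hP hτ 4 0 0 (by norm_num)) (H.imon hα hP hτ 2 1 0 (by norm_num))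
    (H.imon hα hP hτ 1 0 1 (by norm_num)) (H.imon hα hP hτ 0 0 0 (by norm_num))
    (α / 2) (α / 2 + 2) 1 0
  rw [integral_congr_ae
    (g := fun x => p τ x ^ α * (α * ((v2 τ x + v1 τ x ^ 2) / 2) * v1 τ x ^ 2 +
      2 * v1 τ x * ((v3 τ x + 2 * v1 τ x * v2 τ x) / 2)))
    (Eventually.of_forall fun x => by ring)] at e
  simp only [pow_zero, mul_one, one_mul, pow_one, zero_mul, add_zero] at e
  rw [H.ibp2 hα hP hτ] at e
  have e3 := H.ibp3 hα hP hτ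
  rw [e]
  linear_combination (1 / 6 * (1 - α) + 1 / 2) * e3

lemma phi_pos (H : HeatPack p v1 v2 v3 R P a b K) {α : ℝ} (hα : 0 < α)
    (hP : Integrable fun x => P x ^ α) {τ : ℝ} (hτ : τ ∈ Set.Ioo a b) :
    0 < ∫ x, p τ x ^ α := by
  have hi := H.imon hα hP hτ 0 0 0 (by norm_num)
  simp only [pow_zero, mul_one] at hi
  rw [integral_pos_iff_support_of_nonneg (fun x => Real.rpow_nonneg (H.pos τ hτ x).le α) hi]
  have : (Function.support fun x => p τ x ^ α) = Set.univ := by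
    ext x
    simp [(Real.rpow_pos_of_pos (H.pos τ hτ x) α).ne']
  rw [this]; simp

/-- The key sum-of-squares inequality. -/
lemma sos (H : HeatPack p v1 v2 v3 R P a b K) {α : ℝ} (hα : 0 < α)
    (hP : Integrable fun x => P x ^ α) {τ : ℝ} (hτ : τ ∈ Set.Ioo a b) :
    α ^ 2 / 9 * (∫ x, p τ x ^ α) * (∫ x, p τ x ^ α * v1 τ x ^ 4) +
      4 * α ^ 2 / 9 * (∫ x, p τ x ^ α * v1 τ x ^ 2) ^ 2 ≤
    (∫ x, p τ x ^ α) * ∫ x, p τ x ^ α * v2 τ x ^ 2 := by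
  have hφ := H.phi_pos hα hP hτ
  set φ := ∫ x, p τ x ^ α with hφd
  set J := ∫ x, p τ x ^ α * v1 τ x ^ 2 with hJ
  set d := 2 * α / 3 * J / φ with hd
  have e1 := int_lin4 (H.imon hα hP hτ 0 2 0 (by norm_num))
    (H.imon hα hP hτ 4 0 0 (by norm_num))
    (H.imon hα hP hτ 0 0 0 (by norm_num)) (H.imon hα hP hτ 2 1 0 (by norm_num))
    1 (α ^ 2 / 9) (d ^ 2) (2 * α / 3)
  have hI1 : Integrable fun x => 1 * (p τ x ^ α * (v1 τ x ^ 0 * v2 τ x ^ 2 * v3 τ x ^ 0)) +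
      (α ^ 2 / 9) * (p τ x ^ α * (v1 τ x ^ 4 * v2 τ x ^ 0 * v3 τ x ^ 0)) +
      (d ^ 2) * (p τ x ^ α * (v1 τ x ^ 0 * v2 τ x ^ 0 * v3 τ x ^ 0)) +
      (2 * α / 3) * (p τ x ^ α * (v1 τ x ^ 2 * v2 τ x ^ 1 * v3 τ x ^ 0)) :=
    ((((H.imon hα hP hτ 0 2 0 (by norm_num)).const_mul _).add
    ((H.imon hα hP hτ 4 0 0 (by norm_num)).const_mul _)).add
    ((H.imon hα hP hτ 0 0 0 (by norm_num)).const_mul _)).add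
     ((H.imon hα hP hτ 2 1 0 (by norm_num)).const_mul _)
  have e2 := int_lin4 hI1
    (H.imon hα hP hτ 0 1 0 (by norm_num))
    (H.imon hα hP hτ 2 0 0 (by norm_num)) (H.imon hα hP hτ 0 0 0 (by norm_num))
    1 (2 * d) (2 * α / 3 * d) 0
  rw [e1] at e2
  rw [integral_congr_ae
    (g := fun x => p τ x ^ α * (v2 τ x + α / 3 * v1 τ x ^ 2 + d) ^ 2)
    (Eventually.of_forall fun x => by ring)] at e2
  have hnn : 0 ≤ ∫ x, p τ x ^ α * (v2 τ x + α / 3 * v1 τ x ^ 2 + d) ^ 2 :=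
    integral_nonneg fun x => mul_nonneg (Real.rpow_nonneg (H.pos τ hτ x).le α) (sq_nonneg _)
  simp only [pow_zero, mul_one, one_mul, pow_one, zero_mul, add_zero] at e2
  rw [H.ibp1 hα hP hτ, ← hφd, ← hJ] at e2
  have e3 := H.ibp3 hα hP hτ
  set V := ∫ x, p τ x ^ α * v2 τ x ^ 2
  set B := ∫ x, p τ x ^ α * v1 τ x ^ 4
  have hdφ : d * φ = 2 * α / 3 * J := by rw [hd]; field_simp
  have h2 : V - α ^ 2 / 9 * B + d ^ 2 * φ - 4 * α / 3 * d * J ≥ 0 := by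
    nlinarith [hnn, e2, e3]
  have h3 := mul_nonneg hφ.le h2
  have h4 : φ * (V - α ^ 2 / 9 * B + d ^ 2 * φ - 4 * α / 3 * d * J) =
      φ * V - α ^ 2 / 9 * φ * B - 4 * α ^ 2 / 9 * J ^ 2 := by
    linear_combination (d * φ + 2 * α / 3 * J - 4 * α / 3 * J) * hdφ
  linarith

lemma final (H : HeatPack p v1 v2 v3 R P a b K) {α : ℝ} (hα : 0 < α) (hα3 : α ≤ 3)
    (hP : Integrable fun x => P x ^ α) {τ : ℝ} (hτ : τ ∈ Set.Ioo a b) :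
    ((-(∫ x, p τ x ^ α * v2 τ x ^ 2) -
        α * (1 - α) / 6 * ∫ x, p τ x ^ α * v1 τ x ^ 4)) * (∫ x, p τ x ^ α) -
      (∫ x, p τ x ^ α * v1 τ x ^ 2) *
        (α * (1 - α) / 2 * ∫ x, p τ x ^ α * v1 τ x ^ 2) ≤ 0 := by
  have hφ := H.phi_pos hα hP hτ
  have hs := H.sos hα hP hτ
  have hB : 0 ≤ ∫ x, p τ x ^ α * v1 τ x ^ 4 :=
    integral_nonneg fun x => mul_nonneg (Real.rpow_nonneg (H.pos τ hτ x).le α) (by positivity)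
  set φ := ∫ x, p τ x ^ α with hφd
  set J := ∫ x, p τ x ^ α * v1 τ x ^ 2 with hJ
  set V := ∫ x, p τ x ^ α * v2 τ x ^ 2
  set B := ∫ x, p τ x ^ α * v1 τ x ^ 4
  have h1 : 0 ≤ (α * (3 - α) / 18) * (φ * B) := by
    have : 0 ≤ 3 - α := by linarith
    positivity
  have h2 : 0 ≤ (α * (9 - α) / 18) * J ^ 2 := by
    have : 0 ≤ 9 - α := by linarith
    positivity
  nlinarith

end HeatPack

namespace HeatPack

variable {p v1 v2 v3 R : ℝ → ℝ → ℝ} {P : ℝ → ℝ} {a b K : ℝ}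

lemma domlog (H : HeatPack p v1 v2 v3 R P a b K) :
    ∃ C, 0 < C ∧ ∀ τ ∈ Set.Ioo a b, ∀ x,
      p τ x * (1 + |v1 τ x| + |v2 τ x| + |v3 τ x|) ^ 4 * (1 + |Real.log (p τ x)|) ≤
        C * (P x + |P x * Real.log (P x)|) := by
  obtain ⟨C, hC0, hC⟩ := H.bdS (β := 1 / 2) (by norm_num)
  have hK := H.Kpos
  refine ⟨C * K * (3 + |Real.log K|), by positivity, fun τ hτ x => ?_⟩
  have hp := H.pos τ hτ x
  have hR := H.R1 τ hτ x
  have hPx := H.Ppos x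
  have h1 := H.pR τ hτ x
  have h2 := H.Pp τ hτ x
  have hS := hC τ hτ x
  set r := R τ x ^ (1 / 2 : ℝ) with hr
  have hr1 : 1 ≤ r := Real.one_le_rpow hR (by positivity)
  have hrr : r * r = R τ x := by
    rw [hr, ← Real.rpow_add (by linarith)]; norm_num
  have hlogR : Real.log (R τ x) ≤ 2 * r := by
    have := Real.log_le_rpow_div (x := R τ x) (ε := 1 / 2) (by linarith) (by norm_num)
    rw [← hr] at this; linarith
  have hl1 : Real.log (P x) ≤ Real.log (p τ x) + Real.log (R τ x) := by
    rw [← Real.log_mul hp.ne' (by linarith)]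
    exact Real.log_le_log hPx h2
  have hl2 : Real.log (p τ x) ≤ Real.log K + Real.log (P x) := by
    rw [← Real.log_mul hK.ne' hPx.ne']
    refine Real.log_le_log hp (le_trans ?_ h1)
    nlinarith
  have hab : |Real.log (p τ x)| ≤ |Real.log (P x)| + 2 * r + |Real.log K| := by
    have a1 := neg_abs_le (Real.log (P x))
    have a2 := le_abs_self (Real.log (P x))
    have a3 := le_abs_self (Real.log K)
    have a4 := abs_nonneg (Real.log K)
    rw [abs_le]
    constructor <;> linarith
  have hab' : 1 + |Real.log (p τ x)| ≤ r * ((3 + |Real.log K|) * (1 + |Real.log (P x)|)) := by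
    have a4 := abs_nonneg (Real.log K)
    have a5 := abs_nonneg (Real.log (P x))
    have : |Real.log (P x)| + 2 * r + |Real.log K| + 1 ≤
        r * (3 + |Real.log K| + |Real.log (P x)|) := by nlinarith
    have h6 : 3 + |Real.log K| + |Real.log (P x)| ≤
        (3 + |Real.log K|) * (1 + |Real.log (P x)|) := by nlinarith
    have := mul_le_mul_of_nonneg_left h6 (by linarith : 0 ≤ r)
    linarith
  calc _ ≤ p τ x * (C * r) * (r * ((3 + |Real.log K|) * (1 + |Real.log (P x)|))) := by
        gcongr
    _ = C * (3 + |Real.log K|) * (1 + |Real.log (P x)|) * (p τ x * (r * r)) := by ring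
    _ ≤ C * (3 + |Real.log K|) * (1 + |Real.log (P x)|) * (K * P x) := by
        rw [hrr]
        exact mul_le_mul_of_nonneg_left h1 (by positivity)
    _ = _ := by rw [abs_mul, abs_of_pos hPx]; ring

lemma logc (H : HeatPack p v1 v2 v3 R P a b K) {τ : ℝ} (hτ : τ ∈ Set.Ioo a b) :
    Continuous fun x => Real.log (p τ x) :=
  (H.pc hτ).log fun x => (H.pos τ hτ x).ne'

lemma integlog (H : HeatPack p v1 v2 v3 R P a b K)
    (hP : Integrable P) (hPl : Integrable fun x => P x * Real.log (P x))
    {τ : ℝ} (hτ : τ ∈ Set.Ioo a b) {w : ℝ → ℝ}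
    (hw : Continuous w) {c : ℝ}
    (hwb : ∀ x, |w x| ≤ c * ((1 + |v1 τ x| + |v2 τ x| + |v3 τ x|) ^ 4 *
      (1 + |Real.log (p τ x)|))) :
    Integrable fun x => p τ x * w x := by
  obtain ⟨C, hC0, hC⟩ := H.domlog
  refine ((hP.add hPl.abs).const_mul (|c| * C)).mono' ((H.pc hτ).mul hw).aestronglyMeasurable
    (Eventually.of_forall fun x => ?_)
  have hp := (H.pos τ hτ x).le
  rw [Real.norm_eq_abs, abs_mul, abs_of_nonneg hp]
  calc _ ≤ p τ x * (|c| * ((1 + |v1 τ x| + |v2 τ x| + |v3 τ x|) ^ 4 *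
      (1 + |Real.log (p τ x)|))) := by
        gcongr
        refine (hwb x).trans ?_
        gcongr
        exact le_abs_self c
    _ = |c| * (p τ x * (1 + |v1 τ x| + |v2 τ x| + |v3 τ x|) ^ 4 *
      (1 + |Real.log (p τ x)|)) := by ring
    _ ≤ |c| * (C * (P x + |P x * Real.log (P x)|)) :=
        mul_le_mul_of_nonneg_left (hC τ hτ x) (abs_nonneg c)
    _ = _ := by simp only [Pi.add_apply]; ring

lemma mono_bdl (x y z l : ℝ) (i j k : ℕ) (h : i + j + k ≤ 4) :
    |x ^ i * y ^ j * z ^ k| ≤ (1 + |x| + |y| + |z|) ^ 4 * (1 + |l|) := by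
  refine (mono_bd x y z i j k h).trans ?_
  have : 0 ≤ (1 + |x| + |y| + |z|) ^ 4 := by positivity
  nlinarith [abs_nonneg l]

lemma mono_bdl' (x y z l : ℝ) (i j k : ℕ) (h : i + j + k ≤ 4) :
    |x ^ i * y ^ j * z ^ k * l| ≤ (1 + |x| + |y| + |z|) ^ 4 * (1 + |l|) := by
  rw [abs_mul]
  have := mono_bd x y z i j k h
  gcongr
  linarith

lemma shannon_deriv (H : HeatPack p v1 v2 v3 R P a b K)
    (hP : Integrable P) (hPl : Integrable fun x => P x * Real.log (P x))
    {τ : ℝ} (hτ : τ ∈ Set.Ioo a b) :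
    HasDerivAt (fun σ => ∫ x, p σ x * Real.log (p σ x))
      (-(1 / 2) * ∫ x, p τ x * v1 τ x ^ 2) τ := by
  obtain ⟨C, hC0, hC⟩ := H.domlog
  have hn : Set.Ioo a b ∈ nhds τ := isOpen_Ioo.mem_nhds hτ
  have hv1 := H.v1c hτ
  have hv2 := H.v2c hτ
  have hl := H.logc hτ
  -- the differentiated integrand
  have hb : ∀ σ x, |(v2 σ x + v1 σ x ^ 2) / 2 * (1 + Real.log (p σ x))| ≤
      (|1 / 2| + |1 / 2| + |1 / 2| + |1 / 2|) *
        ((1 + |v1 σ x| + |v2 σ x| + |v3 σ x|) ^ 4 * (1 + |Real.log (p σ x)|)) := by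
    intro σ x
    refine le_of_eq_of_le ?_ (lin4_bd
      (mono_bdl (v1 σ x) (v2 σ x) (v3 σ x) (Real.log (p σ x)) 0 1 0 (by norm_num))
      (mono_bdl (v1 σ x) (v2 σ x) (v3 σ x) (Real.log (p σ x)) 2 0 0 (by norm_num))
      (mono_bdl' (v1 σ x) (v2 σ x) (v3 σ x) (Real.log (p σ x)) 0 1 0 (by norm_num))
      (mono_bdl' (v1 σ x) (v2 σ x) (v3 σ x) (Real.log (p σ x)) 2 0 0 (by norm_num))
      (1 / 2) (1 / 2) (1 / 2) (1 / 2))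
    congr 1; ring
  have hI1 : Integrable fun x =>
      p τ x * ((v2 τ x + v1 τ x ^ 2) / 2 * (1 + Real.log (p τ x))) :=
    H.integlog hP hPl hτ (by fun_prop) (hb τ)
  have hI2 : Integrable fun x => p τ x * v1 τ x ^ 2 :=
    H.integlog hP hPl hτ (c := 1) (by fun_prop) fun x => by
      simpa using mono_bdl (v1 τ x) (v2 τ x) (v3 τ x) (Real.log (p τ x)) 2 0 0 (by norm_num)
  have hD : HasDerivAt (fun σ => ∫ x, p σ x * Real.log (p σ x))
      (∫ x, p τ x * ((v2 τ x + v1 τ x ^ 2) / 2 * (1 + Real.log (p τ x)))) τ := by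
    refine (hasDerivAt_integral_of_dominated_loc_of_deriv_le
      (F' := fun σ x => p σ x * ((v2 σ x + v1 σ x ^ 2) / 2 * (1 + Real.log (p σ x))))
      (bound := fun x => 2 * C * (P x + |P x * Real.log (P x)|)) hn ?_ ?_ ?_ ?_ ?_ ?_).2
    · filter_upwards [hn] with σ hσ
      exact ((H.pc hσ).mul (H.logc hσ)).aestronglyMeasurable
    · refine H.integlog hP hPl hτ (c := 1) hl fun x => ?_
      simpa using mono_bdl' (v1 τ x) (v2 τ x) (v3 τ x) (Real.log (p τ x)) 0 0 0 (by norm_num)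
    · exact hI1.aestronglyMeasurable
    · refine Eventually.of_forall fun x σ hσ => ?_
      have hp := (H.pos σ hσ x).le
      rw [Real.norm_eq_abs, abs_mul, abs_of_nonneg hp]
      have h1 := mul_le_mul_of_nonneg_left (hb σ x) hp
      have h2 := hC σ hσ x
      rw [show |(1 : ℝ) / 2| + |1 / 2| + |1 / 2| + |1 / 2| = 2 by norm_num] at h1
      linarith
    · exact (hP.add hPl.abs).const_mul _
    · refine Eventually.of_forall fun x σ hσ => ?_
      have hp := H.pos σ hσ x
      refine ((H.pt σ hσ x).mul ((H.pt σ hσ x).log hp.ne')).congr_deriv ?_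
      field_simp
      ring
  have hI3 : Integrable fun x => 2 * (p τ x * ((v2 τ x + v1 τ x ^ 2) / 2 *
      (1 + Real.log (p τ x)))) + p τ x * v1 τ x ^ 2 := (hI1.const_mul 2).add hI2
  have hz := integral_eq_zero_of_hasDerivAt_of_integrable
    (f := fun x => p τ x * (v1 τ x * (1 + Real.log (p τ x)))) (f' := fun x =>
      2 * (p τ x * ((v2 τ x + v1 τ x ^ 2) / 2 *
      (1 + Real.log (p τ x)))) + p τ x * v1 τ x ^ 2)
    (fun x => by
      have hp := H.pos τ hτ x
      refine ((H.px τ hτ x).mul ((H.v1x τ hτ x).mul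
        (((H.px τ hτ x).log hp.ne').const_add 1))).congr_deriv ?_
      simp only [Pi.mul_apply]
      field_simp
      ring) hI3
    (H.integlog hP hPl hτ (c := |1| + |1| + |0| + |0|) (by fun_prop) fun x => by
      refine le_of_eq_of_le ?_ (lin4_bd
        (mono_bdl (v1 τ x) (v2 τ x) (v3 τ x) (Real.log (p τ x)) 1 0 0 (by norm_num))
        (mono_bdl' (v1 τ x) (v2 τ x) (v3 τ x) (Real.log (p τ x)) 1 0 0 (by norm_num))
        (mono_bdl (v1 τ x) (v2 τ x) (v3 τ x) (Real.log (p τ x)) 0 0 0 (by norm_num))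
        (mono_bdl (v1 τ x) (v2 τ x) (v3 τ x) (Real.log (p τ x)) 0 0 0 (by norm_num))
        1 1 0 0)
      congr 1; ring)
  rw [integral_add (hI1.const_mul 2) hI2, integral_const_mul] at hz
  refine hD.congr_deriv ?_
  linarith

end HeatPack

/-- Unnormalised conditional moments. -/
noncomputable def mom (f : ℝ → ℝ) (k : ℕ) (t x : ℝ) : ℝ :=
  ∫ y : ℝ, f y * ((x - y) ^ k * Real.exp (-(x - y) ^ 2 / (2 * t)))

lemma pow_le_exp_sq (k : ℕ) {ε : ℝ} (hε : 0 < ε) :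
    ∃ C : ℝ, 0 < C ∧ ∀ u : ℝ, |u| ^ k ≤ C * Real.exp (ε * u ^ 2) := by
  refine ⟨1 + k.factorial / ε ^ k, by positivity, fun u => ?_⟩
  have h1 : |u| ^ k ≤ 1 + (u ^ 2) ^ k := by
    rcases le_total |u| 1 with h | h
    · have := pow_le_one₀ (n := k) (abs_nonneg u) h
      have : 0 ≤ (u ^ 2) ^ k := by positivity
      linarith
    · have h2 : |u| ≤ u ^ 2 := by rw [← sq_abs]; nlinarith
      have := pow_le_pow_left₀ (abs_nonneg u) h2 k
      linarith
  have h2 := Real.pow_div_factorial_le_exp (ε * u ^ 2) (by positivity) k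
  have h3 : (u ^ 2) ^ k ≤ k.factorial / ε ^ k * Real.exp (ε * u ^ 2) := by
    rw [mul_pow, div_le_iff₀ (by positivity)] at h2
    rw [div_mul_eq_mul_div, le_div_iff₀ (by positivity)]
    linarith
  have h4 : 1 ≤ Real.exp (ε * u ^ 2) := Real.one_le_exp (by positivity)
  linarith

lemma ker_bd (k : ℕ) {b : ℝ} (hb : 0 < b) :
    ∃ C : ℝ, 0 < C ∧ ∀ τ : ℝ, 0 < τ → τ ≤ b → ∀ u : ℝ,
      |u ^ k * Real.exp (-u ^ 2 / (2 * τ))| ≤ C := by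
  obtain ⟨C, hC, h⟩ := pow_le_exp_sq k (ε := 1 / (2 * b)) (by positivity)
  refine ⟨C, hC, fun τ hτ hτb u => ?_⟩
  rw [abs_mul, abs_pow, abs_of_pos (Real.exp_pos _)]
  calc _ ≤ C * Real.exp (1 / (2 * b) * u ^ 2) * Real.exp (-u ^ 2 / (2 * τ)) := by
        gcongr; exact h u
    _ = C * Real.exp (1 / (2 * b) * u ^ 2 + -u ^ 2 / (2 * τ)) := by rw [Real.exp_add]; ring
    _ ≤ C * 1 := by
        gcongr
        rw [Real.exp_le_one_iff]
        have : 1 / (2 * b) * u ^ 2 ≤ 1 / (2 * τ) * u ^ 2 := by gcongr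
        have e : -u ^ 2 / (2 * τ) = -(1 / (2 * τ) * u ^ 2) := by ring
        linarith
    _ = C := mul_one C

section conc

variable {f : ℝ → ℝ}

lemma momI (hf : Integrable f) (k : ℕ) {t : ℝ} (ht : 0 < t) (x : ℝ) :
    Integrable fun y => f y * ((x - y) ^ k * Real.exp (-(x - y) ^ 2 / (2 * t))) := by
  obtain ⟨C, hC, h⟩ := ker_bd k ht
  refine (hf.abs.const_mul C).mono' (hf.aestronglyMeasurable.mul
    (by fun_prop : Continuous fun y =>
      (x - y) ^ k * Real.exp (-(x - y) ^ 2 / (2 * t))).aestronglyMeasurable) ?_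
  refine Eventually.of_forall fun y => ?_
  rw [Real.norm_eq_abs, abs_mul, mul_comm C]
  exact mul_le_mul_of_nonneg_left (h t ht le_rfl (x - y)) (abs_nonneg _)

lemma mom_x (hf : Integrable f) (k : ℕ) {t : ℝ} (ht : 0 < t) (x : ℝ) :
    HasDerivAt (mom f k t) (k * mom f (k - 1) t x - mom f (k + 1) t x / t) x := by
  obtain ⟨C1, hC1, h1⟩ := ker_bd (k - 1) ht
  obtain ⟨C2, hC2, h2⟩ := ker_bd (k + 1) ht
  have key := (hasDerivAt_integral_of_dominated_loc_of_deriv_le (μ := volume)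
    (F := fun x y => f y * ((x - y) ^ k * Real.exp (-(x - y) ^ 2 / (2 * t))))
    (F' := fun x y => k * (f y * ((x - y) ^ (k - 1) * Real.exp (-(x - y) ^ 2 / (2 * t)))) -
      f y * ((x - y) ^ (k + 1) * Real.exp (-(x - y) ^ 2 / (2 * t))) / t)
    (x₀ := x) (s := Set.univ)
    (bound := fun y => (k * C1 + C2 / t) * |f y|) univ_mem ?_ ?_ ?_ ?_ ?_ ?_).2
  · refine key.congr_deriv ?_
    rw [integral_sub ((momI hf (k - 1) ht x).const_mul _)
      ((momI hf (k + 1) ht x).div_const t), integral_const_mul, integral_div]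
    rfl
  · exact Eventually.of_forall fun x => (momI hf k ht x).aestronglyMeasurable
  · exact momI hf k ht x
  · exact (((momI hf (k - 1) ht x).const_mul _).sub
      ((momI hf (k + 1) ht x).div_const t)).aestronglyMeasurable
  · refine Eventually.of_forall fun y x _ => ?_
    rw [Real.norm_eq_abs]
    refine (abs_sub _ _).trans ?_
    rw [abs_mul, abs_mul, abs_div, abs_mul (f y), abs_of_pos ht, Nat.abs_cast]
    calc _ ≤ k * (|f y| * C1) + |f y| * C2 / t := by
          gcongr
          · exact h1 t ht le_rfl (x - y)
          · exact h2 t ht le_rfl (x - y)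
      _ = _ := by ring
  · exact hf.abs.const_mul _
  · refine Eventually.of_forall fun y x _ => ?_
    have hu : HasDerivAt (fun x => x - y) 1 x := (hasDerivAt_id x).sub_const y
    have he : HasDerivAt (fun x => Real.exp (-(x - y) ^ 2 / (2 * t)))
        (Real.exp (-(x - y) ^ 2 / (2 * t)) * (-(2 * (x - y)) / (2 * t))) x := by
      refine (((hu.pow 2).neg.div_const (2 * t)).exp).congr_deriv ?_
      simp
    refine (((hu.pow k).mul he).const_mul (f y)).congr_deriv ?_
    simp only [Pi.pow_apply]
    field_simp
    ring

lemma mom_t (hf : Integrable f) (k : ℕ) {t : ℝ} (ht : 0 < t) (x : ℝ) :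
    HasDerivAt (fun σ => mom f k σ x) (mom f (k + 2) t x / (2 * t ^ 2)) t := by
  obtain ⟨C, hC, h⟩ := ker_bd (k + 2) (b := 2 * t) (by positivity)
  have key := (hasDerivAt_integral_of_dominated_loc_of_deriv_le (μ := volume)
    (F := fun σ y => f y * ((x - y) ^ k * Real.exp (-(x - y) ^ 2 / (2 * σ))))
    (F' := fun σ y => f y * ((x - y) ^ (k + 2) * Real.exp (-(x - y) ^ 2 / (2 * σ))) / (2 * σ ^ 2))
    (x₀ := t) (s := Set.Ioo (t / 2) (2 * t))
    (bound := fun y => |f y| * C / (2 * (t / 2) ^ 2))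
    (isOpen_Ioo.mem_nhds ⟨by linarith, by linarith⟩) ?_ ?_ ?_ ?_ ?_ ?_).2
  · refine key.congr_deriv ?_
    rw [integral_div]
    rfl
  · filter_upwards [lt_mem_nhds ht] with σ hσ
    exact (momI hf k hσ x).aestronglyMeasurable
  · exact momI hf k ht x
  · exact ((momI hf (k + 2) ht x).div_const _).aestronglyMeasurable
  · refine Eventually.of_forall fun y σ hσ => ?_
    have hσ0 : 0 < σ := by linarith [hσ.1]
    rw [Real.norm_eq_abs, abs_div, abs_mul, abs_of_pos (by positivity : 0 < 2 * σ ^ 2)]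
    have h1 := h σ hσ0 hσ.2.le (x - y)
    have h2 := hσ.1.le
    gcongr
  · exact (hf.abs.mul_const _).div_const _
  · refine Eventually.of_forall fun y σ hσ => ?_
    have hσ0 : 0 < σ := by linarith [hσ.1]
    have he : HasDerivAt (fun σ => Real.exp (-(x - y) ^ 2 / (2 * σ)))
        (Real.exp (-(x - y) ^ 2 / (2 * σ)) * ((x - y) ^ 2 / (2 * σ ^ 2))) σ := by
      refine (((hasDerivAt_const σ (-(x - y) ^ 2)).div ((hasDerivAt_id σ).const_mul 2)
        (by simpa using hσ0.ne')).exp).congr_deriv ?_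
      simp only [id, Pi.div_apply]
      field_simp
      ring
    refine ((he.const_mul ((x - y) ^ k)).const_mul (f y)).congr_deriv ?_
    ring

lemma mom0_pos (hf : Integrable f) (hf0 : ∀ x, 0 ≤ f x) (hf1 : (∫ x : ℝ, f x) = 1)
    {t : ℝ} (ht : 0 < t) (x : ℝ) : 0 < mom f 0 t x := by
  unfold mom
  have h := momI hf 0 ht x
  rw [integral_pos_iff_support_of_nonneg (fun y => mul_nonneg (hf0 y) (by positivity)) h]
  have h1 : 0 < ∫ x, f x := by rw [hf1]; exact one_pos
  rw [integral_pos_iff_support_of_nonneg hf0 hf] at h1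
  convert h1 using 2
  ext y
  simp

lemma mom0_mono (hf : Integrable f) (hf0 : ∀ x, 0 ≤ f x) {τ s : ℝ} (hτ : 0 < τ) (hs : τ ≤ s)
    (x : ℝ) : mom f 0 τ x ≤ mom f 0 s x := by
  refine integral_mono (momI hf 0 hτ x) (momI hf 0 (hτ.trans_le hs) x) fun y => ?_
  have := hf0 y
  refine mul_le_mul_of_nonneg_left ?_ this
  simp only [pow_zero, one_mul]
  apply Real.exp_le_exp.2
  rw [neg_div, neg_div]
  gcongr

/-- Conditional moments are controlled by arbitrarily small powers of the ratio. -/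
lemma mom_bd (hf : Integrable f) (hf0 : ∀ x, 0 ≤ f x) (hf1 : (∫ x : ℝ, f x) = 1)
    {b s : ℝ} (hb : 0 < b) (hbs : b < s) (k : ℕ) {β : ℝ} (hβ : 0 < β) (hβ1 : β ≤ 1) :
    ∃ C, 0 < C ∧ ∀ τ, 0 < τ → τ ≤ b → ∀ x,
      |mom f k τ x / mom f 0 τ x| ≤ C * (mom f 0 s x / mom f 0 τ x) ^ β := by
  have hs : 0 < s := hb.trans hbs
  have hε : 0 < 1 / (2 * b) - 1 / (2 * s) := by
    rw [sub_pos]; gcongr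
  obtain ⟨C, hC, h⟩ := pow_le_exp_sq k (mul_pos hβ hε)
  refine ⟨2 * C, by positivity, fun τ hτ hτb x => ?_⟩
  have hq := mom0_pos hf hf0 hf1 hτ x
  have hqs := mom0_pos hf hf0 hf1 hs x
  set R := mom f 0 s x / mom f 0 τ x with hR
  have hRp : 0 < R := by positivity
  have pw : ∀ u : ℝ, |u| ^ k * Real.exp (-u ^ 2 / (2 * τ)) ≤
      C * R ^ β * Real.exp (-u ^ 2 / (2 * τ)) +
      C * R ^ (β - 1) * Real.exp (-u ^ 2 / (2 * s)) := by
    intro u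
    set w := Real.exp (u ^ 2 / (2 * τ) - u ^ 2 / (2 * s)) with hw
    have hwp : 0 < w := Real.exp_pos _
    have h1 : |u| ^ k ≤ C * w ^ β := by
      refine (h u).trans ?_
      gcongr
      rw [hw, ← Real.exp_mul]
      apply Real.exp_le_exp.2
      have : 1 / (2 * b) ≤ 1 / (2 * τ) := by gcongr
      have h3 : 0 ≤ β * u ^ 2 := by positivity
      have h4 := mul_le_mul_of_nonneg_left this h3
      calc _ = β * u ^ 2 * (1 / (2 * b)) - β * u ^ 2 * (1 / (2 * s)) := by ring
        _ ≤ β * u ^ 2 * (1 / (2 * τ)) - β * u ^ 2 * (1 / (2 * s)) := by linarith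
        _ = _ := by ring
    have h2 : w ^ β ≤ R ^ β + R ^ (β - 1) * w := by
      rcases le_total w R with hwR | hwR
      · have : w ^ β ≤ R ^ β := Real.rpow_le_rpow hwp.le hwR hβ.le
        have : 0 ≤ R ^ (β - 1) * w := by positivity
        linarith
      · have h5 : w ^ (β - 1) ≤ R ^ (β - 1) :=
          Real.rpow_le_rpow_of_nonpos hRp hwR (by linarith)
        have h6 : w ^ β = w ^ (β - 1) * w := by
          rw [Real.rpow_sub_one hwp.ne']; field_simp
        have h7 : 0 ≤ R ^ β := by positivity
        rw [h6]
        nlinarith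
    have h8 : w * Real.exp (-u ^ 2 / (2 * τ)) = Real.exp (-u ^ 2 / (2 * s)) := by
      rw [hw, ← Real.exp_add]; congr 1; ring
    calc _ ≤ C * (R ^ β + R ^ (β - 1) * w) * Real.exp (-u ^ 2 / (2 * τ)) := by
          gcongr
          exact h1.trans (mul_le_mul_of_nonneg_left h2 hC.le)
      _ = C * R ^ β * Real.exp (-u ^ 2 / (2 * τ)) +
          C * R ^ (β - 1) * (w * Real.exp (-u ^ 2 / (2 * τ))) := by ring
      _ = _ := by rw [h8]
  have hI := ((momI hf 0 hτ x).const_mul (C * R ^ β)).add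
    ((momI hf 0 hs x).const_mul (C * R ^ (β - 1)))
  have hle : |mom f k τ x| ≤ C * R ^ β * mom f 0 τ x + C * R ^ (β - 1) * mom f 0 s x := by
    have e : C * R ^ β * mom f 0 τ x + C * R ^ (β - 1) * mom f 0 s x =
      ∫ y, (C * R ^ β * (f y * ((x - y) ^ 0 * Real.exp (-(x - y) ^ 2 / (2 * τ)))) +
        C * R ^ (β - 1) * (f y * ((x - y) ^ 0 * Real.exp (-(x - y) ^ 2 / (2 * s))))) := by
      rw [integral_add ((momI hf 0 hτ x).const_mul _) ((momI hf 0 hs x).const_mul _),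
        integral_const_mul, integral_const_mul]
      rfl
    rw [e, ← Real.norm_eq_abs]
    refine norm_integral_le_of_norm_le hI (Eventually.of_forall fun y => ?_)
    rw [Real.norm_eq_abs, abs_mul, abs_mul, abs_pow, abs_of_pos (Real.exp_pos _),
      abs_of_nonneg (hf0 y)]
    refine (mul_le_mul_of_nonneg_left (pw (x - y)) (hf0 y)).trans (le_of_eq ?_)
    ring
  have hR1 : R ^ (β - 1) * mom f 0 s x = R ^ β * mom f 0 τ x := by
    rw [Real.rpow_sub_one hRp.ne']
    have : mom f 0 s x = R * mom f 0 τ x := by rw [hR]; field_simp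
    rw [this]; field_simp
  rw [abs_div, abs_of_pos hq, div_le_iff₀ hq]
  calc _ ≤ _ := hle
    _ = C * R ^ β * mom f 0 τ x + C * (R ^ (β - 1) * mom f 0 s x) := by ring
    _ = _ := by rw [hR1]; ring

lemma heatP_eq (f : ℝ → ℝ) (t x : ℝ) :
    heatP f t x = (Real.sqrt (2 * Real.pi * t))⁻¹ * mom f 0 t x := by
  unfold heatP mom
  rw [← integral_const_mul]
  congr 1; ext y; ring

lemma heatP_integrable (hf : Integrable f) {s : ℝ} (hs : 0 < s) : Integrable (heatP f s) := by
  have hg : Integrable fun u : ℝ => (Real.sqrt (2 * Real.pi * s))⁻¹ *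
      Real.exp (-u ^ 2 / (2 * s)) := by
    have := (integrable_exp_neg_mul_sq (b := 1 / (2 * s)) (by positivity)).const_mul
      (Real.sqrt (2 * Real.pi * s))⁻¹
    refine this.congr (Eventually.of_forall fun u => ?_)
    simp only
    congr 2; ring
  exact hf.integrable_convolution (ContinuousLinearMap.mul ℝ ℝ) hg

/-- First space derivative of the logarithm of the density. -/
noncomputable def vv1 (f : ℝ → ℝ) (t x : ℝ) : ℝ := -(mom f 1 t x / mom f 0 t x) / t
/-- Second space derivative of the logarithm of the density. -/
noncomputable def vv2 (f : ℝ → ℝ) (t x : ℝ) : ℝ :=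
  -1 / t + (mom f 2 t x / mom f 0 t x - (mom f 1 t x / mom f 0 t x) ^ 2) / t ^ 2
/-- Third space derivative of the logarithm of the density. -/
noncomputable def vv3 (f : ℝ → ℝ) (t x : ℝ) : ℝ :=
  (-(mom f 3 t x / mom f 0 t x) + 3 * (mom f 1 t x / mom f 0 t x) * (mom f 2 t x / mom f 0 t x)
    - 2 * (mom f 1 t x / mom f 0 t x) ^ 3) / t ^ 3

lemma mom_c (hf : Integrable f) (k : ℕ) {t : ℝ} (ht : 0 < t) : Continuous (mom f k t) :=
  continuous_iff_continuousAt.2 fun x => (mom_x hf k ht x).continuousAt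

lemma pack (hf : Integrable f) (hf0 : ∀ x, 0 ≤ f x) (hf1 : (∫ x : ℝ, f x) = 1)
    {a b s : ℝ} (ha : 0 < a) (hab : a < b) (hbs : b < s) :
    HeatPack (heatP f) (vv1 f) (vv2 f) (vv3 f) (fun τ x => mom f 0 s x / mom f 0 τ x)
      (heatP f s) a b (Real.sqrt (2 * Real.pi * s) / Real.sqrt (2 * Real.pi * a)) := by
  have hs : 0 < s := by linarith
  have hpi := Real.pi_pos
  have h0 : ∀ {τ}, τ ∈ Set.Ioo a b → 0 < τ := fun h => ha.trans h.1
  have q : ∀ {τ}, 0 < τ → ∀ x, 0 < mom f 0 τ x := fun h x => mom0_pos hf hf0 hf1 h x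
  have hpos : ∀ {τ}, 0 < τ → ∀ x, 0 < heatP f τ x := fun {τ} h x => by
    rw [heatP_eq]
    have := q h x
    positivity
  have pReq : ∀ {τ}, 0 < τ → ∀ x, heatP f τ x * (mom f 0 s x / mom f 0 τ x) =
      Real.sqrt (2 * Real.pi * s) / Real.sqrt (2 * Real.pi * τ) * heatP f s x := by
    intro τ h x
    have h1 := q h x
    have h2 : 0 < Real.sqrt (2 * Real.pi * s) := by positivity
    have h3 : 0 < Real.sqrt (2 * Real.pi * τ) := by positivity
    rw [heatP_eq, heatP_eq]
    field_simp
  refine ⟨fun τ hτ x => hpos (h0 hτ) x, ?_, ?_, ?_, ?_, ?_, ?_, ?_, fun x => hpos hs x,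
    by positivity, ?_, ?_, ?_⟩
  · intro τ hτ x
    have ht := h0 hτ
    have hq := q ht x
    have e : heatP f τ = fun x => (Real.sqrt (2 * Real.pi * τ))⁻¹ * mom f 0 τ x :=
      funext (heatP_eq f τ)
    rw [e]
    refine ((mom_x hf 0 ht x).const_mul _).congr_deriv ?_
    unfold vv1
    field_simp
    simp
  · intro τ hτ x
    have ht := h0 hτ
    have hq := q ht x
    refine ((((mom_x hf 1 ht x).div (mom_x hf 0 ht x) hq.ne').neg).div_const τ).congr_deriv ?_
    unfold vv2
    simp only [Nat.cast_one, Nat.cast_zero, Nat.sub_self, Nat.zero_sub, zero_add, zero_mul,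
      Nat.reduceAdd]
    field_simp
    ring
  · intro τ hτ x
    have ht := h0 hτ
    have hq := q ht x
    have d0 := mom_x hf 0 ht x
    have d1 := (mom_x hf 1 ht x).div d0 hq.ne'
    have d2 := (mom_x hf 2 ht x).div d0 hq.ne'
    refine (((d2.sub (d1.pow 2)).div_const (τ ^ 2)).const_add (-1 / τ)).congr_deriv ?_
    unfold vv3
    simp only [Nat.cast_one, Nat.cast_zero, Nat.sub_self, Nat.zero_sub, zero_add, zero_mul,
      Nat.reduceAdd, Nat.cast_ofNat, Nat.reduceSub, Pi.div_apply]
    field_simp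
    ring
  · intro τ hτ
    have ht := h0 hτ
    have c0 := mom_c hf 0 ht
    have c1 := mom_c hf 1 ht
    have c2 := mom_c hf 2 ht
    have c3 := mom_c hf 3 ht
    have hq : ∀ x, mom f 0 τ x ≠ 0 := fun x => (q ht x).ne'
    unfold vv3
    fun_prop (disch := assumption)
  · intro τ hτ x
    have ht := h0 hτ
    have hq := q ht x
    have hr : 0 < Real.sqrt (2 * Real.pi * τ) := by positivity
    have hr2 : Real.sqrt (2 * Real.pi * τ) ^ 2 = 2 * Real.pi * τ := Real.sq_sqrt (by positivity)
    have e : (fun σ => heatP f σ x) = fun σ => (Real.sqrt (2 * Real.pi * σ))⁻¹ * mom f 0 σ x :=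
      funext fun σ => heatP_eq f σ x
    have dc : HasDerivAt (fun σ => (Real.sqrt (2 * Real.pi * σ))⁻¹)
        (-(Real.sqrt (2 * Real.pi * τ))⁻¹ / (2 * τ)) τ := by
      refine ((((hasDerivAt_id τ).const_mul (2 * Real.pi)).sqrt
        (by simp only [id]; positivity)).inv (by simpa using hr.ne')).congr_deriv ?_
      simp only [id, hr2]
      field_simp
    rw [e]
    refine (dc.mul (mom_t hf 0 ht x)).congr_deriv ?_
    rw [heatP_eq]
    unfold vv1 vv2
    simp only [zero_add]
    field_simp
    ring
  · intro τ hτ x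
    have ht := h0 hτ
    have hq := q ht x
    refine ((((mom_t hf 1 ht x).div (mom_t hf 0 ht x) hq.ne').neg).div
      (hasDerivAt_id τ) ht.ne').congr_deriv ?_
    unfold vv1 vv2 vv3
    simp only [id, zero_add, Nat.reduceAdd, Pi.neg_apply, Pi.div_apply]
    field_simp
    ring
  · intro τ hτ x
    have ht := h0 hτ
    rw [one_le_div (q ht x)]
    exact mom0_mono hf hf0 ht (by linarith [hτ.2]) x
  · intro τ hτ x
    have ht := h0 hτ
    rw [pReq ht]
    have := (hpos hs x).le
    have h1 := hτ.1.le
    gcongr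
  · intro τ hτ x
    have ht := h0 hτ
    rw [pReq ht]
    have h1 := (hpos hs x).le
    have h2 : τ ≤ s := by linarith [hτ.2]
    have h3 : 1 ≤ Real.sqrt (2 * Real.pi * s) / Real.sqrt (2 * Real.pi * τ) := by
      rw [one_le_div (by positivity)]
      gcongr
    nlinarith
  · intro β hβ hβ1
    have hb : 0 < b := ha.trans hab
    obtain ⟨C1, hC1, h1⟩ := mom_bd hf hf0 hf1 hb hbs 1 (β := β / 3) (by linarith) (by linarith)
    obtain ⟨C2, hC2, h2⟩ := mom_bd hf hf0 hf1 hb hbs 2 (β := β / 3) (by linarith) (by linarith)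
    obtain ⟨C3, hC3, h3⟩ := mom_bd hf hf0 hf1 hb hbs 3 (β := β / 3) (by linarith) (by linarith)
    refine ⟨C1 / a + (1 / a + (C2 + C1 ^ 2) / a ^ 2) +
      (C3 + 3 * C1 * C2 + 2 * C1 ^ 3) / a ^ 3, fun τ hτ x => ?_⟩
    have ht := h0 hτ
    have b1 := h1 τ ht hτ.2.le x
    have b2 := h2 τ ht hτ.2.le x
    have b3 := h3 τ ht hτ.2.le x
    have hR1 : 1 ≤ mom f 0 s x / mom f 0 τ x := by
      rw [one_le_div (q ht x)]
      exact mom0_mono hf hf0 ht (by linarith [hτ.2]) x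
    unfold vv1 vv2 vv3
    set m1 := mom f 1 τ x / mom f 0 τ x
    set m2 := mom f 2 τ x / mom f 0 τ x
    set m3 := mom f 3 τ x / mom f 0 τ x
    set Q := mom f 0 s x / mom f 0 τ x
    have hr1 : 1 ≤ Q ^ (β / 3) := Real.one_le_rpow hR1 (by positivity)
    have hr3 : Q ^ β = (Q ^ (β / 3)) ^ 3 := by
      rw [← Real.rpow_natCast, ← Real.rpow_mul (by linarith)]
      congr 1; push_cast; ring
    rw [hr3]
    set r := Q ^ (β / 3)
    have hr13 : r ≤ r ^ 3 := le_self_pow₀ hr1 (by norm_num)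
    have hr23 : r ^ 2 ≤ r ^ 3 := pow_le_pow_right₀ hr1 (by norm_num)
    have hr03 : 1 ≤ r ^ 3 := one_le_pow₀ hr1
    have haτ := hτ.1.le
    have k1 : |-m1 / τ| ≤ C1 / a * r ^ 3 := by
      rw [abs_div, abs_neg, abs_of_pos ht]
      calc _ ≤ C1 * r ^ 3 / a := by
            gcongr
            exact b1.trans (by gcongr)
        _ = _ := by ring
    have k2 : |-1 / τ + (m2 - m1 ^ 2) / τ ^ 2| ≤ (1 / a + (C2 + C1 ^ 2) / a ^ 2) * r ^ 3 := by
      refine (abs_add_le _ _).trans ?_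
      have e1 : |-1 / τ| ≤ 1 / a * r ^ 3 := by
        rw [abs_div, abs_neg, abs_one, abs_of_pos ht]
        calc 1 / τ ≤ 1 / a * 1 := by rw [mul_one]; gcongr
          _ ≤ _ := by gcongr
      have e2 : |(m2 - m1 ^ 2) / τ ^ 2| ≤ (C2 + C1 ^ 2) / a ^ 2 * r ^ 3 := by
        rw [abs_div, abs_of_pos (by positivity : 0 < τ ^ 2)]
        have : |m2 - m1 ^ 2| ≤ (C2 + C1 ^ 2) * r ^ 3 := by
          calc _ ≤ |m2| + |m1 ^ 2| := abs_sub _ _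
            _ = |m2| + |m1| ^ 2 := by rw [abs_pow]
            _ ≤ C2 * r + (C1 * r) ^ 2 := by gcongr
            _ = C2 * r + C1 ^ 2 * r ^ 2 := by ring
            _ ≤ C2 * r ^ 3 + C1 ^ 2 * r ^ 3 := by gcongr
            _ = _ := by ring
        calc _ ≤ (C2 + C1 ^ 2) * r ^ 3 / a ^ 2 := by gcongr
          _ = _ := by ring
      linarith
    have k3 : |(-m3 + 3 * m1 * m2 - 2 * m1 ^ 3) / τ ^ 3| ≤
        (C3 + 3 * C1 * C2 + 2 * C1 ^ 3) / a ^ 3 * r ^ 3 := by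
      rw [abs_div, abs_of_pos (by positivity : 0 < τ ^ 3)]
      have : |-m3 + 3 * m1 * m2 - 2 * m1 ^ 3| ≤ (C3 + 3 * C1 * C2 + 2 * C1 ^ 3) * r ^ 3 := by
        calc _ ≤ |-m3 + 3 * m1 * m2| + |2 * m1 ^ 3| := abs_sub _ _
          _ ≤ |-m3| + |3 * m1 * m2| + |2 * m1 ^ 3| := by gcongr; exact abs_add_le _ _
          _ = |m3| + 3 * |m1| * |m2| + 2 * |m1| ^ 3 := by
            rw [abs_neg, abs_mul, abs_mul, abs_mul, abs_pow]; norm_num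
          _ ≤ C3 * r + 3 * (C1 * r) * (C2 * r) + 2 * (C1 * r) ^ 3 := by gcongr
          _ = C3 * r + 3 * C1 * C2 * r ^ 2 + 2 * C1 ^ 3 * r ^ 3 := by ring
          _ ≤ C3 * r ^ 3 + 3 * C1 * C2 * r ^ 3 + 2 * C1 ^ 3 * r ^ 3 := by gcongr
          _ = _ := by ring
      calc _ ≤ (C3 + 3 * C1 * C2 + 2 * C1 ^ 3) * r ^ 3 / a ^ 3 := by gcongr
        _ = _ := by ring
    have n1 : 0 ≤ C1 / a * r ^ 3 := by positivity
    have n2 : 0 ≤ (1 / a + (C2 + C1 ^ 2) / a ^ 2) * r ^ 3 := by positivity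
    have n3 : 0 ≤ (C3 + 3 * C1 * C2 + 2 * C1 ^ 3) / a ^ 3 * r ^ 3 := by positivity
    refine ⟨?_, ?_, ?_⟩ <;> linarith

end conc

/-- Concavity of the Rényi entropy (Shannon entropy at order 1) in time along the heat
flow, for all orders α with 0 < α ≤ 3: the second time-derivative is nonpositive. -/
theorem renyi_second_derivative_nonpos
    (f : ℝ → ℝ) (hfm : Measurable f) (hf0 : ∀ x, 0 ≤ f x)
    (hf1 : (∫ x : ℝ, f x) = 1)
    (α : ℝ) (hα : 0 < α) (hα3 : α ≤ 3)
    (t : ℝ) (ht : 0 < t) (htα : ltTalpha f α t) :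
    iteratedDeriv 2 (fun s => renyiEnt f α s) t ≤ 0 := by
  have hf : Integrable f := by
    by_contra h
    rw [integral_undef h] at hf1
    exact zero_ne_one hf1
  obtain ⟨s, hts, hs, hfin⟩ := htα
  have H := pack hf hf0 hf1 (a := t / 2) (b := (t + s) / 2) (s := s) (by linarith)
    (by linarith) (by linarith)
  have htI : t ∈ Set.Ioo (t / 2) ((t + s) / 2) := ⟨by linarith, by linarith⟩
  have hn : Set.Ioo (t / 2) ((t + s) / 2) ∈ nhds t := isOpen_Ioo.mem_nhds htI
  have hPα : Integrable fun x => heatP f s x ^ α := by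
    by_cases h1 : α = 1
    · simpa [h1] using heatP_integrable hf hs
    · rw [renyiFinite, if_neg h1] at hfin
      exact hfin.1
  rw [iteratedDeriv_succ, iteratedDeriv_one]
  have hJ := H.J_deriv hα hPα htI
  have hφ := H.phi_deriv hα hPα htI
  have hφp := H.phi_pos hα hPα htI
  have hF := H.final hα hα3 hPα htI
  by_cases h1 : α = 1
  · subst h1
    rw [renyiFinite, if_pos rfl] at hfin
    have hd : deriv (fun σ => renyiEnt f 1 σ) =ᶠ[nhds t]
        fun σ => 1 / 2 * ∫ x, heatP f σ x ^ (1 : ℝ) * vv1 f σ x ^ 2 := by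
      filter_upwards [hn] with σ hσ
      have h2 := (H.shannon_deriv (heatP_integrable hf hs) hfin hσ).neg
      simp only [renyiEnt, if_true, Real.rpow_one]
      rw [show (fun σ => -∫ x, heatP f σ x * Real.log (heatP f σ x)) =
        -fun σ => ∫ x, heatP f σ x * Real.log (heatP f σ x) from rfl, h2.deriv]
      ring
    rw [hd.deriv_eq, (hJ.const_mul (1 / 2)).deriv]
    have hV : 0 ≤ ∫ x, heatP f t x ^ (1 : ℝ) * vv2 f t x ^ 2 :=
      integral_nonneg fun x => mul_nonneg (Real.rpow_nonneg (H.pos t htI x).le _) (sq_nonneg _)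
    linarith
  · have hd : deriv (fun σ => renyiEnt f α σ) =ᶠ[nhds t]
        fun σ => α / 2 * ((∫ x, heatP f σ x ^ α * vv1 f σ x ^ 2) / ∫ x, heatP f σ x ^ α) := by
      filter_upwards [hn] with σ hσ
      have h2 := ((H.phi_deriv hα hPα hσ).log (H.phi_pos hα hPα hσ).ne').const_mul (1 - α)⁻¹
      simp only [renyiEnt, if_neg h1]
      rw [h2.deriv]
      have h3 : 1 - α ≠ 0 := sub_ne_zero.2 (Ne.symm h1)
      have := (H.phi_pos hα hPα hσ).ne'
      field_simp
    have h4 := (hJ.div hφ hφp.ne').const_mul (α / 2)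
    simp only [Pi.div_apply] at h4
    rw [hd.deriv_eq, h4.deriv]
    refine mul_nonpos_of_nonneg_of_nonpos (by linarith) ?_
    exact div_nonpos_of_nonpos_of_nonneg hF (by positivity)
end

section
/- For every α ∈ (0,∞) and every t ∈ (0, t_α): (i) d/dt E_α[p̄₁⁴] = (3(α-4)(α-5)/10) E_α[p̄₁⁶] − 6 E_α[p̄₁²p̄₂²] + (α(α-1)/2) E_α[p̄₁⁴] E_α[p̄₁²]; (ii) d/dt E_α[p̄₂²] = ((α-2)(α-3)/2) E_α[p̄₁²p̄₂²] + (α-2) E_α[p̄₂³] − E_α[p̄₃²] + (α(α-1)/2) E_α[p̄₁²] E_α[p̄₂²]; (iii) d/dt E_α[p̄₁²] = ((α-2)(α-3)/6) E_α[p̄₁⁴] − E_α[p̄₂²] + (α(α-1)/2)(E_α[p̄₁²])²; (iv) d/dt (E_α[p̄₁²])² = E_α[p̄₁²]·( ((α-2)(α-3)/3) E_α[p̄₁⁴] − 2 E_α[p̄₂²] + α(α-1)(E_α[p̄₁²])² ). -/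
open MeasureTheory Real Filter
open scoped Classical

namespace TiltAux

open scoped Topology

/-- Gaussian-damped powers are bounded. -/
lemma pow_exp_bdd (N : ℕ) (κ : ℝ) (hκ : 0 < κ) :
    ∃ C : ℝ, 0 ≤ C ∧ ∀ u : ℝ, |u| ^ N * exp (-(κ * u ^ 2)) ≤ C := by
  refine ⟨1 + N.factorial / κ ^ N, by positivity, fun u => ?_⟩
  have h1 : |u| ^ N ≤ 1 + (u ^ 2) ^ N := by
    have : (u ^ 2) ^ N = (|u| ^ N) ^ 2 := by rw [← sq_abs]; ring
    rw [this]; nlinarith [sq_nonneg (|u| ^ N - 1), sq_nonneg (|u| ^ N)]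
  have h2 : (κ * u ^ 2) ^ N / N.factorial ≤ exp (κ * u ^ 2) :=
    Real.pow_div_factorial_le_exp _ (by positivity) N
  have h3 : (u ^ 2) ^ N ≤ N.factorial / κ ^ N * exp (κ * u ^ 2) := by
    rw [div_le_iff₀ (by positivity), mul_pow] at h2
    rw [div_mul_eq_mul_div, le_div_iff₀ (by positivity)]
    linarith
  have h4 : 1 ≤ exp (κ * u ^ 2) := Real.one_le_exp (by positivity)
  rw [Real.exp_neg, ← div_eq_mul_inv, div_le_iff₀ (by positivity)]
  nlinarith

/-- Unnormalised moments of the heat kernel against `f`. -/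
noncomputable def mm (f : ℝ → ℝ) (j : ℕ) (s x : ℝ) : ℝ :=
  ∫ y : ℝ, f y * ((x - y) ^ j * exp (-(x - y) ^ 2 / (2 * s)))

lemma kern_bdd (N : ℕ) (s : ℝ) (hs : 0 < s) :
    ∃ C : ℝ, 0 ≤ C ∧ ∀ r, 0 < r → r ≤ s → ∀ u : ℝ, |u ^ N * exp (-u ^ 2 / (2 * r))| ≤ C := by
  obtain ⟨C, hC, h⟩ := pow_exp_bdd N (1 / (2 * s)) (by positivity)
  refine ⟨C, hC, fun r hr hrs u => ?_⟩
  rw [abs_mul, abs_pow, abs_of_pos (Real.exp_pos _)]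
  refine le_trans ?_ (h u)
  gcongr
  rw [neg_div, neg_le_neg_iff, div_mul_eq_mul_div, one_mul]
  gcongr

lemma meas_kern (N : ℕ) (s x : ℝ) :
    Continuous (fun y : ℝ => (x - y) ^ N * exp (-(x - y) ^ 2 / (2 * s))) := by
  fun_prop

lemma integrable_kern {f : ℝ → ℝ} (hf : Integrable f) (N : ℕ) {s : ℝ} (hs : 0 < s) (x : ℝ) :
    Integrable (fun y : ℝ => f y * ((x - y) ^ N * exp (-(x - y) ^ 2 / (2 * s)))) := by
  obtain ⟨C, hC, h⟩ := kern_bdd N s hs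
  exact hf.mul_bdd (c := C) (meas_kern N s x).aestronglyMeasurable
    (Filter.Eventually.of_forall fun y => h s hs le_rfl (x - y))

lemma mm_hasDerivAt_x {f : ℝ → ℝ} (hf : Integrable f) (j : ℕ) {s : ℝ} (hs : 0 < s) (x : ℝ) :
    HasDerivAt (mm f j s) (j * mm f (j - 1) s x - mm f (j + 1) s x / s) x := by
  obtain ⟨C, hC, h⟩ := kern_bdd (j - 1) s hs
  obtain ⟨D, hD, h'⟩ := kern_bdd (j + 1) s hs
  have key := (hasDerivAt_integral_of_dominated_loc_of_deriv_le (μ := volume) (𝕜 := ℝ)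
    (F := fun x y => f y * ((x - y) ^ j * exp (-(x - y) ^ 2 / (2 * s))))
    (F' := fun x y => j * (f y * ((x - y) ^ (j - 1) * exp (-(x - y) ^ 2 / (2 * s))))
      - (f y * ((x - y) ^ (j + 1) * exp (-(x - y) ^ 2 / (2 * s)))) / s)
    (x₀ := x) (s := Set.univ) (bound := fun y => |f y| * (j * C + D / s))
    Filter.univ_mem
    (Filter.Eventually.of_forall fun x => (integrable_kern hf j hs x).aestronglyMeasurable)
    (integrable_kern hf j hs x)
    ((((integrable_kern hf (j - 1) hs x).const_mul _).sub
      ((integrable_kern hf (j + 1) hs x).div_const _)).aestronglyMeasurable)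
    (Filter.Eventually.of_forall fun y x _ => ?_)
    (hf.abs.mul_const _)
    (Filter.Eventually.of_forall fun y x _ => ?_)).2
  · refine HasDerivAt.congr_deriv (f := mm f j s) key ?_
    rw [integral_sub ((integrable_kern hf (j - 1) hs x).const_mul _)
      ((integrable_kern hf (j + 1) hs x).div_const _), integral_const_mul, integral_div]
    rfl
  · have e1 := h s hs le_rfl (x - y)
    have e2 := h' s hs le_rfl (x - y)
    rw [Real.norm_eq_abs]
    refine (abs_sub _ _).trans ?_
    rw [abs_mul, abs_div, abs_mul (f y), abs_mul (f y), abs_of_pos hs, Nat.abs_cast, mul_add]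
    have : |f y| * (↑j * C) = j * (|f y| * C) := by ring
    rw [this, ← mul_div_assoc]
    gcongr
  · have d1 : HasDerivAt (fun x : ℝ => x - y) 1 x := (hasDerivAt_id x).sub_const y
    have := ((d1.fun_pow j).mul (((d1.fun_pow 2).neg.div_const (2 * s)).exp)).const_mul (f y)
    refine this.congr_deriv ?_
    simp only [Pi.neg_apply]
    field_simp
    push_cast
    ring

lemma mm_hasDerivAt_t {f : ℝ → ℝ} (hf : Integrable f) (j : ℕ) {s : ℝ} (hs : 0 < s) (x : ℝ) :
    HasDerivAt (fun s => mm f j s x) (mm f (j + 2) s x / (2 * s ^ 2)) s := by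
  obtain ⟨D, hD, h'⟩ := kern_bdd (j + 2) (2 * s) (by positivity)
  have key := (hasDerivAt_integral_of_dominated_loc_of_deriv_le (μ := volume) (𝕜 := ℝ)
    (F := fun s y => f y * ((x - y) ^ j * exp (-(x - y) ^ 2 / (2 * s))))
    (F' := fun s y => (f y * ((x - y) ^ (j + 2) * exp (-(x - y) ^ 2 / (2 * s)))) / (2 * s ^ 2))
    (x₀ := s) (s := Set.Ioo (s / 2) (2 * s)) (bound := fun y => |f y| * D / (2 * (s / 2) ^ 2))
    (Ioo_mem_nhds (by linarith) (by linarith))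
    (by
      filter_upwards [lt_mem_nhds hs] with r hr
      exact (integrable_kern hf j hr x).aestronglyMeasurable)
    (integrable_kern hf j hs x)
    ((integrable_kern hf (j + 2) hs x).div_const _).aestronglyMeasurable
    (Filter.Eventually.of_forall fun y r hr => ?_)
    ((hf.abs.mul_const _).div_const _)
    (Filter.Eventually.of_forall fun y r hr => ?_)).2
  · refine HasDerivAt.congr_deriv (f := fun s => mm f j s x) key ?_
    rw [integral_div]
    rfl
  · have hr0 : 0 < r := lt_trans (by positivity) hr.1
    have e2 := h' r hr0 hr.2.le (x - y)
    rw [Real.norm_eq_abs, abs_div, abs_mul (f y), abs_of_pos (show 0 < 2 * r ^ 2 by positivity)]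
    have := hr.1.le
    gcongr
  · have hr0 : 0 < r := lt_trans (by positivity) hr.1
    have d1 : HasDerivAt (fun r : ℝ => -(x - y) ^ 2 / (2 * r)) ((x - y) ^ 2 / (2 * r ^ 2)) r := by
      have := (((hasDerivAt_id r).const_mul 2).fun_inv (by simpa using hr0.ne')).const_mul
        (-(x - y) ^ 2)
      refine this.congr_deriv ?_
      simp
      field_simp
    have := ((d1.exp).const_mul ((x - y) ^ j)).const_mul (f y)
    refine this.congr_deriv ?_
    field_simp
    ring

lemma mm_continuous {f : ℝ → ℝ} (hf : Integrable f) (j : ℕ) {s : ℝ} (hs : 0 < s) :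
    Continuous (mm f j s) :=
  continuous_iff_continuousAt.2 fun x => (mm_hasDerivAt_x hf j hs x).continuousAt

lemma mm_pos {f : ℝ → ℝ} (hf : Integrable f) (hf0 : ∀ x, 0 ≤ f x) (hf1 : (∫ x : ℝ, f x) = 1)
    {s : ℝ} (hs : 0 < s) (x : ℝ) : 0 < mm f 0 s x := by
  unfold mm
  have h := (integral_pos_iff_support_of_nonneg hf0 hf).1 (by rw [hf1]; norm_num)
  rw [integral_pos_iff_support_of_nonneg (fun y => mul_nonneg (hf0 y) (by simp; positivity))
    (integrable_kern hf 0 hs x)]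
  convert h using 2
  ext y
  simp [(Real.exp_pos _).ne']

lemma mm_mono {f : ℝ → ℝ} (hf : Integrable f) (hf0 : ∀ x, 0 ≤ f x)
    {r s : ℝ} (hr : 0 < r) (hrs : r ≤ s) (x : ℝ) : mm f 0 r x ≤ mm f 0 s x := by
  refine integral_mono (integrable_kern hf 0 hr x) (integrable_kern hf 0 (hr.trans_le hrs) x) ?_
  intro y
  simp only [pow_zero, one_mul]
  refine mul_le_mul_of_nonneg_left ?_ (hf0 y)
  rw [Real.exp_le_exp, neg_div, neg_div, neg_le_neg_iff]
  gcongr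

lemma mm0_integrable {f : ℝ → ℝ} (hf : Integrable f) {s : ℝ} (hs : 0 < s) :
    Integrable (mm f 0 s) := by
  have hg : Integrable (fun u : ℝ => exp (-(1 / (2 * s)) * u ^ 2)) :=
    integrable_exp_neg_mul_sq (by positivity)
  have := hf.integrable_convolution (ContinuousLinearMap.mul ℝ ℝ) hg
  convert this using 1
  ext x
  simp only [mm, convolution, ContinuousLinearMap.mul_apply', pow_zero, one_mul]
  congr 1; ext y; congr 2; ring

/-- ratio of times -/
noncomputable def RR (f : ℝ → ℝ) (S s x : ℝ) : ℝ := mm f 0 S x / mm f 0 s x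

lemma young (a l : ℝ) (ha : 0 ≤ a) (hl : 0 < l) (n : ℕ) : a ≤ l + a ^ (n + 1) / l ^ n := by
  rcases le_total a l with h | h
  · have : 0 ≤ a ^ (n + 1) / l ^ n := by positivity
    linarith
  · have : a ≤ a ^ (n + 1) / l ^ n := by
      rw [le_div_iff₀ (by positivity), pow_succ']
      gcongr
    linarith

lemma q_bound {f : ℝ → ℝ} (hf : Integrable f) (hf0 : ∀ x, 0 ≤ f x) (hf1 : (∫ x : ℝ, f x) = 1)
    (j n : ℕ) {t1 S : ℝ} (ht1 : 0 < t1) (hS : t1 < S) :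
    ∃ C : ℝ, 0 ≤ C ∧ ∀ s, 0 < s → s ≤ t1 → ∀ x,
      |mm f j s x / mm f 0 s x| ≤ C * RR f S s x ^ (1 / ((n : ℝ) + 1)) := by
  have hS0 : 0 < S := ht1.trans hS
  obtain ⟨C, hC, h⟩ := pow_exp_bdd (j * (n + 1)) (1 / (2 * t1) - 1 / (2 * S))
    (sub_pos.2 (by gcongr))
  refine ⟨1 + C, by positivity, fun s hs hst x => ?_⟩
  have m0 := mm_pos hf hf0 hf1 hs x
  have M0 := mm_pos hf hf0 hf1 hS0 x
  have hR : 0 < RR f S s x := div_pos M0 m0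
  set l := RR f S s x ^ (1 / ((n : ℝ) + 1)) with hl
  have hl0 : 0 < l := Real.rpow_pos_of_pos hR _
  have hln : l ^ (n + 1) = RR f S s x := by
    rw [hl, ← Real.rpow_natCast, ← Real.rpow_mul hR.le]
    push_cast
    rw [one_div_mul_cancel (by positivity), Real.rpow_one]
  have pt : ∀ u : ℝ, |u ^ j * exp (-u ^ 2 / (2 * s))| ≤
      l * exp (-u ^ 2 / (2 * s)) + C / l ^ n * exp (-u ^ 2 / (2 * S)) := by
    intro u
    rw [abs_mul, abs_pow, abs_of_pos (Real.exp_pos _)]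
    have y := young (|u| ^ j) l (by positivity) hl0 n
    have e : |u| ^ (j * (n + 1)) * exp (-u ^ 2 / (2 * s)) ≤ C * exp (-u ^ 2 / (2 * S)) := by
      have h1 := h u
      have h2 : exp (-u ^ 2 / (2 * s)) ≤
          exp (-((1 / (2 * t1) - 1 / (2 * S)) * u ^ 2)) * exp (-u ^ 2 / (2 * S)) := by
        rw [← Real.exp_add, Real.exp_le_exp]
        have : u ^ 2 / (2 * t1) ≤ u ^ 2 / (2 * s) := by gcongr
        have e3 : -u ^ 2 / (2 * s) = - (u ^ 2 / (2 * s)) := by ring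
        have e4 : -((1 / (2 * t1) - 1 / (2 * S)) * u ^ 2) + -u ^ 2 / (2 * S)
          = - (u ^ 2 / (2 * t1)) := by ring
        rw [e3, e4]; linarith
      calc _ ≤ |u| ^ (j * (n + 1)) * (exp (-((1 / (2 * t1) - 1 / (2 * S)) * u ^ 2))
              * exp (-u ^ 2 / (2 * S))) := by gcongr
        _ = (|u| ^ (j * (n + 1)) * exp (-((1 / (2 * t1) - 1 / (2 * S)) * u ^ 2)))
              * exp (-u ^ 2 / (2 * S)) := by ring
        _ ≤ _ := by gcongr
    calc |u| ^ j * exp (-u ^ 2 / (2 * s))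
        ≤ (l + (|u| ^ j) ^ (n + 1) / l ^ n) * exp (-u ^ 2 / (2 * s)) := by gcongr
      _ = l * exp (-u ^ 2 / (2 * s))
          + (|u| ^ (j * (n + 1)) * exp (-u ^ 2 / (2 * s))) / l ^ n := by rw [← pow_mul]; ring
      _ ≤ l * exp (-u ^ 2 / (2 * s)) + (C * exp (-u ^ 2 / (2 * S))) / l ^ n := by gcongr
      _ = _ := by ring
  have hb : |mm f j s x| ≤ l * mm f 0 s x + C / l ^ n * mm f 0 S x := by
    calc |mm f j s x| ≤ ∫ y, |f y * ((x - y) ^ j * exp (-(x - y) ^ 2 / (2 * s)))| :=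
          abs_integral_le_integral_abs
      _ ≤ ∫ y, (l * (f y * ((x - y) ^ 0 * exp (-(x - y) ^ 2 / (2 * s))))
            + C / l ^ n * (f y * ((x - y) ^ 0 * exp (-(x - y) ^ 2 / (2 * S))))) := by
          refine integral_mono (integrable_kern hf j hs x).abs
            (((integrable_kern hf 0 hs x).const_mul _).add
              ((integrable_kern hf 0 hS0 x).const_mul _)) ?_
          intro y
          have := mul_le_mul_of_nonneg_left (pt (x - y)) (hf0 y)
          simp only [pow_zero, one_mul]
          rw [abs_mul, abs_of_nonneg (hf0 y)]
          refine this.trans (le_of_eq ?_)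
          ring
      _ = _ := by
          rw [integral_add ((integrable_kern hf 0 hs x).const_mul _)
            ((integrable_kern hf 0 hS0 x).const_mul _), integral_const_mul, integral_const_mul]
          rfl
  rw [abs_div, abs_of_pos m0, div_le_iff₀ m0]
  refine hb.trans (le_of_eq ?_)
  have hM : mm f 0 S x = l ^ (n + 1) * mm f 0 s x := by
    rw [hln, RR, div_mul_cancel₀ _ m0.ne']
  rw [hM]
  field_simp
  ring

/-- Working hypotheses. -/
structure Ctx (f : ℝ → ℝ) (α S t0 t1 : ℝ) : Prop where
  hf : Integrable f
  hf0 : ∀ x, 0 ≤ f x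
  hf1 : (∫ x : ℝ, f x) = 1
  hα : 0 < α
  h0 : 0 < t0
  h01 : t0 < t1
  h1S : t1 < S
  hG : Integrable (fun x => mm f 0 S x ^ α)

/-- Admissible functions: continuous in space, and bounded by any small power of the ratio. -/
def Adm (f : ℝ → ℝ) (S t0 t1 : ℝ) (h : ℝ → ℝ → ℝ) : Prop :=
  (∀ s ∈ Set.Ioo t0 t1, Continuous (h s)) ∧
  ∀ δ : ℝ, 0 < δ → ∃ C : ℝ, 0 ≤ C ∧ ∀ s ∈ Set.Ioo t0 t1, ∀ x, |h s x| ≤ C * RR f S s x ^ δ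

/-- Moment ratios. -/
noncomputable def qq (f : ℝ → ℝ) (j : ℕ) (s x : ℝ) : ℝ := mm f j s x / mm f 0 s x

section
variable {f : ℝ → ℝ} {α S t0 t1 : ℝ}

lemma Ctx.one_le_RR (c : Ctx f α S t0 t1) {s : ℝ} (hs : s ∈ Set.Ioo t0 t1) (x : ℝ) :
    1 ≤ RR f S s x := by
  have hs0 : 0 < s := c.h0.trans hs.1
  rw [RR, one_le_div (mm_pos c.hf c.hf0 c.hf1 hs0 x)]
  exact mm_mono c.hf c.hf0 hs0 (hs.2.trans c.h1S).le x

lemma Adm.add {g h : ℝ → ℝ → ℝ} (hg : Adm f S t0 t1 g) (hh : Adm f S t0 t1 h) :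
    Adm f S t0 t1 (fun s x => g s x + h s x) := by
  refine ⟨fun s hs => (hg.1 s hs).add (hh.1 s hs), fun δ hδ => ?_⟩
  obtain ⟨C, hC, h1⟩ := hg.2 δ hδ
  obtain ⟨D, hD, h2⟩ := hh.2 δ hδ
  refine ⟨C + D, by positivity, fun s hs x => ?_⟩
  have := abs_add_le (g s x) (h s x)
  nlinarith [h1 s hs x, h2 s hs x]

lemma Adm.mul (c : Ctx f α S t0 t1) {g h : ℝ → ℝ → ℝ} (hg : Adm f S t0 t1 g)
    (hh : Adm f S t0 t1 h) : Adm f S t0 t1 (fun s x => g s x * h s x) := by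
  refine ⟨fun s hs => (hg.1 s hs).mul (hh.1 s hs), fun δ hδ => ?_⟩
  obtain ⟨C, hC, h1⟩ := hg.2 (δ / 2) (by positivity)
  obtain ⟨D, hD, h2⟩ := hh.2 (δ / 2) (by positivity)
  refine ⟨C * D, by positivity, fun s hs x => ?_⟩
  have hR := c.one_le_RR hs x
  have e : RR f S s x ^ δ = RR f S s x ^ (δ / 2) * RR f S s x ^ (δ / 2) := by
    rw [← Real.rpow_add (by linarith)]; congr 1; ring
  rw [abs_mul, e]
  calc _ ≤ (C * RR f S s x ^ (δ / 2)) * (D * RR f S s x ^ (δ / 2)) :=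
        mul_le_mul (h1 s hs x) (h2 s hs x) (abs_nonneg _) ((abs_nonneg _).trans (h1 s hs x))
    _ = _ := by ring

lemma Adm.of_bdd (c : Ctx f α S t0 t1) (g : ℝ → ℝ) (C : ℝ)
    (hC : ∀ s ∈ Set.Ioo t0 t1, |g s| ≤ C) : Adm f S t0 t1 (fun s _ => g s) := by
  refine ⟨fun s hs => continuous_const, fun δ hδ => ⟨|C|, abs_nonneg _, fun s hs x => ?_⟩⟩
  have := Real.one_le_rpow (c.one_le_RR hs x) hδ.le
  have h2 := (hC s hs).trans (le_abs_self C)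
  nlinarith [abs_nonneg C]

lemma Adm.const (c : Ctx f α S t0 t1) (a : ℝ) : Adm f S t0 t1 (fun _ _ => a) :=
  Adm.of_bdd c (fun _ => a) |a| fun _ _ => le_rfl

lemma Adm.inv (c : Ctx f α S t0 t1) : Adm f S t0 t1 (fun s _ => s⁻¹) := by
  refine Adm.of_bdd c (fun s => s⁻¹) t0⁻¹ fun s hs => ?_
  have h0 := c.h0
  have := hs.1
  rw [abs_of_pos (inv_pos.2 (h0.trans this))]
  gcongr

lemma Adm.sub (c : Ctx f α S t0 t1) {g h : ℝ → ℝ → ℝ} (hg : Adm f S t0 t1 g)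
    (hh : Adm f S t0 t1 h) : Adm f S t0 t1 (fun s x => g s x - h s x) := by
  have := hg.add ((Adm.const c (-1)).mul c hh)
  simpa [sub_eq_add_neg] using this

lemma Adm.pow (c : Ctx f α S t0 t1) {g : ℝ → ℝ → ℝ} (hg : Adm f S t0 t1 g) (n : ℕ) :
    Adm f S t0 t1 (fun s x => g s x ^ n) := by
  induction n with
  | zero => simpa using Adm.const c 1
  | succ k ih => simpa [pow_succ] using ih.mul c hg

lemma Adm.qq (c : Ctx f α S t0 t1) (j : ℕ) : Adm f S t0 t1 (qq f j) := by
  refine ⟨fun s hs => ?_, fun δ hδ => ?_⟩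
  · have hs0 : 0 < s := c.h0.trans hs.1
    exact (mm_continuous c.hf j hs0).div (mm_continuous c.hf 0 hs0)
      fun x => (mm_pos c.hf c.hf0 c.hf1 hs0 x).ne'
  · obtain ⟨n, hn⟩ := exists_nat_one_div_lt hδ
    obtain ⟨C, hC, h⟩ := q_bound c.hf c.hf0 c.hf1 j n (c.h0.trans c.h01) c.h1S
    refine ⟨C, hC, fun s hs x => (h s (c.h0.trans hs.1) hs.2.le x).trans ?_⟩
    gcongr
    exact c.one_le_RR hs x

/-- `p̄₁ … p̄₄` -/
noncomputable def r1 (f : ℝ → ℝ) (s x : ℝ) : ℝ := -1 * (s⁻¹ * qq f 1 s x)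
noncomputable def r2 (f : ℝ → ℝ) (s x : ℝ) : ℝ := s⁻¹ ^ 2 * qq f 2 s x - s⁻¹
noncomputable def r3 (f : ℝ → ℝ) (s x : ℝ) : ℝ :=
  3 * (s⁻¹ ^ 2 * qq f 1 s x) - s⁻¹ ^ 3 * qq f 3 s x
noncomputable def r4 (f : ℝ → ℝ) (s x : ℝ) : ℝ :=
  s⁻¹ ^ 4 * qq f 4 s x - 6 * (s⁻¹ ^ 3 * qq f 2 s x) + 3 * s⁻¹ ^ 2

lemma Adm.r1 (c : Ctx f α S t0 t1) : Adm f S t0 t1 (r1 f) :=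
  (Adm.const c (-1)).mul c ((Adm.inv c).mul c (Adm.qq c 1))
lemma Adm.r2 (c : Ctx f α S t0 t1) : Adm f S t0 t1 (r2 f) :=
  (((Adm.inv c).pow c 2).mul c (Adm.qq c 2)).sub c (Adm.inv c)
lemma Adm.r3 (c : Ctx f α S t0 t1) : Adm f S t0 t1 (r3 f) :=
  ((Adm.const c 3).mul c (((Adm.inv c).pow c 2).mul c (Adm.qq c 1))).sub c
    (((Adm.inv c).pow c 3).mul c (Adm.qq c 3))
lemma Adm.r4 (c : Ctx f α S t0 t1) : Adm f S t0 t1 (r4 f) :=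
  ((((Adm.inv c).pow c 4).mul c (Adm.qq c 4)).sub c
    ((Adm.const c 6).mul c (((Adm.inv c).pow c 3).mul c (Adm.qq c 2)))).add
    ((Adm.const c 3).mul c ((Adm.inv c).pow c 2))

lemma qq_x (hf : Integrable f) (hf0 : ∀ x, 0 ≤ f x) (hf1 : (∫ x : ℝ, f x) = 1) (j : ℕ) {s : ℝ}
    (hs : 0 < s) (x : ℝ) :
    HasDerivAt (qq f j s) (j * qq f (j - 1) s x - qq f (j + 1) s x / s
      + qq f j s x * qq f 1 s x / s) x := by
  have m0 := (mm_pos hf hf0 hf1 hs x).ne'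
  refine HasDerivAt.congr_deriv (f := qq f j s)
    ((mm_hasDerivAt_x hf j hs x).div (mm_hasDerivAt_x hf 0 hs x) m0) ?_
  simp only [qq]
  field_simp
  push_cast
  ring

lemma qq_t (hf : Integrable f) (hf0 : ∀ x, 0 ≤ f x) (hf1 : (∫ x : ℝ, f x) = 1) (j : ℕ) {s : ℝ}
    (hs : 0 < s) (x : ℝ) :
    HasDerivAt (fun s => qq f j s x)
      ((qq f (j + 2) s x - qq f j s x * qq f 2 s x) / (2 * s ^ 2)) s := by
  have m0 := (mm_pos hf hf0 hf1 hs x).ne'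
  refine HasDerivAt.congr_deriv (f := fun s => qq f j s x)
    ((mm_hasDerivAt_t hf j hs x).div (mm_hasDerivAt_t hf 0 hs x) m0) ?_
  simp only [qq]
  field_simp

lemma qq_zero (hf : Integrable f) (hf0 : ∀ x, 0 ≤ f x) (hf1 : (∫ x : ℝ, f x) = 1) {s : ℝ}
    (hs : 0 < s) (x : ℝ) : qq f 0 s x = 1 :=
  div_self (mm_pos hf hf0 hf1 hs x).ne'

lemma r1_x (hf : Integrable f) (hf0 : ∀ x, 0 ≤ f x) (hf1 : (∫ x : ℝ, f x) = 1) {s : ℝ}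
    (hs : 0 < s) (x : ℝ) :
    HasDerivAt (r1 f s) (r2 f s x - r1 f s x * r1 f s x) x := by
  have h0 := qq_zero hf hf0 hf1 hs x
  refine HasDerivAt.congr_deriv (f := r1 f s)
    (((qq_x hf hf0 hf1 1 hs x).const_mul s⁻¹).const_mul (-1)) ?_
  simp [r1, r2, h0]
  field_simp
  ring

lemma r2_x (hf : Integrable f) (hf0 : ∀ x, 0 ≤ f x) (hf1 : (∫ x : ℝ, f x) = 1) {s : ℝ}
    (hs : 0 < s) (x : ℝ) :
    HasDerivAt (r2 f s) (r3 f s x - r2 f s x * r1 f s x) x := by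
  refine HasDerivAt.congr_deriv (f := r2 f s)
    (((qq_x hf hf0 hf1 2 hs x).const_mul (s⁻¹ ^ 2)).sub_const s⁻¹) ?_
  simp [r1, r2, r3]
  field_simp
  ring

lemma r3_x (hf : Integrable f) (hf0 : ∀ x, 0 ≤ f x) (hf1 : (∫ x : ℝ, f x) = 1) {s : ℝ}
    (hs : 0 < s) (x : ℝ) :
    HasDerivAt (r3 f s) (r4 f s x - r3 f s x * r1 f s x) x := by
  have h0 := qq_zero hf hf0 hf1 hs x
  refine HasDerivAt.congr_deriv (f := r3 f s)
    ((((qq_x hf hf0 hf1 1 hs x).const_mul (s⁻¹ ^ 2)).const_mul 3).sub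
      ((qq_x hf hf0 hf1 3 hs x).const_mul (s⁻¹ ^ 3))) ?_
  simp [r1, r3, r4, h0]
  field_simp
  ring

lemma inv_t {s : ℝ} (hs : 0 < s) (n : ℕ) :
    HasDerivAt (fun s : ℝ => s⁻¹ ^ n) (- n * s⁻¹ ^ (n + 1)) s := by
  refine ((hasDerivAt_inv hs.ne').fun_pow n).congr_deriv ?_
  rcases n with _ | n
  · simp
  · simp only [Nat.add_sub_cancel, inv_pow]
    field_simp
    ring

lemma r1_t (hf : Integrable f) (hf0 : ∀ x, 0 ≤ f x) (hf1 : (∫ x : ℝ, f x) = 1) {s : ℝ}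
    (hs : 0 < s) (x : ℝ) :
    HasDerivAt (fun s => r1 f s x) ((r3 f s x - r1 f s x * r2 f s x) / 2) s := by
  refine HasDerivAt.congr_deriv (f := fun s => r1 f s x)
    (((hasDerivAt_inv hs.ne').fun_mul (qq_t hf hf0 hf1 1 hs x)).const_mul (-1)) ?_
  simp [r1, r2, r3]
  field_simp
  ring

lemma r2_t (hf : Integrable f) (hf0 : ∀ x, 0 ≤ f x) (hf1 : (∫ x : ℝ, f x) = 1) {s : ℝ}
    (hs : 0 < s) (x : ℝ) :
    HasDerivAt (fun s => r2 f s x) ((r4 f s x - r2 f s x * r2 f s x) / 2) s := by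
  refine HasDerivAt.congr_deriv (f := fun s => r2 f s x)
    (((inv_t hs 2).fun_mul (qq_t hf hf0 hf1 2 hs x)).fun_sub (hasDerivAt_inv hs.ne')) ?_
  simp [r2, r4]
  field_simp
  ring

lemma heatP_eq (s x : ℝ) : heatP f s x = (Real.sqrt (2 * Real.pi * s))⁻¹ * mm f 0 s x := by
  unfold heatP mm
  rw [← integral_const_mul]
  congr 1; ext y; ring

lemma heatP_pos (hf : Integrable f) (hf0 : ∀ x, 0 ≤ f x) (hf1 : (∫ x : ℝ, f x) = 1) {s : ℝ}
    (hs : 0 < s) (x : ℝ) : 0 < heatP f s x := by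
  rw [heatP_eq]
  have := mm_pos hf hf0 hf1 hs x
  have := Real.pi_pos
  positivity

lemma heatP_x (hf : Integrable f) (hf0 : ∀ x, 0 ≤ f x) (hf1 : (∫ x : ℝ, f x) = 1) {s : ℝ}
    (hs : 0 < s) (x : ℝ) : HasDerivAt (heatP f s) (r1 f s x * heatP f s x) x := by
  have m0 := (mm_pos hf hf0 hf1 hs x).ne'
  have e : heatP f s = fun x => (Real.sqrt (2 * Real.pi * s))⁻¹ * mm f 0 s x :=
    funext fun x => heatP_eq s x
  rw [e]
  refine ((mm_hasDerivAt_x hf 0 hs x).const_mul _).congr_deriv ?_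
  simp [r1, qq]
  field_simp

lemma heatP_t (hf : Integrable f) (hf0 : ∀ x, 0 ≤ f x) (hf1 : (∫ x : ℝ, f x) = 1) {s : ℝ}
    (hs : 0 < s) (x : ℝ) :
    HasDerivAt (fun s => heatP f s x) (r2 f s x / 2 * heatP f s x) s := by
  have m0 := (mm_pos hf hf0 hf1 hs x).ne'
  have hpi := Real.pi_pos
  have e : (fun s => heatP f s x) = fun s => (Real.sqrt (2 * Real.pi * s))⁻¹ * mm f 0 s x :=
    funext fun s => heatP_eq s x
  rw [e]
  have hq : 0 < 2 * Real.pi * s := by positivity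
  have hsq : 0 < Real.sqrt (2 * Real.pi * s) := Real.sqrt_pos.2 hq
  have hss : Real.sqrt (2 * Real.pi * s) ^ 2 = 2 * Real.pi * s := Real.sq_sqrt hq.le
  have d : HasDerivAt (fun s => (Real.sqrt (2 * Real.pi * s))⁻¹)
      (-(Real.sqrt (2 * Real.pi * s))⁻¹ / (2 * s)) s := by
    refine ((((hasDerivAt_id s).const_mul (2 * Real.pi)).sqrt hq.ne').fun_inv hsq.ne').congr_deriv ?_
    simp only [id, mul_one]
    rw [hss]
    field_simp
  refine (d.fun_mul (mm_hasDerivAt_t hf 0 hs x)).congr_deriv ?_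
  rw [heatP_eq]
  simp [r2, qq]
  field_simp
  ring

lemma pk_eq (hf : Integrable f) (hf0 : ∀ x, 0 ≤ f x) (hf1 : (∫ x : ℝ, f x) = 1) {s : ℝ}
    (hs : 0 < s) :
    pk f 1 s = (fun x => r1 f s x * heatP f s x) ∧ pk f 2 s = (fun x => r2 f s x * heatP f s x) ∧
    pk f 3 s = (fun x => r3 f s x * heatP f s x) := by
  have H1 : pk f 1 s = (fun x => r1 f s x * heatP f s x) := by
    ext x
    rw [pk, iteratedDeriv_one]
    exact (heatP_x hf hf0 hf1 hs x).deriv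
  have H2 : pk f 2 s = (fun x => r2 f s x * heatP f s x) := by
    ext x
    rw [pk, iteratedDeriv_succ]
    change deriv (pk f 1 s) x = _
    rw [H1]
    rw [((r1_x hf hf0 hf1 hs x).fun_mul (heatP_x hf hf0 hf1 hs x)).deriv]
    ring
  refine ⟨H1, H2, ?_⟩
  ext x
  rw [pk, iteratedDeriv_succ]
  change deriv (pk f 2 s) x = _
  rw [H2]
  rw [((r2_x hf hf0 hf1 hs x).fun_mul (heatP_x hf hf0 hf1 hs x)).deriv]
  ring

lemma pbar_eq (hf : Integrable f) (hf0 : ∀ x, 0 ≤ f x) (hf1 : (∫ x : ℝ, f x) = 1) {s : ℝ}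
    (hs : 0 < s) :
    pbar f 1 s = r1 f s ∧ pbar f 2 s = r2 f s ∧ pbar f 3 s = r3 f s := by
  obtain ⟨h1, h2, h3⟩ := pk_eq hf hf0 hf1 hs
  refine ⟨?_, ?_, ?_⟩ <;> ext x <;> have := (heatP_pos hf hf0 hf1 hs x).ne' <;>
    simp only [pbar, h1, h2, h3] <;> field_simp

lemma w_x (hf : Integrable f) (hf0 : ∀ x, 0 ≤ f x) (hf1 : (∫ x : ℝ, f x) = 1) {s : ℝ}
    (hs : 0 < s) (α x : ℝ) :
    HasDerivAt (fun x => heatP f s x ^ α) (α * r1 f s x * heatP f s x ^ α) x := by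
  have hp := heatP_pos hf hf0 hf1 hs x
  refine ((heatP_x hf hf0 hf1 hs x).rpow_const (Or.inl hp.ne')).congr_deriv ?_
  rw [Real.rpow_sub_one hp.ne']
  field_simp

lemma w_t (hf : Integrable f) (hf0 : ∀ x, 0 ≤ f x) (hf1 : (∫ x : ℝ, f x) = 1) {s : ℝ}
    (hs : 0 < s) (α x : ℝ) :
    HasDerivAt (fun s => heatP f s x ^ α) (α / 2 * r2 f s x * heatP f s x ^ α) s := by
  have hp := heatP_pos hf hf0 hf1 hs x
  refine ((heatP_t hf hf0 hf1 hs x).rpow_const (Or.inl hp.ne')).congr_deriv ?_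
  rw [Real.rpow_sub_one hp.ne']
  field_simp

/-- Domination of admissible integrands. -/
lemma Adm.dom (c : Ctx f α S t0 t1) {h : ℝ → ℝ → ℝ} (hh : Adm f S t0 t1 h) :
    ∃ C : ℝ, ∀ s ∈ Set.Ioo t0 t1, ∀ x, |h s x * heatP f s x ^ α| ≤ C * mm f 0 S x ^ α := by
  obtain ⟨C, hC, hb⟩ := hh.2 α c.hα
  have hα := c.hα
  refine ⟨C * ((Real.sqrt (2 * Real.pi * t0))⁻¹) ^ α, fun s hs x => ?_⟩
  have h0 := c.h0
  have hpi := Real.pi_pos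
  have hs0 : 0 < s := h0.trans hs.1
  have m0 := mm_pos c.hf c.hf0 c.hf1 hs0 x
  have M0 := mm_pos c.hf c.hf0 c.hf1 (c.h0.trans (c.h01.trans c.h1S)) x
  have hp := heatP_pos c.hf c.hf0 c.hf1 hs0 x
  have hR := c.one_le_RR hs x
  have hle : heatP f s x ^ α ≤ ((Real.sqrt (2 * Real.pi * t0))⁻¹) ^ α * mm f 0 s x ^ α := by
    rw [← Real.mul_rpow (by positivity) m0.le]
    refine Real.rpow_le_rpow hp.le ?_ hα.le
    rw [heatP_eq]
    have := hs.1.le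
    gcongr
  rw [abs_mul, abs_of_pos (Real.rpow_pos_of_pos hp α)]
  have e : RR f S s x ^ α * mm f 0 s x ^ α = mm f 0 S x ^ α := by
    rw [← Real.mul_rpow (by linarith) m0.le, RR, div_mul_cancel₀ _ m0.ne']
  calc _ ≤ (C * RR f S s x ^ α) * (((Real.sqrt (2 * Real.pi * t0))⁻¹) ^ α * mm f 0 s x ^ α) :=
        mul_le_mul (hb s hs x) hle (Real.rpow_nonneg hp.le _) ((abs_nonneg _).trans (hb s hs x))
    _ = C * ((Real.sqrt (2 * Real.pi * t0))⁻¹) ^ α * (RR f S s x ^ α * mm f 0 s x ^ α) := by ring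
    _ = _ := by rw [e]

lemma Adm.cont (c : Ctx f α S t0 t1) {h : ℝ → ℝ → ℝ} (hh : Adm f S t0 t1 h) {s : ℝ}
    (hs : s ∈ Set.Ioo t0 t1) : Continuous (fun x => h s x * heatP f s x ^ α) :=
  (hh.1 s hs).mul (continuous_iff_continuousAt.2 fun x =>
    (w_x c.hf c.hf0 c.hf1 (c.h0.trans hs.1) α x).continuousAt)

lemma Adm.int (c : Ctx f α S t0 t1) {h : ℝ → ℝ → ℝ} (hh : Adm f S t0 t1 h) {s : ℝ}
    (hs : s ∈ Set.Ioo t0 t1) : Integrable (fun x => h s x * heatP f s x ^ α) := by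
  obtain ⟨C, hC⟩ := hh.dom c
  exact (c.hG.const_mul C).mono' (hh.cont c hs).aestronglyMeasurable
    (Filter.Eventually.of_forall fun x => hC s hs x)

lemma ibp (c : Ctx f α S t0 t1) {h h' : ℝ → ℝ → ℝ} (hh : Adm f S t0 t1 h)
    (hh' : Adm f S t0 t1 h') {s : ℝ} (hs : s ∈ Set.Ioo t0 t1)
    (hd : ∀ x, HasDerivAt (h s) (h' s x) x) :
    ∫ x, (h' s x + α * (h s x * r1 f s x)) * heatP f s x ^ α = 0 := by
  refine integral_eq_zero_of_hasDerivAt_of_integrable (f := fun x => h s x * heatP f s x ^ α)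
    (fun x => ?_) ((hh'.add ((Adm.const c α).mul c (hh.mul c (Adm.r1 c)))).int c hs)
    (hh.int c hs)
  refine ((hd x).fun_mul (w_x c.hf c.hf0 c.hf1 (c.h0.trans hs.1) α x)).congr_deriv ?_
  ring

lemma dt (c : Ctx f α S t0 t1) {h h' : ℝ → ℝ → ℝ} (hh : Adm f S t0 t1 h)
    (hh' : Adm f S t0 t1 h') {t : ℝ} (ht : t ∈ Set.Ioo t0 t1)
    (hd : ∀ s ∈ Set.Ioo t0 t1, ∀ x, HasDerivAt (fun s => h s x) (h' s x) s) :
    HasDerivAt (fun s => ∫ x, h s x * heatP f s x ^ α)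
      (∫ x, (h' t x + α / 2 * (h t x * r2 f t x)) * heatP f t x ^ α) t := by
  have hA := hh'.add ((Adm.const c (α / 2)).mul c (hh.mul c (Adm.r2 c)))
  obtain ⟨C, hC⟩ := hA.dom c
  refine (hasDerivAt_integral_of_dominated_loc_of_deriv_le (μ := volume) (𝕜 := ℝ)
    (F := fun s x => h s x * heatP f s x ^ α)
    (F' := fun t x => (h' t x + α / 2 * (h t x * r2 f t x)) * heatP f t x ^ α)
    (s := Set.Ioo t0 t1) (bound := fun x => C * mm f 0 S x ^ α)
    (Ioo_mem_nhds ht.1 ht.2) ?_ (hh.int c ht) (hA.int c ht).aestronglyMeasurable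
    (Filter.Eventually.of_forall fun x s hs => hC s hs x) (c.hG.const_mul C)
    (Filter.Eventually.of_forall fun x s hs => ?_)).2
  · filter_upwards [Ioo_mem_nhds ht.1 ht.2] with s hs
    exact (hh.int c hs).aestronglyMeasurable
  · refine ((hd s hs x).fun_mul (w_t c.hf c.hf0 c.hf1 (c.h0.trans hs.1) α x)).congr_deriv ?_
    ring

end

section
variable {f : ℝ → ℝ} {α S t0 t1 : ℝ}

lemma lin {w H A1 A2 T1 T2 T3 : ℝ → ℝ} (c1 c2 k1 k2 k3 : ℝ)
    (i1 : Integrable fun x => A1 x * w x) (i2 : Integrable fun x => A2 x * w x)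
    (j1 : Integrable fun x => T1 x * w x) (j2 : Integrable fun x => T2 x * w x)
    (j3 : Integrable fun x => T3 x * w x)
    (z1 : ∫ x, A1 x * w x = 0) (z2 : ∫ x, A2 x * w x = 0)
    (e : ∀ x, H x = c1 * A1 x + c2 * A2 x + (k1 * T1 x + k2 * T2 x + k3 * T3 x)) :
    ∫ x, H x * w x =
      k1 * (∫ x, T1 x * w x) + k2 * (∫ x, T2 x * w x) + k3 * (∫ x, T3 x * w x) := by
  have e' : (fun x => H x * w x) = fun x => (c1 * (A1 x * w x) + c2 * (A2 x * w x))
      + ((k1 * (T1 x * w x) + k2 * (T2 x * w x)) + k3 * (T3 x * w x)) := by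
    ext x; rw [e]; ring
  have k12 : Integrable fun x => c1 * (A1 x * w x) + c2 * (A2 x * w x) :=
    (i1.const_mul _).add (i2.const_mul _)
  have l12 : Integrable fun x => k1 * (T1 x * w x) + k2 * (T2 x * w x) :=
    (j1.const_mul _).add (j2.const_mul _)
  have l123 : Integrable fun x => k1 * (T1 x * w x) + k2 * (T2 x * w x) + k3 * (T3 x * w x) :=
    l12.add (j3.const_mul _)
  rw [e', integral_add k12 l123, integral_add (i1.const_mul _) (i2.const_mul _),
    integral_add l12 (j3.const_mul _), integral_add (j1.const_mul _) (j2.const_mul _)]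
  simp only [integral_const_mul, z1, z2]
  ring

lemma Z_pos (c : Ctx f α S t0 t1) {s : ℝ} (hs : s ∈ Set.Ioo t0 t1) :
    0 < ∫ x, heatP f s x ^ α := by
  have hp := fun x => Real.rpow_pos_of_pos (heatP_pos c.hf c.hf0 c.hf1 (c.h0.trans hs.1) x) α
  have hi := (Adm.const c 1).int c hs
  simp only [one_mul] at hi
  rw [integral_pos_iff_support_of_nonneg (fun x => (hp x).le) hi]
  have : Function.support (fun x => heatP f s x ^ α) = Set.univ := by
    ext x; simp [(hp x).ne']
  rw [this]; simp

lemma Z_deriv (c : Ctx f α S t0 t1) {t : ℝ} (ht : t ∈ Set.Ioo t0 t1) :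
    HasDerivAt (fun s => ∫ x, heatP f s x ^ α)
      (-(α * (α - 1) / 2) * ∫ x, r1 f t x ^ 2 * heatP f t x ^ α) t := by
  have h := dt c (Adm.const c 1) (Adm.const c 0) ht (fun s _ x => hasDerivAt_const s (1 : ℝ))
  simp only [one_mul] at h
  refine h.congr_deriv ?_
  have A1' : Adm f S t0 t1 (fun s x => r2 f s x - r1 f s x * r1 f s x) :=
    (Adm.r2 c).sub c ((Adm.r1 c).mul c (Adm.r1 c))
  have z1 := ibp c (Adm.r1 c) A1' ht (fun x => r1_x c.hf c.hf0 c.hf1 (c.h0.trans ht.1) x)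
  have i1 := (A1'.add ((Adm.const c α).mul c ((Adm.r1 c).mul c (Adm.r1 c)))).int c ht
  have j1 := ((Adm.r1 c).pow c 2).int c ht
  rw [lin (w := fun x => heatP f t x ^ α) (T1 := fun x => r1 f t x ^ 2)
    (T2 := fun x => r1 f t x ^ 2) (T3 := fun x => r1 f t x ^ 2)
    (α / 2) 0 (-(α * (α - 1) / 2)) 0 0 i1 i1 j1 j1 j1 z1 z1 (fun x => by ring)]
  ring

lemma ea_deriv (c : Ctx f α S t0 t1) {h h' : ℝ → ℝ → ℝ} (hh : Adm f S t0 t1 h)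
    (hh' : Adm f S t0 t1 h') {t : ℝ} (ht : t ∈ Set.Ioo t0 t1)
    (hd : ∀ s ∈ Set.Ioo t0 t1, ∀ x, HasDerivAt (fun s => h s x) (h' s x) s) (K : ℝ)
    (hK : ∫ x, (h' t x + α / 2 * (h t x * r2 f t x)) * heatP f t x ^ α = K) :
    HasDerivAt (fun s => Ea f α s (h s))
      (K / (∫ x, heatP f t x ^ α)
        + α * (α - 1) / 2 * Ea f α t (h t) * Ea f α t (fun x => r1 f t x ^ 2)) t := by
  have hZ := (Z_pos c ht).ne'
  have h1 := dt c hh hh' ht hd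
  rw [hK] at h1
  refine HasDerivAt.congr_deriv (f := fun s => Ea f α s (h s)) (h1.div (Z_deriv c ht) hZ) ?_
  simp only [Ea]
  field_simp
  ring

lemma ea1 (c : Ctx f α S t0 t1) {t : ℝ} (ht : t ∈ Set.Ioo t0 t1) :
    HasDerivAt (fun s => Ea f α s (fun x => r1 f s x ^ 4))
      (3 * (α - 4) * (α - 5) / 10 * Ea f α t (fun x => (r1 f t x) ^ 6)
        - 6 * Ea f α t (fun x => (r1 f t x) ^ 2 * (r2 f t x) ^ 2)
        + α * (α - 1) / 2 * Ea f α t (fun x => (r1 f t x) ^ 4)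
            * Ea f α t (fun x => (r1 f t x) ^ 2)) t := by
  have a1 := Adm.r1 c
  have a2 := Adm.r2 c
  have a3 := Adm.r3 c
  have ht0 : 0 < t := c.h0.trans ht.1
  have d1 := fun x => r1_x c.hf c.hf0 c.hf1 ht0 x
  have d2 := fun x => r2_x c.hf c.hf0 c.hf1 ht0 x
  have b1 : Adm f S t0 t1 (fun s x => r2 f s x - r1 f s x * r1 f s x) := a2.sub c (a1.mul c a1)
  have b2 : Adm f S t0 t1 (fun s x => r3 f s x - r2 f s x * r1 f s x) := a3.sub c (a2.mul c a1)
  -- first integration by parts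
  have g1 : Adm f S t0 t1 (fun s x => r1 f s x ^ 3 * r2 f s x) := (a1.pow c 3).mul c a2
  have g1' : Adm f S t0 t1 (fun s x => 3 * (r1 f s x ^ 2 * (r2 f s x - r1 f s x * r1 f s x))
      * r2 f s x + r1 f s x ^ 3 * (r3 f s x - r2 f s x * r1 f s x)) :=
    (((Adm.const c 3).mul c ((a1.pow c 2).mul c b1)).mul c a2).add ((a1.pow c 3).mul c b2)
  have z1 := ibp c g1 g1' ht (fun x => (((d1 x).fun_pow 3).fun_mul (d2 x)).congr_deriv (by
    push_cast; ring))
  have i1 := (g1'.add ((Adm.const c α).mul c (g1.mul c a1))).int c ht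
  -- second integration by parts
  have g2 : Adm f S t0 t1 (fun s x => r1 f s x ^ 5) := a1.pow c 5
  have g2' : Adm f S t0 t1 (fun s x => 5 * (r1 f s x ^ 4 * (r2 f s x - r1 f s x * r1 f s x))) :=
    (Adm.const c 5).mul c ((a1.pow c 4).mul c b1)
  have z2 := ibp c g2 g2' ht (fun x => ((d1 x).fun_pow 5).congr_deriv (by push_cast; ring))
  have i2 := (g2'.add ((Adm.const c α).mul c (g2.mul c a1))).int c ht
  have j1 := (a1.pow c 6).int c ht
  have j2 := ((a1.pow c 2).mul c (a2.pow c 2)).int c ht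
  have hh' : Adm f S t0 t1 (fun s x => 2 * (r1 f s x ^ 3 * (r3 f s x - r1 f s x * r2 f s x))) :=
    (Adm.const c 2).mul c ((a1.pow c 3).mul c (a3.sub c (a1.mul c a2)))
  refine (ea_deriv c (a1.pow c 4) hh' ht (fun s hs x =>
    ((r1_t c.hf c.hf0 c.hf1 (c.h0.trans hs.1) x).fun_pow 4).congr_deriv (by push_cast; ring)) _
    (lin (w := fun x => heatP f t x ^ α) (T1 := fun x => r1 f t x ^ 6)
      (T2 := fun x => r1 f t x ^ 2 * r2 f t x ^ 2) (T3 := fun x => r1 f t x ^ 6)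
      2 (-(3 / 10) * (α - 4)) (3 * (α - 4) * (α - 5) / 10) (-6) 0 i1 i2 j1 j2 j1 z1 z2
      (fun x => by ring))).congr_deriv ?_
  simp only [Ea]
  ring

lemma ea2 (c : Ctx f α S t0 t1) {t : ℝ} (ht : t ∈ Set.Ioo t0 t1) :
    HasDerivAt (fun s => Ea f α s (fun x => r2 f s x ^ 2))
      ((α - 2) * (α - 3) / 2 * Ea f α t (fun x => (r1 f t x) ^ 2 * (r2 f t x) ^ 2)
        + (α - 2) * Ea f α t (fun x => (r2 f t x) ^ 3)
        - Ea f α t (fun x => (r3 f t x) ^ 2)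
        + α * (α - 1) / 2 * Ea f α t (fun x => (r1 f t x) ^ 2)
            * Ea f α t (fun x => (r2 f t x) ^ 2)) t := by
  have a1 := Adm.r1 c
  have a2 := Adm.r2 c
  have a3 := Adm.r3 c
  have a4 := Adm.r4 c
  have ht0 : 0 < t := c.h0.trans ht.1
  have d1 := fun x => r1_x c.hf c.hf0 c.hf1 ht0 x
  have d2 := fun x => r2_x c.hf c.hf0 c.hf1 ht0 x
  have d3 := fun x => r3_x c.hf c.hf0 c.hf1 ht0 x
  have b1 : Adm f S t0 t1 (fun s x => r2 f s x - r1 f s x * r1 f s x) := a2.sub c (a1.mul c a1)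
  have b2 : Adm f S t0 t1 (fun s x => r3 f s x - r2 f s x * r1 f s x) := a3.sub c (a2.mul c a1)
  have b3 : Adm f S t0 t1 (fun s x => r4 f s x - r3 f s x * r1 f s x) := a4.sub c (a3.mul c a1)
  -- first integration by parts
  have g1 : Adm f S t0 t1 (fun s x => r2 f s x * r3 f s x) := a2.mul c a3
  have g1' : Adm f S t0 t1 (fun s x => (r3 f s x - r2 f s x * r1 f s x) * r3 f s x
      + r2 f s x * (r4 f s x - r3 f s x * r1 f s x)) := (b2.mul c a3).add (a2.mul c b3)
  have z1 := ibp c g1 g1' ht (fun x => (d2 x).fun_mul (d3 x))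
  have i1 := (g1'.add ((Adm.const c α).mul c (g1.mul c a1))).int c ht
  -- second integration by parts
  have g2 : Adm f S t0 t1 (fun s x => r1 f s x * r2 f s x ^ 2) := a1.mul c (a2.pow c 2)
  have g2' : Adm f S t0 t1 (fun s x => (r2 f s x - r1 f s x * r1 f s x) * r2 f s x ^ 2
      + r1 f s x * (2 * (r2 f s x * (r3 f s x - r2 f s x * r1 f s x)))) :=
    (b1.mul c (a2.pow c 2)).add (a1.mul c ((Adm.const c 2).mul c (a2.mul c b2)))
  have z2 := ibp c g2 g2' ht (fun x => ((d1 x).fun_mul ((d2 x).fun_pow 2)).congr_deriv (by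
    push_cast; ring))
  have i2 := (g2'.add ((Adm.const c α).mul c (g2.mul c a1))).int c ht
  have j1 := ((a1.pow c 2).mul c (a2.pow c 2)).int c ht
  have j2 := (a2.pow c 3).int c ht
  have j3 := (a3.pow c 2).int c ht
  have hh' : Adm f S t0 t1 (fun s x => r2 f s x * (r4 f s x - r2 f s x * r2 f s x)) :=
    a2.mul c (a4.sub c (a2.mul c a2))
  refine (ea_deriv c (a2.pow c 2) hh' ht (fun s hs x =>
    ((r2_t c.hf c.hf0 c.hf1 (c.h0.trans hs.1) x).fun_pow 2).congr_deriv (by push_cast; ring)) _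
    (lin (w := fun x => heatP f t x ^ α) (T1 := fun x => r1 f t x ^ 2 * r2 f t x ^ 2)
      (T2 := fun x => r2 f t x ^ 3) (T3 := fun x => r3 f t x ^ 2)
      1 (-(α - 2) / 2) ((α - 2) * (α - 3) / 2) (α - 2) (-1) i1 i2 j1 j2 j3 z1 z2
      (fun x => by ring))).congr_deriv ?_
  simp only [Ea]
  ring

lemma ea3 (c : Ctx f α S t0 t1) {t : ℝ} (ht : t ∈ Set.Ioo t0 t1) :
    HasDerivAt (fun s => Ea f α s (fun x => r1 f s x ^ 2))
      ((α - 2) * (α - 3) / 6 * Ea f α t (fun x => (r1 f t x) ^ 4)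
        - Ea f α t (fun x => (r2 f t x) ^ 2)
        + α * (α - 1) / 2 * (Ea f α t (fun x => (r1 f t x) ^ 2)) ^ 2) t := by
  have a1 := Adm.r1 c
  have a2 := Adm.r2 c
  have a3 := Adm.r3 c
  have ht0 : 0 < t := c.h0.trans ht.1
  have d1 := fun x => r1_x c.hf c.hf0 c.hf1 ht0 x
  have d2 := fun x => r2_x c.hf c.hf0 c.hf1 ht0 x
  have b1 : Adm f S t0 t1 (fun s x => r2 f s x - r1 f s x * r1 f s x) := a2.sub c (a1.mul c a1)
  have b2 : Adm f S t0 t1 (fun s x => r3 f s x - r2 f s x * r1 f s x) := a3.sub c (a2.mul c a1)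
  -- first integration by parts
  have g1 : Adm f S t0 t1 (fun s x => r1 f s x * r2 f s x) := a1.mul c a2
  have g1' : Adm f S t0 t1 (fun s x => (r2 f s x - r1 f s x * r1 f s x) * r2 f s x
      + r1 f s x * (r3 f s x - r2 f s x * r1 f s x)) := (b1.mul c a2).add (a1.mul c b2)
  have z1 := ibp c g1 g1' ht (fun x => (d1 x).fun_mul (d2 x))
  have i1 := (g1'.add ((Adm.const c α).mul c (g1.mul c a1))).int c ht
  -- second integration by parts
  have g2 : Adm f S t0 t1 (fun s x => r1 f s x ^ 3) := a1.pow c 3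
  have g2' : Adm f S t0 t1 (fun s x => 3 * (r1 f s x ^ 2 * (r2 f s x - r1 f s x * r1 f s x))) :=
    (Adm.const c 3).mul c ((a1.pow c 2).mul c b1)
  have z2 := ibp c g2 g2' ht (fun x => ((d1 x).fun_pow 3).congr_deriv (by push_cast; ring))
  have i2 := (g2'.add ((Adm.const c α).mul c (g2.mul c a1))).int c ht
  have j1 := (a1.pow c 4).int c ht
  have j2 := (a2.pow c 2).int c ht
  have hh' : Adm f S t0 t1 (fun s x => r1 f s x * (r3 f s x - r1 f s x * r2 f s x)) :=
    a1.mul c (a3.sub c (a1.mul c a2))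
  refine (ea_deriv c (a1.pow c 2) hh' ht (fun s hs x =>
    ((r1_t c.hf c.hf0 c.hf1 (c.h0.trans hs.1) x).fun_pow 2).congr_deriv (by push_cast; ring)) _
    (lin (w := fun x => heatP f t x ^ α) (T1 := fun x => r1 f t x ^ 4)
      (T2 := fun x => r2 f t x ^ 2) (T3 := fun x => r1 f t x ^ 4)
      1 (-(α - 2) / 6) ((α - 2) * (α - 3) / 6) (-1) 0 i1 i2 j1 j2 j1 z1 z2
      (fun x => by ring))).congr_deriv ?_
  simp only [Ea]
  ring

end

lemma exists_ctx {f : ℝ → ℝ} (hf0 : ∀ x, 0 ≤ f x) (hf1 : (∫ x : ℝ, f x) = 1)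
    {α : ℝ} (hα : 0 < α) {t : ℝ} (ht : 0 < t) (htα : ltTalpha f α t) :
    ∃ S t0 t1 : ℝ, Ctx f α S t0 t1 ∧ t ∈ Set.Ioo t0 t1 := by
  have hf : Integrable f := by
    by_contra h
    rw [integral_undef h] at hf1
    norm_num at hf1
  obtain ⟨S, hS, hS0, hfin⟩ := htα
  refine ⟨S, t / 2, (t + S) / 2, ⟨hf, hf0, hf1, hα, by linarith, by linarith, by linarith, ?_⟩,
    by linarith, by linarith⟩
  unfold renyiFinite at hfin
  split_ifs at hfin with h1
  · subst h1
    simpa using mm0_integrable hf hS0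
  · have hpi := Real.pi_pos
    have hsq : 0 < Real.sqrt (2 * Real.pi * S) := Real.sqrt_pos.2 (by positivity)
    convert hfin.1.const_mul (Real.sqrt (2 * Real.pi * S) ^ α) using 1
    ext x
    have m0 := mm_pos hf hf0 hf1 hS0 x
    rw [← Real.mul_rpow hsq.le (heatP_pos hf hf0 hf1 hS0 x).le, heatP_eq,
      mul_inv_cancel_left₀ hsq.ne']

end TiltAux

/-- Time derivatives of the tilted expectations E_α[p̄₁⁴], E_α[p̄₂²], E_α[p̄₁²],
and (E_α[p̄₁²])² along the heat flow. -/
theorem deriv_of_tilted_expectations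
    (f : ℝ → ℝ) (hfm : Measurable f) (hf0 : ∀ x, 0 ≤ f x)
    (hf1 : (∫ x : ℝ, f x) = 1)
    (α : ℝ) (hα : 0 < α)
    (t : ℝ) (ht : 0 < t) (htα : ltTalpha f α t) :
    HasDerivAt (fun s => Ea f α s (fun x => (pbar f 1 s x) ^ 4))
      (3 * (α - 4) * (α - 5) / 10 * Ea f α t (fun x => (pbar f 1 t x) ^ 6)
        - 6 * Ea f α t (fun x => (pbar f 1 t x) ^ 2 * (pbar f 2 t x) ^ 2)
        + α * (α - 1) / 2 * Ea f α t (fun x => (pbar f 1 t x) ^ 4)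
            * Ea f α t (fun x => (pbar f 1 t x) ^ 2)) t
    ∧ HasDerivAt (fun s => Ea f α s (fun x => (pbar f 2 s x) ^ 2))
      ((α - 2) * (α - 3) / 2 * Ea f α t (fun x => (pbar f 1 t x) ^ 2 * (pbar f 2 t x) ^ 2)
        + (α - 2) * Ea f α t (fun x => (pbar f 2 t x) ^ 3)
        - Ea f α t (fun x => (pbar f 3 t x) ^ 2)
        + α * (α - 1) / 2 * Ea f α t (fun x => (pbar f 1 t x) ^ 2)
            * Ea f α t (fun x => (pbar f 2 t x) ^ 2)) t
    ∧ HasDerivAt (fun s => Ea f α s (fun x => (pbar f 1 s x) ^ 2))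
      ((α - 2) * (α - 3) / 6 * Ea f α t (fun x => (pbar f 1 t x) ^ 4)
        - Ea f α t (fun x => (pbar f 2 t x) ^ 2)
        + α * (α - 1) / 2 * (Ea f α t (fun x => (pbar f 1 t x) ^ 2)) ^ 2) t
    ∧ HasDerivAt (fun s => (Ea f α s (fun x => (pbar f 1 s x) ^ 2)) ^ 2)
      (Ea f α t (fun x => (pbar f 1 t x) ^ 2) *
        ((α - 2) * (α - 3) / 3 * Ea f α t (fun x => (pbar f 1 t x) ^ 4)
          - 2 * Ea f α t (fun x => (pbar f 2 t x) ^ 2)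
          + α * (α - 1) * (Ea f α t (fun x => (pbar f 1 t x) ^ 2)) ^ 2)) t := by
  obtain ⟨S, t0, t1, c, hmem⟩ := TiltAux.exists_ctx hf0 hf1 hα ht htα
  have hpos : ∀ᶠ s in nhds t, 0 < s := lt_mem_nhds ht
  obtain ⟨e1, e2, e3⟩ := TiltAux.pbar_eq c.hf c.hf0 c.hf1 ht
  rw [e1, e2, e3]
  have E1 := TiltAux.ea1 c hmem
  have E2 := TiltAux.ea2 c hmem
  have E3 : HasDerivAt (fun s => Ea f α s (fun x => (pbar f 1 s x) ^ 2)) _ t :=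
    (TiltAux.ea3 c hmem).congr_of_eventuallyEq (by
      filter_upwards [hpos] with s hs
      rw [(TiltAux.pbar_eq c.hf c.hf0 c.hf1 hs).1])
  refine ⟨E1.congr_of_eventuallyEq ?_, E2.congr_of_eventuallyEq ?_, E3, ?_⟩
  · filter_upwards [hpos] with s hs
    rw [(TiltAux.pbar_eq c.hf c.hf0 c.hf1 hs).1]
  · filter_upwards [hpos] with s hs
    rw [(TiltAux.pbar_eq c.hf c.hf0 c.hf1 hs).2.1]
  · refine (E3.fun_pow 2).congr_deriv ?_
    rw [e1]
    norm_num
    ring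
end

section
/- For every α ∈ (0,∞) with α ≠ 1 and every t ∈ (0, t_α), the map t ↦ h_α(p(·,t)) is three times differentiable and ∂³h_α(p(·,t))/∂t³ = (α/12) · [ (3(α-2)(α-3)(α-4)(α-5)/10) E_α[p̄₁⁶] − 9(α-2)(α-3) E_α[p̄₁²p̄₂²] + (3/2)α(α-1)(α-2)(α-3) E_α[p̄₁⁴] E_α[p̄₁²] − 6(α-2) E_α[p̄₂³] + 6 E_α[p̄₃²] − 9α(α-1) E_α[p̄₁²] E_α[p̄₂²] + 3α²(α-1)²(E_α[p̄₁²])³ ]. -/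
open MeasureTheory Real Filter
open scoped Classical

namespace RenyiAux

/-- unnormalised Gaussian integral with weight `w`. -/
noncomputable def EE (f w : ℝ → ℝ) (t x : ℝ) : ℝ :=
  ∫ y : ℝ, f y * (w (x - y) * Real.exp (-(x - y) ^ 2 / (2 * t)))

lemma pow_exp_bound (n : ℕ) (c : ℝ) (hc : 0 < c) :
    ∃ C : ℝ, 0 < C ∧ ∀ z : ℝ, (1 + z ^ 2) ^ n * Real.exp (-(c * z ^ 2)) ≤ C := by
  refine ⟨n.factorial * Real.exp c / c ^ n, by positivity, fun z => ?_⟩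
  have h := Real.pow_div_factorial_le_exp (c * (1 + z ^ 2)) (by positivity) n
  have hn : (0 : ℝ) < n.factorial := by positivity
  rw [div_le_iff₀ hn, mul_pow, mul_add, mul_one, Real.exp_add] at h
  rw [Real.exp_neg, ← div_eq_mul_inv, div_le_div_iff₀ (Real.exp_pos _) (by positivity)]
  nlinarith

lemma kernel_bound (n : ℕ) (b s : ℝ) (hb : 0 < b) (hbs : b < s) :
    ∃ C : ℝ, 0 < C ∧ ∀ τ, 0 < τ → τ ≤ b → ∀ z : ℝ,
      (1 + z ^ 2) ^ n * Real.exp (-z ^ 2 / (2 * τ)) ≤ C * Real.exp (-z ^ 2 / (2 * s)) := by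
  have hs : 0 < s := hb.trans hbs
  have hc : 0 < 1 / (2 * b) - 1 / (2 * s) := by
    rw [sub_pos]; apply one_div_lt_one_div_of_lt <;> linarith
  obtain ⟨C, hC, h⟩ := pow_exp_bound n _ hc
  refine ⟨C, hC, fun τ hτ hτb z => ?_⟩
  have h1 : Real.exp (-z ^ 2 / (2 * τ)) ≤
      Real.exp (-((1 / (2 * b) - 1 / (2 * s)) * z ^ 2)) * Real.exp (-z ^ 2 / (2 * s)) := by
    rw [← Real.exp_add]
    apply Real.exp_le_exp.2
    have : 1 / (2 * b) ≤ 1 / (2 * τ) := by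
      apply one_div_le_one_div_of_le <;> linarith
    have h2 := mul_le_mul_of_nonneg_right this (sq_nonneg z)
    have e1 : -z ^ 2 / (2 * τ) = - (1 / (2 * τ) * z ^ 2) := by ring
    have e2 : -z ^ 2 / (2 * s) = - (1 / (2 * s) * z ^ 2) := by ring
    rw [e1, e2]; linarith
  calc _ ≤ (1 + z ^ 2) ^ n * (Real.exp (-((1 / (2 * b) - 1 / (2 * s)) * z ^ 2)) *
      Real.exp (-z ^ 2 / (2 * s))) := by gcongr
    _ = ((1 + z ^ 2) ^ n * Real.exp (-((1 / (2 * b) - 1 / (2 * s)) * z ^ 2))) *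
      Real.exp (-z ^ 2 / (2 * s)) := by ring
    _ ≤ _ := by gcongr; exact h z

lemma kernel_bdd (n : ℕ) (b : ℝ) (hb : 0 < b) :
    ∃ C : ℝ, 0 < C ∧ ∀ τ, 0 < τ → τ ≤ b → ∀ z : ℝ,
      (1 + z ^ 2) ^ n * Real.exp (-z ^ 2 / (2 * τ)) ≤ C := by
  obtain ⟨C, hC, h⟩ := kernel_bound n b (b + 1) hb (by linarith)
  refine ⟨C, hC, fun τ h1 h2 z => (h τ h1 h2 z).trans ?_⟩
  have : Real.exp (-z ^ 2 / (2 * (b + 1))) ≤ 1 := by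
    apply Real.exp_le_one_iff.2
    apply div_nonpos_of_nonpos_of_nonneg <;> nlinarith [sq_nonneg z]
  nlinarith

lemma abs_pow_le (a : ℕ) (z : ℝ) : |z ^ a| ≤ (1 + z ^ 2) ^ a := by
  rw [abs_pow]
  apply pow_le_pow_left₀ (abs_nonneg _)
  nlinarith [sq_abs z, sq_nonneg (|z| - 1), abs_nonneg z]

/-- polynomially bounded measurable weights -/
def PB (w : ℝ → ℝ) : Prop := Continuous w ∧ ∃ (K : ℝ) (n : ℕ), 0 ≤ K ∧ ∀ z, |w z| ≤ K * (1 + z ^ 2) ^ n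

lemma PB_pow (a : ℕ) : PB (fun z => z ^ a) :=
  ⟨by fun_prop, 1, a, zero_le_one, fun z => by simpa using abs_pow_le a z⟩

lemma PB_w (n : ℕ) : PB (fun z => (1 + z ^ 2) ^ n) :=
  ⟨by fun_prop, 1, n, zero_le_one, fun z => by rw [abs_of_nonneg (by positivity), one_mul]⟩

lemma PB.bdd {w : ℝ → ℝ} (hw : PB w) {b : ℝ} (hb : 0 < b) :
    ∃ C : ℝ, 0 ≤ C ∧ ∀ τ, 0 < τ → τ ≤ b → ∀ z, |w z * Real.exp (-z ^ 2 / (2 * τ))| ≤ C := by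
  obtain ⟨-, K, n, hK, h⟩ := hw
  obtain ⟨C, hC, h'⟩ := kernel_bdd n b hb
  refine ⟨K * C, by positivity, fun τ h1 h2 z => ?_⟩
  rw [abs_mul, abs_of_pos (Real.exp_pos _)]
  calc _ ≤ K * (1 + z ^ 2) ^ n * Real.exp (-z ^ 2 / (2 * τ)) := by gcongr; exact h z
    _ = K * ((1 + z ^ 2) ^ n * Real.exp (-z ^ 2 / (2 * τ))) := by ring
    _ ≤ _ := by gcongr; exact h' τ h1 h2 z

lemma EE_int {f w : ℝ → ℝ} (hf : Integrable f) (hw : PB w) {t : ℝ} (ht : 0 < t) (x : ℝ) :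
    Integrable (fun y => f y * (w (x - y) * Real.exp (-(x - y) ^ 2 / (2 * t)))) := by
  obtain ⟨C, hC, h⟩ := hw.bdd ht
  have := hw.1
  refine hf.mul_bdd (c := C) ?_ ?_
  · apply Continuous.aestronglyMeasurable; fun_prop
  · exact Eventually.of_forall fun y => by
      rw [Real.norm_eq_abs]; exact h t ht le_rfl (x - y)

lemma EE_add {f w w' : ℝ → ℝ} (hf : Integrable f) (hw : PB w) (hw' : PB w') {t : ℝ} (ht : 0 < t)
    (x : ℝ) : EE f (fun z => w z + w' z) t x = EE f w t x + EE f w' t x := by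
  unfold EE
  rw [← integral_add (EE_int hf hw ht x) (EE_int hf hw' ht x)]
  congr 1; ext y; ring

lemma EE_smul {f w : ℝ → ℝ} (c t x : ℝ) : EE f (fun z => c * w z) t x = c * EE f w t x := by
  unfold EE
  rw [← integral_const_mul]
  congr 1; ext y; ring

lemma PB.add {w w' : ℝ → ℝ} (h : PB w) (h' : PB w') : PB (fun z => w z + w' z) := by
  obtain ⟨c, K, n, hK, h⟩ := h
  obtain ⟨c', K', n', hK', h'⟩ := h'
  refine ⟨c.add c', K + K', n + n', by positivity, fun z => ?_⟩
  have h1 : (1:ℝ) ≤ 1 + z ^ 2 := by nlinarith [sq_nonneg z]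
  calc _ ≤ |w z| + |w' z| := abs_add_le _ _
    _ ≤ K * (1 + z ^ 2) ^ n + K' * (1 + z ^ 2) ^ n' := add_le_add (h z) (h' z)
    _ ≤ K * (1 + z ^ 2) ^ (n + n') + K' * (1 + z ^ 2) ^ (n + n') := by
      gcongr <;> first | exact h1 | omega
    _ = _ := by ring

lemma PB.smul {w : ℝ → ℝ} (h : PB w) (k : ℝ) : PB (fun z => k * w z) := by
  obtain ⟨c, K, n, hK, h⟩ := h
  refine ⟨by fun_prop, |k| * K, n, by positivity, fun z => ?_⟩
  rw [abs_mul, mul_assoc]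
  gcongr; exact h z

lemma EE_mono {f w w' : ℝ → ℝ} (hf : Integrable f) (hf0 : ∀ x, 0 ≤ f x) (hw : PB w) (hw' : PB w')
    (h : ∀ z, w z ≤ w' z) {t : ℝ} (ht : 0 < t) (x : ℝ) : EE f w t x ≤ EE f w' t x := by
  apply integral_mono (EE_int hf hw ht x) (EE_int hf hw' ht x)
  intro y
  have := h (x - y)
  have := hf0 y
  dsimp only
  gcongr

lemma EE_abs_le {f w w' : ℝ → ℝ} (hf : Integrable f) (hf0 : ∀ x, 0 ≤ f x) (hw : PB w) (hw' : PB w')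
    (h : ∀ z, |w z| ≤ w' z) {t : ℝ} (ht : 0 < t) (x : ℝ) : |EE f w t x| ≤ EE f w' t x := by
  rw [abs_le]
  constructor
  · have := EE_mono hf hf0 (hw'.smul (-1)) hw (fun z => by linarith [(abs_le.1 (h z)).1]) ht x
    rw [EE_smul] at this; linarith
  · exact EE_mono hf hf0 hw hw' (fun z => (abs_le.1 (h z)).2) ht x

lemma EE_pos {f w : ℝ → ℝ} (hf : Integrable f) (hf0 : ∀ x, 0 ≤ f x) (hf1 : (∫ x : ℝ, f x) = 1)
    (hw : PB w) (hw0 : ∀ z, 0 < w z) {t : ℝ} (ht : 0 < t) (x : ℝ) : 0 < EE f w t x := by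
  have h0 : 0 < ∫ x : ℝ, f x := by rw [hf1]; exact one_pos
  unfold EE
  rw [integral_pos_iff_support_of_nonneg hf0 hf] at h0
  rw [integral_pos_iff_support_of_nonneg _ (EE_int hf hw ht x)]
  · convert h0 using 2
    ext y
    simp [Function.mem_support, (hw0 (x - y)).ne', (Real.exp_pos _).ne']
  · intro y
    exact mul_nonneg (hf0 y) (mul_nonneg (hw0 _).le (Real.exp_pos _).le)

/-- `E_a` -/
noncomputable abbrev Em (f : ℝ → ℝ) (a : ℕ) (t x : ℝ) : ℝ := EE f (fun z => z ^ a) t x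

lemma Em_deriv_x {f : ℝ → ℝ} (hf : Integrable f) (a : ℕ) {t : ℝ} (ht : 0 < t) (x : ℝ) :
    HasDerivAt (Em f a t) (a * Em f (a - 1) t x - 1 / t * Em f (a + 1) t x) x := by
  have hpb : PB (fun z => (a : ℝ) * z ^ (a - 1) + (-(1 / t)) * z ^ (a + 1)) :=
    ((PB_pow (a - 1)).smul _).add ((PB_pow (a + 1)).smul _)
  obtain ⟨C, hC, hb⟩ := hpb.bdd ht
  have key := hasDerivAt_integral_of_dominated_loc_of_deriv_le (μ := volume)
    (F := fun x y => f y * ((x - y) ^ a * Real.exp (-(x - y) ^ 2 / (2 * t))))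
    (F' := fun x y => f y * (((a : ℝ) * (x - y) ^ (a - 1) + (-(1 / t)) * (x - y) ^ (a + 1)) *
      Real.exp (-(x - y) ^ 2 / (2 * t)))) (x₀ := x) (s := Set.univ) (bound := fun y => |f y| * C)
    Filter.univ_mem
    (Eventually.of_forall fun x' => (EE_int hf (PB_pow a) ht x').aestronglyMeasurable)
    (EE_int hf (PB_pow a) ht x) (EE_int hf hpb ht x).aestronglyMeasurable
    (Eventually.of_forall fun y x' _ => by
      rw [Real.norm_eq_abs, abs_mul]
      exact mul_le_mul_of_nonneg_left (hb t ht le_rfl (x' - y)) (abs_nonneg _))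
    (hf.abs.mul_const C)
    (Eventually.of_forall fun y x' _ => by
      have h1 : HasDerivAt (fun x : ℝ => x - y) 1 x' := (hasDerivAt_id x').sub_const y
      have h2 := (h1.fun_pow a).mul (((h1.fun_pow 2).neg.div_const (2 * t)).exp)
      refine (h2.const_mul (f y)).congr_deriv ?_
      push_cast
      simp only [Pi.neg_apply]
      field_simp
      ring)
  have := key.2
  change HasDerivAt (Em f a t) (EE f (fun z => (a : ℝ) * z ^ (a - 1) + (-(1 / t)) * z ^ (a + 1)) t x) x
    at this
  rw [EE_add hf ((PB_pow (a - 1)).smul _) ((PB_pow (a + 1)).smul _) ht, EE_smul, EE_smul] at this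
  convert this using 1
  ring

lemma Em_deriv_t {f : ℝ → ℝ} (hf : Integrable f) (a : ℕ) {t : ℝ} (ht : 0 < t) (x : ℝ) :
    HasDerivAt (fun τ => Em f a τ x) (1 / (2 * t ^ 2) * Em f (a + 2) t x) t := by
  have hpb : PB (fun z => z ^ (a + 2)) := PB_pow (a + 2)
  obtain ⟨C, hC, hb⟩ := hpb.bdd (b := 2 * t) (by linarith)
  have hmem : Set.Ioo (t / 2) (2 * t) ∈ nhds t := Ioo_mem_nhds (by linarith) (by linarith)
  have key := hasDerivAt_integral_of_dominated_loc_of_deriv_le (μ := volume)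
    (F := fun τ y => f y * ((x - y) ^ a * Real.exp (-(x - y) ^ 2 / (2 * τ))))
    (F' := fun τ y => f y * ((1 / (2 * τ ^ 2) * (x - y) ^ (a + 2)) *
      Real.exp (-(x - y) ^ 2 / (2 * τ)))) (x₀ := t) (s := Set.Ioo (t / 2) (2 * t))
    (bound := fun y => |f y| * ((2 / t ^ 2) * C))
    hmem
    (by filter_upwards [hmem] with τ hτ
        exact (EE_int hf (PB_pow a) (by linarith [hτ.1]) x).aestronglyMeasurable)
    (EE_int hf (PB_pow a) ht x) (EE_int hf (hpb.smul _) ht x).aestronglyMeasurable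
    (Eventually.of_forall fun y τ hτ => by
      have hτ0 : 0 < τ := by linarith [hτ.1]
      rw [Real.norm_eq_abs, abs_mul]
      refine mul_le_mul_of_nonneg_left ?_ (abs_nonneg _)
      rw [mul_assoc, abs_mul]
      have h1 : |1 / (2 * τ ^ 2)| ≤ 2 / t ^ 2 := by
        rw [abs_of_pos (by positivity), div_le_div_iff₀ (by positivity) (by positivity)]
        nlinarith [hτ.1]
      exact mul_le_mul h1 (hb τ hτ0 hτ.2.le (x - y)) (abs_nonneg _) (by positivity))
    (hf.abs.mul_const _)
    (Eventually.of_forall fun y τ hτ => by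
      have hτ0 : 0 < τ := by linarith [hτ.1]
      have h1 : HasDerivAt (fun τ : ℝ => 2 * τ) 2 τ := by
        simpa using (hasDerivAt_id τ).const_mul 2
      have h2 := (((hasDerivAt_const τ (-(x - y) ^ 2)).div h1 (by positivity)).exp).const_mul
        ((x - y) ^ a)
      refine (h2.const_mul (f y)).congr_deriv ?_
      simp only [Pi.div_apply]
      field_simp
      ring)
  have := key.2
  change HasDerivAt _ (EE f (fun z => 1 / (2 * t ^ 2) * z ^ (a + 2)) t x) t at this
  rw [EE_smul] at this
  exact this


/-- normalisation -/
noncomputable def nrm (t : ℝ) : ℝ := (Real.sqrt (2 * Real.pi * t))⁻¹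

lemma nrm_pos {t : ℝ} (ht : 0 < t) : 0 < nrm t := by unfold nrm; positivity

lemma nrm_deriv {t : ℝ} (ht : 0 < t) : HasDerivAt nrm (-(1 / (2 * t)) * nrm t) t := by
  have hpos : 0 < 2 * Real.pi * t := by positivity
  have h1 : HasDerivAt (fun t : ℝ => 2 * Real.pi * t) (2 * Real.pi) t := by
    simpa using (hasDerivAt_id t).const_mul (2 * Real.pi)
  have h2 := (h1.sqrt hpos.ne').inv (Real.sqrt_pos.2 hpos).ne'
  refine h2.congr_deriv ?_
  unfold nrm
  have h3 := Real.sq_sqrt hpos.le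
  have h4 := Real.sqrt_pos.2 hpos
  rw [h3]
  field_simp

/-- explicit spatial derivatives of the heat flow -/
noncomputable def P (f : ℝ → ℝ) (k : ℕ) (t x : ℝ) : ℝ :=
  nrm t * (match k with
    | 0 => Em f 0 t x
    | 1 => -(1 / t) * Em f 1 t x
    | 2 => 1 / t ^ 2 * Em f 2 t x - 1 / t * Em f 0 t x
    | 3 => -(1 / t ^ 3) * Em f 3 t x + 3 / t ^ 2 * Em f 1 t x
    | _ => 1 / t ^ 4 * Em f 4 t x - 6 / t ^ 3 * Em f 2 t x + 3 / t ^ 2 * Em f 0 t x)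

lemma heatP_eq (f : ℝ → ℝ) : heatP f = P f 0 := by
  ext t x
  simp only [heatP, P, EE]
  rw [← integral_const_mul]
  congr 1; ext y; unfold nrm; ring

lemma P_deriv_x {f : ℝ → ℝ} (hf : Integrable f) (k : ℕ) (hk : k ≤ 3) {t : ℝ} (ht : 0 < t) (x : ℝ) :
    HasDerivAt (P f k t) (P f (k + 1) t x) x := by
  have h0 := Em_deriv_x hf 0 ht x
  have h1 := Em_deriv_x hf 1 ht x
  have h2 := Em_deriv_x hf 2 ht x
  have h3 := Em_deriv_x hf 3 ht x
  interval_cases k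
  · refine (h0.const_mul (nrm t)).congr_deriv ?_
    simp [P]
  · refine ((h1.const_mul (-(1 / t))).const_mul (nrm t)).congr_deriv ?_
    simp [P]; field_simp; ring
  · refine (((h2.const_mul (1 / t ^ 2)).sub (h0.const_mul (1 / t))).const_mul (nrm t)).congr_deriv ?_
    simp [P]; left; field_simp; ring
  · refine (((h3.const_mul (-(1 / t ^ 3))).add (h1.const_mul (3 / t ^ 2))).const_mul (nrm t)).congr_deriv ?_
    simp [P]; left; field_simp; ring

lemma P_deriv_t {f : ℝ → ℝ} (hf : Integrable f) (k : ℕ) (hk : k ≤ 2) {t : ℝ} (ht : 0 < t) (x : ℝ) :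
    HasDerivAt (fun τ => P f k τ x) (1 / 2 * P f (k + 2) t x) t := by
  have h0 := Em_deriv_t hf 0 ht x
  have h1 := Em_deriv_t hf 1 ht x
  have h2 := Em_deriv_t hf 2 ht x
  have hn := nrm_deriv ht
  have i1 : HasDerivAt (fun τ : ℝ => 1 / τ) (-(1 / t ^ 2)) t := by
    simpa using hasDerivAt_inv ht.ne'
  have i2 : HasDerivAt (fun τ : ℝ => 1 / τ ^ 2) (-(2 / t ^ 3)) t := by
    have := i1.fun_pow 2
    simp only [one_div, inv_pow] at this ⊢
    refine this.congr_deriv ?_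
    norm_num; field_simp
  interval_cases k
  · refine (hn.mul h0).congr_deriv ?_
    simp [P]; field_simp; ring
  · refine (hn.mul (i1.neg.mul h1)).congr_deriv ?_
    simp [P]; field_simp; ring
  · refine (hn.mul ((i2.mul h2).sub (i1.mul h0))).congr_deriv ?_
    simp [P]; field_simp; ring

lemma pk_eq {f : ℝ → ℝ} (hf : Integrable f) (k : ℕ) (hk : k ≤ 4) {t : ℝ} (ht : 0 < t) (x : ℝ) :
    pk f k t x = P f k t x := by
  unfold pk
  induction k generalizing x with
  | zero => simp [heatP_eq]
  | succ n ih =>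
    rw [iteratedDeriv_succ]
    have : iteratedDeriv n (heatP f t) = P f n t := funext fun y => ih (by omega) y
    rw [this]
    exact (P_deriv_x hf n (by omega) ht x).deriv

/-- ratio -/
noncomputable def v (f : ℝ → ℝ) (k : ℕ) (t x : ℝ) : ℝ := P f k t x / P f 0 t x

section
variable {f : ℝ → ℝ}

lemma Em0_pos (hf : Integrable f) (hf0 : ∀ x, 0 ≤ f x) (hf1 : (∫ x : ℝ, f x) = 1)
    {t : ℝ} (ht : 0 < t) (x : ℝ) : 0 < Em f 0 t x :=
  EE_pos hf hf0 hf1 (PB_pow 0) (fun z => by simp) ht x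

lemma P0_pos (hf : Integrable f) (hf0 : ∀ x, 0 ≤ f x) (hf1 : (∫ x : ℝ, f x) = 1)
    {t : ℝ} (ht : 0 < t) (x : ℝ) : 0 < P f 0 t x :=
  mul_pos (nrm_pos ht) (Em0_pos hf hf0 hf1 ht x)

lemma v_deriv_x (hf : Integrable f) (hf0 : ∀ x, 0 ≤ f x) (hf1 : (∫ x : ℝ, f x) = 1)
    (k : ℕ) (hk : k ≤ 3) {t : ℝ} (ht : 0 < t) (x : ℝ) :
    HasDerivAt (v f k t) (v f (k + 1) t x - v f k t x * v f 1 t x) x := by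
  have h := P0_pos hf hf0 hf1 ht x
  refine ((P_deriv_x hf k hk ht x).div (P_deriv_x hf 0 (by omega) ht x) h.ne').congr_deriv ?_
  unfold v; field_simp

lemma v_deriv_t (hf : Integrable f) (hf0 : ∀ x, 0 ≤ f x) (hf1 : (∫ x : ℝ, f x) = 1)
    (k : ℕ) (hk : k ≤ 2) {t : ℝ} (ht : 0 < t) (x : ℝ) :
    HasDerivAt (fun τ => v f k τ x) (1 / 2 * (v f (k + 2) t x - v f k t x * v f 2 t x)) t := by
  have h := P0_pos hf hf0 hf1 ht x
  refine ((P_deriv_t hf k hk ht x).div (P_deriv_t hf 0 (by omega) ht x) h.ne').congr_deriv ?_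
  unfold v; field_simp

lemma Em_cont (hf : Integrable f) (a : ℕ) {t : ℝ} (ht : 0 < t) : Continuous (Em f a t) :=
  continuous_iff_continuousAt.2 fun x => (Em_deriv_x hf a ht x).continuousAt

lemma P_cont (hf : Integrable f) (k : ℕ) {t : ℝ} (ht : 0 < t) : Continuous (P f k t) := by
  have h := fun a => Em_cont hf a ht
  have h0 := h 0
  have h1 := h 1
  have h2 := h 2
  have h3 := h 3
  have h4 := h 4
  unfold P
  split <;> fun_prop

lemma v_cont (hf : Integrable f) (hf0 : ∀ x, 0 ≤ f x) (hf1 : (∫ x : ℝ, f x) = 1)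
    (k : ℕ) {t : ℝ} (ht : 0 < t) : Continuous (v f k t) :=
  (P_cont hf k ht).div (P_cont hf 0 ht) fun x => ne_of_gt (P0_pos hf hf0 hf1 ht x)

/-- majorant of the ratios -/
noncomputable def cc (f : ℝ → ℝ) (t x : ℝ) : ℝ := EE f (fun z => (1 + z ^ 2) ^ 2) t x / Em f 0 t x

lemma young (c u : ℝ) (hc : 0 ≤ c) (hu : 0 ≤ u) (n : ℕ) :
    (n + 1) * c ^ n * u ≤ n * c ^ (n + 1) + u ^ (n + 1) := by
  induction n with
  | zero => simp
  | succ n ih =>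
    push_cast
    have h1 := mul_le_mul_of_nonneg_left ih hu
    have h2 : 0 ≤ (n + 1) * c ^ n * (u - c) ^ 2 := by positivity
    have e1 : c ^ (n + 1) = c ^ n * c := pow_succ _ _
    have e2 : c ^ (n + 1 + 1) = c ^ n * c * c := by rw [pow_succ, pow_succ]
    have e3 : u ^ (n + 1 + 1) = u ^ (n + 1) * u := pow_succ _ _
    rw [e2, e3, e1]
    rw [e1] at h1
    nlinarith

lemma cc_one_le (hf : Integrable f) (hf0 : ∀ x, 0 ≤ f x) (hf1 : (∫ x : ℝ, f x) = 1)
    {t : ℝ} (ht : 0 < t) (x : ℝ) : 1 ≤ cc f t x := by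
  unfold cc
  rw [one_le_div (Em0_pos hf hf0 hf1 ht x)]
  refine EE_mono hf hf0 (PB_pow 0) (PB_w 2) (fun z => ?_) ht x
  simp only [pow_zero]
  exact one_le_pow₀ (by nlinarith [sq_nonneg z])

lemma Em_le_cc (hf : Integrable f) (hf0 : ∀ x, 0 ≤ f x) (hf1 : (∫ x : ℝ, f x) = 1)
    (a : ℕ) (ha : a ≤ 4) {t : ℝ} (ht : 0 < t) (x : ℝ) : |Em f a t x| ≤ cc f t x * Em f 0 t x := by
  unfold cc
  rw [div_mul_cancel₀ _ (Em0_pos hf hf0 hf1 ht x).ne']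
  refine EE_abs_le hf hf0 (PB_pow a) (PB_w 2) (fun z => ?_) ht x
  rw [abs_pow]
  have h0 := abs_nonneg z
  have hs := sq_abs z
  rw [← hs]
  generalize |z| = u at *
  interval_cases a <;> nlinarith [sq_nonneg (u - 1), sq_nonneg (u ^ 2), sq_nonneg (u * (u - 1)), sq_nonneg (u^2 - 1)]

/-- Jensen. -/
lemma cc_pow_le (hf : Integrable f) (hf0 : ∀ x, 0 ≤ f x) (hf1 : (∫ x : ℝ, f x) = 1)
    (n : ℕ) {t : ℝ} (ht : 0 < t) (x : ℝ) :
    cc f t x ^ (n + 1) * Em f 0 t x ≤ EE f (fun z => (1 + z ^ 2) ^ (2 * (n + 1))) t x := by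
  set c := cc f t x with hc
  have hc1 : 1 ≤ c := cc_one_le hf hf0 hf1 ht x
  have hE := Em0_pos hf hf0 hf1 ht x
  have hA : EE f (fun z => (1 + z ^ 2) ^ 2) t x = c * Em f 0 t x := by
    rw [hc, cc, div_mul_cancel₀ _ hE.ne']
  have h := EE_mono hf hf0 (((PB_w 2).smul ((n + 1) * c ^ n)).add ((PB_pow 0).smul (-(n * c ^ (n + 1)))))
    (PB_w (2 * (n + 1))) (fun z => by
      have := young c ((1 + z ^ 2) ^ 2) (by linarith) (by positivity) n
      rw [← pow_mul] at this
      simp only [pow_zero, mul_one]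
      linarith) ht x
  rw [EE_add hf ((PB_w 2).smul _) ((PB_pow 0).smul _) ht, EE_smul, EE_smul, hA] at h
  change _ + _ * Em f 0 t x ≤ _ at h
  refine le_trans (le_of_eq ?_) h
  ring

lemma nrm_bound {a : ℝ} (ha : 0 < a) {τ : ℝ} (h : a ≤ τ) : nrm τ ≤ nrm a := by
  unfold nrm
  gcongr

lemma cc_P_le (hf : Integrable f) (hf0 : ∀ x, 0 ≤ f x) (hf1 : (∫ x : ℝ, f x) = 1)
    (n : ℕ) {a b s : ℝ} (ha : 0 < a) (hab : a ≤ b) (hbs : b < s) :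
    ∃ C, 0 < C ∧ ∀ τ, a ≤ τ → τ ≤ b → ∀ x, cc f τ x ^ (n + 1) * P f 0 τ x ≤ C * P f 0 s x := by
  have hs : 0 < s := by linarith
  obtain ⟨C, hC, h⟩ := kernel_bound (2 * (n + 1)) b s (by linarith) hbs
  refine ⟨nrm a * C / nrm s, by have := nrm_pos ha; have := nrm_pos hs; positivity,
    fun τ h1 h2 x => ?_⟩
  have hτ : 0 < τ := by linarith
  have k1 := cc_pow_le hf hf0 hf1 n hτ x
  have k2 : EE f (fun z => (1 + z ^ 2) ^ (2 * (n + 1))) τ x ≤ C * Em f 0 s x := by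
    rw [← EE_smul]
    apply integral_mono (EE_int hf (PB_w _) hτ x) (EE_int hf ((PB_pow 0).smul C) hs x)
    intro y
    have := h τ hτ h2 (x - y)
    have := hf0 y
    simp only [pow_zero, mul_one]
    gcongr
  have k3 := nrm_bound ha h1
  have k4 : cc f τ x ^ (n + 1) * Em f 0 τ x ≤ C * Em f 0 s x := k1.trans k2
  have hn := (nrm_pos hs).ne'
  have hE := Em0_pos hf hf0 hf1 hs x
  calc cc f τ x ^ (n + 1) * P f 0 τ x = nrm τ * (cc f τ x ^ (n + 1) * Em f 0 τ x) := by
        unfold P; ring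
    _ ≤ nrm a * (C * Em f 0 s x) := by
        apply mul_le_mul k3 k4 _ (nrm_pos ha).le
        have := cc_one_le hf hf0 hf1 hτ x
        have := Em0_pos hf hf0 hf1 hτ x
        positivity
    _ = _ := by unfold P; field_simp

lemma v_le_cc (hf : Integrable f) (hf0 : ∀ x, 0 ≤ f x) (hf1 : (∫ x : ℝ, f x) = 1)
    (k : ℕ) {a : ℝ} (ha : 0 < a) :
    ∃ C, 0 ≤ C ∧ ∀ τ, a ≤ τ → ∀ x, |v f k τ x| ≤ C * cc f τ x := by
  have key : ∀ τ, a ≤ τ → ∀ x, ∀ j : ℕ, j ≤ 4 → ∀ d : ℕ, ∀ r : ℝ, 0 ≤ r →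
      |r / τ ^ d * Em f j τ x| ≤ r / a ^ d * (cc f τ x * Em f 0 τ x) := by
    intro τ hτ x j hj d r hr
    have hτ0 : 0 < τ := by linarith
    rw [abs_mul, abs_of_nonneg (by positivity)]
    apply mul_le_mul _ (Em_le_cc hf hf0 hf1 j hj hτ0 x) (abs_nonneg _) (by positivity)
    gcongr
  have main : ∃ C, 0 ≤ C ∧ ∀ τ, a ≤ τ → ∀ x, |P f k τ x / nrm τ| ≤ C * (cc f τ x * Em f 0 τ x) := by
    refine ⟨1 + 1 / a ^ 1 + 1 / a ^ 2 + 1 / a ^ 3 + 3 / a ^ 2 + 1 / a ^ 4 + 6 / a ^ 3 + 3 / a ^ 2,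
      by positivity, fun τ hτ x => ?_⟩
    have hτ0 : 0 < τ := by linarith
    have hn := (nrm_pos hτ0).ne'
    have hX : 0 ≤ cc f τ x * Em f 0 τ x := by
      have := cc_one_le hf hf0 hf1 hτ0 x
      have := Em0_pos hf hf0 hf1 hτ0 x
      positivity
    unfold P
    rw [mul_div_cancel_left₀ _ hn]
    have q := key τ hτ x
    generalize cc f τ x * Em f 0 τ x = X at *
    have p1 : 0 ≤ 1 / a ^ 1 * X := by positivity
    have p2 : 0 ≤ 1 / a ^ 2 * X := by positivity
    have p3 : 0 ≤ 1 / a ^ 3 * X := by positivity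
    have p4 : 0 ≤ 3 / a ^ 2 * X := by positivity
    have p5 : 0 ≤ 1 / a ^ 4 * X := by positivity
    have p6 : 0 ≤ 6 / a ^ 3 * X := by positivity
    have q0 := abs_le.1 (q 0 (by omega) 0 1 (by norm_num))
    have q1 := abs_le.1 (q 1 (by omega) 1 1 (by norm_num))
    have q2 := abs_le.1 (q 2 (by omega) 2 1 (by norm_num))
    have q2' := abs_le.1 (q 0 (by omega) 1 1 (by norm_num))
    have q3 := abs_le.1 (q 3 (by omega) 3 1 (by norm_num))
    have q3' := abs_le.1 (q 1 (by omega) 2 3 (by norm_num))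
    have q4 := abs_le.1 (q 4 (by omega) 4 1 (by norm_num))
    have q4' := abs_le.1 (q 2 (by omega) 3 6 (by norm_num))
    have q4'' := abs_le.1 (q 0 (by omega) 2 3 (by norm_num))
    rw [show (1:ℝ) / τ ^ 1 = 1 / τ by rw [pow_one]] at q1 q2'
    rw [show (1:ℝ) / τ ^ 0 = 1 by simp, show (1:ℝ) / a ^ 0 = 1 by simp] at q0
    rw [abs_le]
    split <;> constructor <;> linarith [q0.1, q0.2, q1.1, q1.2, q2.1, q2.2, q3.1, q3.2, q4.1, q4.2]
  obtain ⟨C, hC, h⟩ := main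
  refine ⟨C, hC, fun τ hτ x => ?_⟩
  have hτ0 : 0 < τ := by linarith
  have hn := nrm_pos hτ0
  have hE := Em0_pos hf hf0 hf1 hτ0 x
  have e : v f k τ x = (P f k τ x / nrm τ) / Em f 0 τ x := by
    have : P f 0 τ x = nrm τ * Em f 0 τ x := rfl
    rw [v, this, div_div]
  rw [e, abs_div, abs_of_pos hE, div_le_iff₀ hE, mul_assoc]
  exact h τ hτ x

end

/-- standing assumptions on the density -/
structure Dens (f : ℝ → ℝ) : Prop where
  int : Integrable f
  nn : ∀ x, 0 ≤ f x
  one : (∫ x : ℝ, f x) = 1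

/-- continuous functions dominated by powers of `cc`, locally uniformly in time -/
def Good (f : ℝ → ℝ) (F : ℝ → ℝ → ℝ) : Prop :=
  (∀ τ, 0 < τ → Continuous (F τ)) ∧
  ∀ a, 0 < a → ∃ (K : ℝ) (r : ℕ), 0 ≤ K ∧ ∀ τ, a ≤ τ → ∀ x, |F τ x| ≤ K * cc f τ x ^ r

variable {f : ℝ → ℝ}

lemma Good.const (hd : Dens f) (k : ℝ) : Good f (fun _ _ => k) :=
  ⟨fun _ _ => continuous_const, fun a _ => ⟨|k|, 0, abs_nonneg _, fun τ _ x => by simp⟩⟩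

lemma Good.v (hd : Dens f) (k : ℕ) : Good f (v f k) :=
  ⟨fun _ h => v_cont hd.int hd.nn hd.one k h, fun a ha => by
    obtain ⟨C, hC, h⟩ := v_le_cc hd.int hd.nn hd.one k ha
    exact ⟨C, 1, hC, fun τ hτ x => by simpa using h τ hτ x⟩⟩

lemma Good.add (hd : Dens f) {F G : ℝ → ℝ → ℝ} (hF : Good f F) (hG : Good f G) :
    Good f (fun τ x => F τ x + G τ x) := by
  refine ⟨fun τ h => (hF.1 τ h).add (hG.1 τ h), fun a ha => ?_⟩
  obtain ⟨K, r, hK, h⟩ := hF.2 a ha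
  obtain ⟨K', r', hK', h'⟩ := hG.2 a ha
  refine ⟨K + K', r + r', by positivity, fun τ hτ x => ?_⟩
  have h1 := cc_one_le hd.int hd.nn hd.one (ha.trans_le hτ) x
  calc _ ≤ |F τ x| + |G τ x| := abs_add_le _ _
    _ ≤ K * cc f τ x ^ r + K' * cc f τ x ^ r' := add_le_add (h τ hτ x) (h' τ hτ x)
    _ ≤ K * cc f τ x ^ (r + r') + K' * cc f τ x ^ (r + r') := by
      gcongr <;> first | exact h1 | omega
    _ = _ := by ring

lemma Good.mul (hd : Dens f) {F G : ℝ → ℝ → ℝ} (hF : Good f F) (hG : Good f G) :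
    Good f (fun τ x => F τ x * G τ x) := by
  refine ⟨fun τ h => (hF.1 τ h).mul (hG.1 τ h), fun a ha => ?_⟩
  obtain ⟨K, r, hK, h⟩ := hF.2 a ha
  obtain ⟨K', r', hK', h'⟩ := hG.2 a ha
  refine ⟨K * K', r + r', by positivity, fun τ hτ x => ?_⟩
  have h1 := cc_one_le hd.int hd.nn hd.one (ha.trans_le hτ) x
  rw [abs_mul]
  calc _ ≤ (K * cc f τ x ^ r) * (K' * cc f τ x ^ r') :=
        mul_le_mul (h τ hτ x) (h' τ hτ x) (abs_nonneg _) (by positivity)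
    _ = _ := by ring

lemma Good.sub (hd : Dens f) {F G : ℝ → ℝ → ℝ} (hF : Good f F) (hG : Good f G) :
    Good f (fun τ x => F τ x - G τ x) := by
  have := hF.add hd ((Good.const hd (-1)).mul hd hG)
  simpa only [neg_one_mul, ← sub_eq_add_neg] using this

lemma Good.pow (hd : Dens f) {F : ℝ → ℝ → ℝ} (hF : Good f F) (n : ℕ) :
    Good f (fun τ x => F τ x ^ n) := by
  induction n with
  | zero => simpa using Good.const hd 1
  | succ n ih => simpa [pow_succ] using ih.mul hd hF

lemma Good.dom (hd : Dens f) {F : ℝ → ℝ → ℝ} (hF : Good f F) {α : ℝ} (hα : 0 < α)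
    {a b s : ℝ} (ha : 0 < a) (hab : a ≤ b) (hbs : b < s) :
    ∃ C, 0 ≤ C ∧ ∀ τ, a ≤ τ → τ ≤ b → ∀ x, |F τ x * P f 0 τ x ^ α| ≤ C * P f 0 s x ^ α := by
  obtain ⟨K, r, hK, h⟩ := hF.2 a ha
  obtain ⟨n, hn⟩ := exists_nat_ge ((r : ℝ) / α)
  obtain ⟨C, hC, h'⟩ := cc_P_le hd.int hd.nn hd.one n ha hab hbs
  have hs : 0 < s := by linarith
  refine ⟨K * C ^ α, by positivity, fun τ h1 h2 x => ?_⟩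
  have hτ : 0 < τ := by linarith
  have hc := cc_one_le hd.int hd.nn hd.one hτ x
  have hp := P0_pos hd.int hd.nn hd.one hτ x
  have hps := P0_pos hd.int hd.nn hd.one hs x
  have hr : (r : ℝ) ≤ ((n + 1 : ℕ) : ℝ) * α := by
    rw [div_le_iff₀ hα] at hn
    push_cast
    linarith
  have e : cc f τ x ^ r ≤ (cc f τ x ^ (n + 1)) ^ α := by
    rw [← Real.rpow_natCast, ← Real.rpow_natCast, ← Real.rpow_mul (by linarith)]
    exact Real.rpow_le_rpow_of_exponent_le hc hr
  rw [abs_mul, abs_of_pos (Real.rpow_pos_of_pos hp α)]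
  calc _ ≤ K * cc f τ x ^ r * P f 0 τ x ^ α := by gcongr; exact h τ h1 x
    _ ≤ K * (cc f τ x ^ (n + 1)) ^ α * P f 0 τ x ^ α := by gcongr
    _ = K * (cc f τ x ^ (n + 1) * P f 0 τ x) ^ α := by
      rw [Real.mul_rpow (by positivity) hp.le]; ring
    _ ≤ K * (C * P f 0 s x) ^ α := 
      mul_le_mul_of_nonneg_left (Real.rpow_le_rpow (by positivity) (h' τ h1 h2 x) hα.le) hK
    _ = _ := by rw [Real.mul_rpow hC.le hps.le]; ring

/-- weighted integral -/
noncomputable def J (f : ℝ → ℝ) (α : ℝ) (F : ℝ → ℝ → ℝ) (τ : ℝ) : ℝ :=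
  ∫ x : ℝ, F τ x * P f 0 τ x ^ α

lemma pa_cont (hd : Dens f) (α : ℝ) {τ : ℝ} (h : 0 < τ) : Continuous (fun x => P f 0 τ x ^ α) :=
  (P_cont hd.int 0 h).rpow_const fun x => Or.inl (P0_pos hd.int hd.nn hd.one h x).ne'

lemma Good.integrable (hd : Dens f) {F : ℝ → ℝ → ℝ} (hF : Good f F) {α : ℝ} (hα : 0 < α)
    {s : ℝ} (hI : Integrable (fun x => P f 0 s x ^ α)) {τ : ℝ} (hτ : 0 < τ) (hτs : τ < s) :
    Integrable (fun x => F τ x * P f 0 τ x ^ α) := by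
  obtain ⟨C, hC, h⟩ := hF.dom hd hα hτ le_rfl hτs
  refine (hI.const_mul C).mono' ((hF.1 τ hτ).mul (pa_cont hd α hτ)).aestronglyMeasurable ?_
  exact Eventually.of_forall fun x => h τ le_rfl le_rfl x

lemma pa_deriv_t (hd : Dens f) (α : ℝ) {τ : ℝ} (h : 0 < τ) (x : ℝ) :
    HasDerivAt (fun τ => P f 0 τ x ^ α) (α / 2 * v f 2 τ x * P f 0 τ x ^ α) τ := by
  have hp := P0_pos hd.int hd.nn hd.one h x
  refine ((P_deriv_t hd.int 0 (by omega) h x).rpow_const (p := α) (Or.inl hp.ne')).congr_deriv ?_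
  rw [Real.rpow_sub_one hp.ne', v]
  field_simp

lemma pa_deriv_x (hd : Dens f) (α : ℝ) {τ : ℝ} (h : 0 < τ) (x : ℝ) :
    HasDerivAt (fun x => P f 0 τ x ^ α) (α * v f 1 τ x * P f 0 τ x ^ α) x := by
  have hp := P0_pos hd.int hd.nn hd.one h x
  refine ((P_deriv_x hd.int 0 (by omega) h x).rpow_const (p := α) (Or.inl hp.ne')).congr_deriv ?_
  rw [Real.rpow_sub_one hp.ne', v]
  field_simp

lemma J_deriv (hd : Dens f) {α : ℝ} (hα : 0 < α) {s : ℝ}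
    (hI : Integrable (fun x => P f 0 s x ^ α)) {F F' : ℝ → ℝ → ℝ} (hF : Good f F)
    (hF' : Good f F') (hder : ∀ τ, 0 < τ → ∀ x, HasDerivAt (fun τ => F τ x) (F' τ x) τ)
    {t : ℝ} (ht : 0 < t) (hts : t < s) :
    HasDerivAt (J f α F) (J f α (fun τ x => F' τ x + α / 2 * v f 2 τ x * F τ x) t) t := by
  have hG : Good f (fun τ x => F' τ x + α / 2 * v f 2 τ x * F τ x) :=
    hF'.add hd (((Good.const hd (α / 2)).mul hd (Good.v hd 2)).mul hd hF)
  obtain ⟨C, hC, h⟩ := hG.dom hd hα (a := t / 2) (b := (t + s) / 2) (s := s)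
    (by linarith) (by linarith) (by linarith)
  have hmem : Set.Ioo (t / 2) ((t + s) / 2) ∈ nhds t := Ioo_mem_nhds (by linarith) (by linarith)
  exact (hasDerivAt_integral_of_dominated_loc_of_deriv_le (μ := volume)
    (F := fun τ x => F τ x * P f 0 τ x ^ α)
    (F' := fun τ x => (F' τ x + α / 2 * v f 2 τ x * F τ x) * P f 0 τ x ^ α) (x₀ := t)
    (bound := fun x => C * P f 0 s x ^ α)
    hmem
    (by filter_upwards [hmem] with τ hτ
        have hτ0 : 0 < τ := by linarith [hτ.1]
        exact ((hF.1 τ hτ0).mul (pa_cont hd α hτ0)).aestronglyMeasurable)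
    (hF.integrable hd hα hI ht hts)
    ((hG.1 t ht).mul (pa_cont hd α ht)).aestronglyMeasurable
    (Eventually.of_forall fun x τ hτ => h τ hτ.1.le hτ.2.le x)
    (hI.const_mul C)
    (Eventually.of_forall fun x τ hτ => by
      have hτ0 : 0 < τ := by linarith [hτ.1]
      refine ((hder τ hτ0 x).mul (pa_deriv_t hd α hτ0 x)).congr_deriv ?_
      ring)).2

lemma J_ibp (hd : Dens f) {α : ℝ} (hα : 0 < α) {s : ℝ}
    (hI : Integrable (fun x => P f 0 s x ^ α)) {F F' T G : ℝ → ℝ → ℝ} (hF : Good f F)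
    (hF' : Good f F') (hT : Good f T)
    (hder : ∀ τ, 0 < τ → ∀ x, HasDerivAt (fun x => F τ x) (F' τ x) x)
    {t : ℝ} (ht : 0 < t) (hts : t < s)
    (hG : ∀ x, G t x = T t x + (F' t x + α * v f 1 t x * F t x)) :
    J f α G t = J f α T t := by
  have hH : Good f (fun τ x => F' τ x + α * v f 1 τ x * F τ x) :=
    hF'.add hd (((Good.const hd α).mul hd (Good.v hd 1)).mul hd hF)
  have hz : ∫ x, (F' t x + α * v f 1 t x * F t x) * P f 0 t x ^ α = 0 := by
    refine integral_eq_zero_of_hasDerivAt_of_integrable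
      (f := fun x => F t x * P f 0 t x ^ α) (fun x => ?_)
      (hH.integrable hd hα hI ht hts) (hF.integrable hd hα hI ht hts)
    refine ((hder t ht x).mul (pa_deriv_x hd α ht x)).congr_deriv ?_
    ring
  unfold J
  have : ∀ x, G t x * P f 0 t x ^ α =
      T t x * P f 0 t x ^ α + (F' t x + α * v f 1 t x * F t x) * P f 0 t x ^ α := by
    intro x; rw [hG]; ring
  simp_rw [this]
  rw [integral_add (hT.integrable hd hα hI ht hts) (hH.integrable hd hα hI ht hts), hz, add_zero]

lemma J_add (hd : Dens f) {α : ℝ} (hα : 0 < α) {s : ℝ}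
    (hI : Integrable (fun x => P f 0 s x ^ α)) {F G : ℝ → ℝ → ℝ} (hF : Good f F)
    (hG : Good f G) {t : ℝ} (ht : 0 < t) (hts : t < s) :
    J f α (fun τ x => F τ x + G τ x) t = J f α F t + J f α G t := by
  unfold J
  rw [← integral_add (hF.integrable hd hα hI ht hts) (hG.integrable hd hα hI ht hts)]
  congr 1; ext x; ring

lemma J_smul (α k : ℝ) (F : ℝ → ℝ → ℝ) (t : ℝ) :
    J f α (fun τ x => k * F τ x) t = k * J f α F t := by
  unfold J
  rw [← integral_const_mul]
  congr 1; ext x; ring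

section main

lemma J0_deriv (hd : Dens f) {α : ℝ} (hα : 0 < α) {s : ℝ}
    (hI : Integrable (fun x => P f 0 s x ^ α)) {t : ℝ} (ht : 0 < t) (hts : t < s) :
    HasDerivAt (J f α (fun _ _ => 1))
    (-(α * (α - 1) / 2) * J f α (fun τ x => v f 1 τ x ^ 2) t) t := by
  have g1 := Good.v hd 1
  have g2 := Good.v hd 2
  have h := J_deriv hd hα hI (Good.const hd 1) (Good.const hd 0)
    (fun τ _ x => hasDerivAt_const τ (1 : ℝ)) ht hts
  refine h.congr_deriv ?_
  rw [← J_smul]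
  refine J_ibp hd hα hI (F := fun τ x => α / 2 * v f 1 τ x)
    (F' := fun τ x => α / 2 * (v f 2 τ x - v f 1 τ x * v f 1 τ x))
    ((Good.const hd _).mul hd g1) ((Good.const hd _).mul hd (g2.sub hd (g1.mul hd g1)))
    ((Good.const hd _).mul hd (g1.pow hd 2)) (fun τ hτ x => ?_) ht hts (fun x => ?_)
  · exact (v_deriv_x hd.int hd.nn hd.one 1 (by omega) hτ x).const_mul _
  · ring

lemma J1_deriv (hd : Dens f) {α : ℝ} (hα : 0 < α) {s : ℝ}
    (hI : Integrable (fun x => P f 0 s x ^ α)) {t : ℝ} (ht : 0 < t) (hts : t < s) :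
    HasDerivAt (J f α (fun τ x => v f 1 τ x ^ 2))
    (-J f α (fun τ x => v f 2 τ x ^ 2) t
      + (α - 2) * (α - 3) / 6 * J f α (fun τ x => v f 1 τ x ^ 4) t) t := by
  have g1 := Good.v hd 1
  have g2 := Good.v hd 2
  have g3 := Good.v hd 3
  have gc := Good.const hd
  have dx := fun k hk τ hτ x => v_deriv_x hd.int hd.nn hd.one k hk (t := τ) hτ x
  have h := J_deriv hd hα hI (g1.pow hd 2)
    (F' := fun τ x => v f 1 τ x * (v f 3 τ x - v f 1 τ x * v f 2 τ x))
    (g1.mul hd (g3.sub hd (g1.mul hd g2)))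
    (fun τ hτ x => ((v_deriv_t hd.int hd.nn hd.one 1 (by omega) hτ x).fun_pow 2).congr_deriv
      (by push_cast; ring)) ht hts
  refine h.congr_deriv ?_
  rw [← J_smul, neg_eq_neg_one_mul, ← J_smul, ← J_add hd hα hI
    ((gc _).mul hd (g2.pow hd 2)) ((gc _).mul hd (g1.pow hd 4)) ht hts]
  refine J_ibp hd hα hI
    (F := fun τ x => v f 1 τ x * v f 2 τ x + -((α - 2) / 6) * v f 1 τ x ^ 3)
    (F' := fun τ x => (v f 2 τ x - v f 1 τ x * v f 1 τ x) * v f 2 τ x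
        + v f 1 τ x * (v f 3 τ x - v f 2 τ x * v f 1 τ x)
        + -((α - 2) / 6) * (3 * v f 1 τ x ^ 2 * (v f 2 τ x - v f 1 τ x * v f 1 τ x)))
    ((g1.mul hd g2).add hd ((gc _).mul hd (g1.pow hd 3)))
    ((((g2.sub hd (g1.mul hd g1)).mul hd g2).add hd
      (g1.mul hd (g3.sub hd (g2.mul hd g1)))).add hd
      ((gc _).mul hd (((gc 3).mul hd (g1.pow hd 2)).mul hd (g2.sub hd (g1.mul hd g1)))))
    (((gc _).mul hd (g2.pow hd 2)).add hd ((gc _).mul hd (g1.pow hd 4)))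
    (fun τ hτ x => ?_) ht hts (fun x => ?_)
  · refine (((dx 1 (by omega) τ hτ x).mul (dx 2 (by omega) τ hτ x)).add
      (((dx 1 (by omega) τ hτ x).fun_pow 3).const_mul _)).congr_deriv ?_
    push_cast; ring
  · ring

lemma J22_deriv (hd : Dens f) {α : ℝ} (hα : 0 < α) {s : ℝ}
    (hI : Integrable (fun x => P f 0 s x ^ α)) {t : ℝ} (ht : 0 < t) (hts : t < s) :
    HasDerivAt (J f α (fun τ x => v f 2 τ x ^ 2))
    (-J f α (fun τ x => v f 3 τ x ^ 2) t + (α - 2) * J f α (fun τ x => v f 2 τ x ^ 3) t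
      + (α - 2) * (α - 3) / 2 * J f α (fun τ x => v f 1 τ x ^ 2 * v f 2 τ x ^ 2) t) t := by
  have g1 := Good.v hd 1
  have g2 := Good.v hd 2
  have g3 := Good.v hd 3
  have g4 := Good.v hd 4
  have gc := Good.const hd
  have dx := fun k hk τ hτ x => v_deriv_x hd.int hd.nn hd.one k hk (t := τ) hτ x
  have h := J_deriv hd hα hI (g2.pow hd 2)
    (F' := fun τ x => v f 2 τ x * (v f 4 τ x - v f 2 τ x * v f 2 τ x))
    (g2.mul hd (g4.sub hd (g2.mul hd g2)))
    (fun τ hτ x => ((v_deriv_t hd.int hd.nn hd.one 2 (by omega) hτ x).fun_pow 2).congr_deriv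
      (by push_cast; ring)) ht hts
  refine h.congr_deriv ?_
  have ga := ((gc (-1)).mul hd (g3.pow hd 2))
  have gb := ((gc (α - 2)).mul hd (g2.pow hd 3))
  have gd := ((gc ((α - 2) * (α - 3) / 2)).mul hd ((g1.pow hd 2).mul hd (g2.pow hd 2)))
  rw [← J_smul, neg_eq_neg_one_mul, ← J_smul, ← J_smul, ← J_add hd hα hI ga gb ht hts,
    ← J_add hd hα hI (ga.add hd gb) gd ht hts]
  refine J_ibp hd hα hI
    (F := fun τ x => v f 2 τ x * v f 3 τ x + -((α - 2) / 2) * (v f 1 τ x * v f 2 τ x ^ 2))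
    (F' := fun τ x => (v f 3 τ x - v f 2 τ x * v f 1 τ x) * v f 3 τ x
        + v f 2 τ x * (v f 4 τ x - v f 3 τ x * v f 1 τ x)
        + -((α - 2) / 2) * ((v f 2 τ x - v f 1 τ x * v f 1 τ x) * v f 2 τ x ^ 2
          + v f 1 τ x * (2 * v f 2 τ x * (v f 3 τ x - v f 2 τ x * v f 1 τ x))))
    ((g2.mul hd g3).add hd ((gc _).mul hd (g1.mul hd (g2.pow hd 2))))
    ((((g3.sub hd (g2.mul hd g1)).mul hd g3).add hd
      (g2.mul hd (g4.sub hd (g3.mul hd g1)))).add hd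
      ((gc _).mul hd (((g2.sub hd (g1.mul hd g1)).mul hd (g2.pow hd 2)).add hd
        (g1.mul hd (((gc 2).mul hd g2).mul hd (g3.sub hd (g2.mul hd g1)))))))
    ((ga.add hd gb).add hd gd)
    (fun τ hτ x => ?_) ht hts (fun x => ?_)
  · refine (((dx 2 (by omega) τ hτ x).mul (dx 3 (by omega) τ hτ x)).add
      (((dx 1 (by omega) τ hτ x).mul ((dx 2 (by omega) τ hτ x).fun_pow 2)).const_mul _)).congr_deriv ?_
    push_cast; ring
  · ring

lemma J4_deriv (hd : Dens f) {α : ℝ} (hα : 0 < α) {s : ℝ}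
    (hI : Integrable (fun x => P f 0 s x ^ α)) {t : ℝ} (ht : 0 < t) (hts : t < s) :
    HasDerivAt (J f α (fun τ x => v f 1 τ x ^ 4))
    (-6 * J f α (fun τ x => v f 1 τ x ^ 2 * v f 2 τ x ^ 2) t
      + 3 * (α - 4) * (α - 5) / 10 * J f α (fun τ x => v f 1 τ x ^ 6) t) t := by
  have g1 := Good.v hd 1
  have g2 := Good.v hd 2
  have g3 := Good.v hd 3
  have gc := Good.const hd
  have dx := fun k hk τ hτ x => v_deriv_x hd.int hd.nn hd.one k hk (t := τ) hτ x
  have h := J_deriv hd hα hI (g1.pow hd 4)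
    (F' := fun τ x => 2 * v f 1 τ x ^ 3 * (v f 3 τ x - v f 1 τ x * v f 2 τ x))
    (((gc 2).mul hd (g1.pow hd 3)).mul hd (g3.sub hd (g1.mul hd g2)))
    (fun τ hτ x => ((v_deriv_t hd.int hd.nn hd.one 1 (by omega) hτ x).fun_pow 4).congr_deriv
      (by push_cast; ring)) ht hts
  refine h.congr_deriv ?_
  have ga := ((gc (-6)).mul hd ((g1.pow hd 2).mul hd (g2.pow hd 2)))
  have gb := ((gc (3 * (α - 4) * (α - 5) / 10)).mul hd (g1.pow hd 6))
  rw [← J_smul, ← J_smul, ← J_add hd hα hI ga gb ht hts]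
  refine J_ibp hd hα hI
    (F := fun τ x => 2 * (v f 1 τ x ^ 3 * v f 2 τ x) + -(3 * (α - 4) / 10) * v f 1 τ x ^ 5)
    (F' := fun τ x => 2 * (3 * v f 1 τ x ^ 2 * (v f 2 τ x - v f 1 τ x * v f 1 τ x) * v f 2 τ x
        + v f 1 τ x ^ 3 * (v f 3 τ x - v f 2 τ x * v f 1 τ x))
        + -(3 * (α - 4) / 10) * (5 * v f 1 τ x ^ 4 * (v f 2 τ x - v f 1 τ x * v f 1 τ x)))
    (((gc 2).mul hd ((g1.pow hd 3).mul hd g2)).add hd ((gc _).mul hd (g1.pow hd 5)))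
    (((gc 2).mul hd (((((gc 3).mul hd (g1.pow hd 2)).mul hd (g2.sub hd (g1.mul hd g1))).mul hd
      g2).add hd ((g1.pow hd 3).mul hd (g3.sub hd (g2.mul hd g1))))).add hd
      ((gc _).mul hd (((gc 5).mul hd (g1.pow hd 4)).mul hd (g2.sub hd (g1.mul hd g1)))))
    (ga.add hd gb)
    (fun τ hτ x => ?_) ht hts (fun x => ?_)
  · refine (((((dx 1 (by omega) τ hτ x).fun_pow 3).mul (dx 2 (by omega) τ hτ x)).const_mul 2).add
      (((dx 1 (by omega) τ hτ x).fun_pow 5).const_mul _)).congr_deriv ?_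
    push_cast; ring
  · ring

lemma J0_pos (hd : Dens f) {α : ℝ} (hα : 0 < α) {s : ℝ}
    (hI : Integrable (fun x => P f 0 s x ^ α)) {t : ℝ} (ht : 0 < t) (hts : t < s) :
    0 < J f α (fun _ _ => 1) t := by
  have hi := (Good.const hd 1).integrable hd hα hI ht hts
  unfold J
  have hp : ∀ x, 0 < (1 : ℝ) * P f 0 t x ^ α := fun x => by
    rw [one_mul]; exact Real.rpow_pos_of_pos (P0_pos hd.int hd.nn hd.one ht x) α
  rw [integral_pos_iff_support_of_nonneg (fun x => (hp x).le) hi]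
  have : (Function.support fun x => (1 : ℝ) * P f 0 t x ^ α) = Set.univ := by
    ext x; simpa [Function.mem_support] using (by simpa using (hp x).ne')
  rw [this]
  simp

end main

end RenyiAux

/-- Third-order derivative of the Rényi entropy along the heat flow. -/
theorem renyi_third_derivative
    (f : ℝ → ℝ) (hfm : Measurable f) (hf0 : ∀ x, 0 ≤ f x)
    (hf1 : (∫ x : ℝ, f x) = 1)
    (α : ℝ) (hα : 0 < α) (hα1 : α ≠ 1)
    (t : ℝ) (ht : 0 < t) (htα : ltTalpha f α t) :
    DifferentiableAt ℝ (fun s => renyiEnt f α s) t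
    ∧ DifferentiableAt ℝ (deriv (fun s => renyiEnt f α s)) t
    ∧ HasDerivAt (deriv (deriv (fun s => renyiEnt f α s)))
      (α / 12 *
        (3 * (α - 2) * (α - 3) * (α - 4) * (α - 5) / 10
            * Ea f α t (fun x => (pbar f 1 t x) ^ 6)
          - 9 * (α - 2) * (α - 3)
            * Ea f α t (fun x => (pbar f 1 t x) ^ 2 * (pbar f 2 t x) ^ 2)
          + 3 / 2 * α * (α - 1) * (α - 2) * (α - 3)
            * Ea f α t (fun x => (pbar f 1 t x) ^ 4)
            * Ea f α t (fun x => (pbar f 1 t x) ^ 2)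
          - 6 * (α - 2) * Ea f α t (fun x => (pbar f 2 t x) ^ 3)
          + 6 * Ea f α t (fun x => (pbar f 3 t x) ^ 2)
          - 9 * α * (α - 1) * Ea f α t (fun x => (pbar f 1 t x) ^ 2)
            * Ea f α t (fun x => (pbar f 2 t x) ^ 2)
          + 3 * α ^ 2 * (α - 1) ^ 2 * (Ea f α t (fun x => (pbar f 1 t x) ^ 2)) ^ 3)) t := by
  have hd : RenyiAux.Dens f := ⟨by
    by_contra h
    rw [integral_undef h] at hf1
    exact zero_ne_one hf1, hf0, hf1⟩
  obtain ⟨s, hts, hs, hfin⟩ := htα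
  simp only [renyiFinite, if_neg hα1] at hfin
  have hI := hfin.1
  rw [RenyiAux.heatP_eq] at hI
  have hent : (fun s => renyiEnt f α s) =
      fun τ => (1 - α)⁻¹ * Real.log (RenyiAux.J f α (fun _ _ => 1) τ) := by
    funext τ
    simp only [renyiEnt, if_neg hα1, RenyiAux.J, one_mul, RenyiAux.heatP_eq]
  have hα1' : 1 - α ≠ 0 := sub_ne_zero.2 (Ne.symm hα1)
  have hv : ∀ k, k ≤ 4 → ∀ x, pbar f k t x = RenyiAux.v f k t x := fun k hk x => by
    rw [pbar, RenyiAux.pk_eq hd.int k hk ht, RenyiAux.heatP_eq, RenyiAux.v]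
  set I := RenyiAux.J f α (fun _ _ => 1) with hIdef
  set A := RenyiAux.J f α (fun τ x => RenyiAux.v f 1 τ x ^ 2) with hA
  set B := RenyiAux.J f α (fun τ x => RenyiAux.v f 2 τ x ^ 2) with hB
  set Q := RenyiAux.J f α (fun τ x => RenyiAux.v f 1 τ x ^ 4) with hQ
  have dI : ∀ τ, 0 < τ → τ < s → HasDerivAt I (-(α * (α - 1) / 2) * A τ) τ :=
    fun τ h1 h2 => RenyiAux.J0_deriv hd hα hI h1 h2
  have dA : ∀ τ, 0 < τ → τ < s → HasDerivAt A (-B τ + (α - 2) * (α - 3) / 6 * Q τ) τ :=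
    fun τ h1 h2 => RenyiAux.J1_deriv hd hα hI h1 h2
  have dB := RenyiAux.J22_deriv hd hα hI ht hts
  have dQ := RenyiAux.J4_deriv hd hα hI ht hts
  have pI : ∀ τ, 0 < τ → τ < s → 0 < I τ := fun τ h1 h2 => RenyiAux.J0_pos hd hα hI h1 h2
  have d1 : ∀ τ, 0 < τ → τ < s →
      HasDerivAt (fun s => renyiEnt f α s) (α / 2 * (A τ / I τ)) τ := fun τ h1 h2 => by
    rw [hent]
    refine (((dI τ h1 h2).log (pI τ h1 h2).ne').const_mul _).congr_deriv ?_
    have := (pI τ h1 h2).ne'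
    field_simp
    ring
  have hnear : ∀ τ, 0 < τ → τ < s → ∀ᶠ u in nhds τ, 0 < u ∧ u < s := fun τ h1 h2 =>
    (Ioo_mem_nhds h1 h2 : Set.Ioo 0 s ∈ nhds τ)
  have d2 : ∀ τ, 0 < τ → τ < s →
      HasDerivAt (deriv (fun s => renyiEnt f α s))
        (α / 2 * ((-B τ + (α - 2) * (α - 3) / 6 * Q τ) / I τ
          + α * (α - 1) / 2 * (A τ / I τ) ^ 2)) τ := fun τ h1 h2 => by
    have := (pI τ h1 h2).ne'
    have e : deriv (fun s => renyiEnt f α s) =ᶠ[nhds τ] fun u => α / 2 * (A u / I u) := by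
      filter_upwards [hnear τ h1 h2] with u hu
      exact (d1 u hu.1 hu.2).deriv
    refine HasDerivAt.congr_of_eventuallyEq ?_ e
    refine (((dA τ h1 h2).div (dI τ h1 h2) this).const_mul _).congr_deriv ?_
    field_simp
    ring
  refine ⟨(d1 t ht hts).differentiableAt, (d2 t ht hts).differentiableAt, ?_⟩
  have e : deriv (deriv (fun s => renyiEnt f α s)) =ᶠ[nhds t] fun τ =>
      α / 2 * ((-B τ + (α - 2) * (α - 3) / 6 * Q τ) / I τ
          + α * (α - 1) / 2 * (A τ / I τ) ^ 2) := by
    filter_upwards [hnear t ht hts] with u hu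
    exact (d2 u hu.1 hu.2).deriv
  refine HasDerivAt.congr_of_eventuallyEq ?_ e
  have hne := (pI t ht hts).ne'
  have hE : ∀ F : ℝ → ℝ → ℝ, Ea f α t (F t) = RenyiAux.J f α F t / I t := fun F => by
    simp only [Ea, hIdef, RenyiAux.J, one_mul, RenyiAux.heatP_eq]
  simp only [hv 1 (by omega), hv 2 (by omega), hv 3 (by omega)]
  rw [hE (fun τ x => RenyiAux.v f 1 τ x ^ 6),
    hE (fun τ x => RenyiAux.v f 1 τ x ^ 2 * RenyiAux.v f 2 τ x ^ 2),
    hE (fun τ x => RenyiAux.v f 1 τ x ^ 4), hE (fun τ x => RenyiAux.v f 1 τ x ^ 2),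
    hE (fun τ x => RenyiAux.v f 2 τ x ^ 3), hE (fun τ x => RenyiAux.v f 3 τ x ^ 2),
    hE (fun τ x => RenyiAux.v f 2 τ x ^ 2), ← hA, ← hB, ← hQ]
  refine ((((dB.neg.add (dQ.const_mul ((α - 2) * (α - 3) / 6))).div (dI t ht hts) hne).add
    ((((dA t ht hts).div (dI t ht hts) hne).fun_pow 2).const_mul
      (α * (α - 1) / 2))).const_mul (α / 2)).congr_deriv ?_
  simp only [Pi.add_apply, Pi.neg_apply, Pi.div_apply]
  generalize RenyiAux.J f α (fun τ x => RenyiAux.v f 1 τ x ^ 6) t = x1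
  generalize RenyiAux.J f α (fun τ x => RenyiAux.v f 1 τ x ^ 2 * RenyiAux.v f 2 τ x ^ 2) t = x2
  generalize RenyiAux.J f α (fun τ x => RenyiAux.v f 2 τ x ^ 3) t = x3
  generalize RenyiAux.J f α (fun τ x => RenyiAux.v f 3 τ x ^ 2) t = x4
  push_cast
  field_simp
  ring
end
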